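/- Let f be a critically fixed rational map with charge graph G and let S be a spanning tree of G with edge set {e₁, …, e_n}. For any simple closed curve γ in Ĉ \ C_f, the total complexity of the pullbacks of γ under f is at most the complexity of γ: Σ_{δ ∈ Δ(γ)} δ·S ≤ γ·S. -/

import Mathlib

open Topology

/-- A subset `A` of a topological space is a (Jordan) arc from `x` to `y` if it is the image
of an injective path from `x` to `y`, with `x ≠ y`. -/
def IsArc {S : Type*} [TopologicalSpace S] (A : Set S) (x y : S) : Prop :=
  x ≠ y ∧ ∃ γ : Path x y, Function.Injective γ ∧ Set.range γ = A

/-- A subset of a topological space is a simple closed (Jordan) curve if it is homeomorphic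
to the circle. -/
def IsSimpleClosedCurve {S : Type*} [TopologicalSpace S] (A : Set S) : Prop :=
  Nonempty (A ≃ₜ Circle)

/-- Two subsets `A`, `B` of a space are (ambient) isotopic rel `P` if there is a continuous
family of bijections of the space starting at the identity, fixing `P` pointwise, and
carrying `A` to `B` at time `1`. -/
def IsotopicRel {S : Type*} [TopologicalSpace S] (A B P : Set S) : Prop :=
  ∃ H : C(ℝ × S, S), (∀ x, H (0, x) = x) ∧ (∀ t, Function.Bijective fun x => H (t, x)) ∧
    (∀ t, ∀ p ∈ P, H (t, p) = p) ∧ (fun x => H (1, x)) '' A = B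

/-- The intersection number of the set `A` (e.g. a simple closed curve) with the arc `e`,
relative to the marked set `P`: the minimal number of intersection points with `e` among
sets isotopic to `A` rel `P`. -/
noncomputable def interNum {S : Type*} [TopologicalSpace S] (A e P : Set S) : ℕ :=
  sInf {n : ℕ | ∃ A' : Set S, IsotopicRel A A' P ∧ (A' ∩ e).Finite ∧ (A' ∩ e).ncard = n}

/-- `f` has local degree `k` at `v`: on arbitrarily small neighbourhoods of `v`, every value
close to `f v` (other than `f v` itself) is attained exactly `k` times. -/
def HasLocalDegree {S : Type*} [TopologicalSpace S] (f : S → S) (v : S) (k : ℕ) : Prop :=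
  ∀ U ∈ 𝓝 v, ∃ W ∈ 𝓝 v, W ⊆ U ∧
    ∀ y ∈ (f '' W) \ {f v}, Nat.card {x : S // x ∈ W ∧ f x = y} = k

/-- The data of a planar embedded graph (without loops) on the sphere `S` together with a
map `toFun` obtained from the identity by blowing up the edges of the graph in the sense of
Pilgrim–Tan Lei. The fields record the conditions (B1)–(B8) of the blow-up construction:
each edge `edge j` is an arc between two distinct vertices, edges meet only at vertices,
each edge is replaced by a closed Jordan region `patch j` whose boundary consists of two
arcs `side1 j`, `side2 j` isotopic to `edge j` rel the vertex set, patches meet only where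
the corresponding edges do, `toFun` fixes the vertices, maps each boundary arc of a patch
homeomorphically onto the corresponding edge, maps the interior of each patch
homeomorphically onto the complement of its edge, and maps the complement of the patches
homeomorphically onto the complement of the realization of the graph. -/
structure BlowupData (S : Type*) [TopologicalSpace S] where
  /-- number of edges -/
  n : ℕ
  /-- the vertex set -/
  Vset : Finset S
  /-- endpoints of each edge -/
  ends : Fin n → S × S
  /-- the edges -/
  edge : Fin n → Set S
  /-- the closed Jordan region patches glued in along the edges -/
  patch : Fin n → Set S
  /-- the blow-up map -/
  toFun : S → S
  continuous_toFun : Continuous toFun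
  ends_mem : ∀ j, (ends j).1 ∈ Vset ∧ (ends j).2 ∈ Vset
  edge_isArc : ∀ j, IsArc (edge j) (ends j).1 (ends j).2
  edge_inter : ∀ j k, j ≠ k →
    (edge j ∩ edge k) ⊆ {(ends j).1, (ends j).2} ∩ {(ends k).1, (ends k).2}
  patch_compact : ∀ j, IsCompact (patch j)
  patch_closed : ∀ j, IsClosed (patch j)
  /-- the two boundary arcs of each patch -/
  side1 : Fin n → Set S
  side2 : Fin n → Set S
  -- (B1)
  frontier_patch : ∀ j, frontier (patch j) = side1 j ∪ side2 j
  side1_isArc : ∀ j, IsArc (side1 j) (ends j).1 (ends j).2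
  side2_isArc : ∀ j, IsArc (side2 j) (ends j).1 (ends j).2
  side_inter : ∀ j, side1 j ∩ side2 j = {(ends j).1, (ends j).2}
  -- (B2)
  side1_isotopic : ∀ j, IsotopicRel (side1 j) (edge j) ↑Vset
  side2_isotopic : ∀ j, IsotopicRel (side2 j) (edge j) ↑Vset
  -- (B3)
  patch_inter : ∀ j k, j ≠ k → patch j ∩ patch k = edge j ∩ edge k
  -- (B5)
  fixes_vertices : ∀ v ∈ Vset, toFun v = v
  -- (B6)
  maps_side1 : ∀ j, Set.BijOn toFun (side1 j) (edge j)
  maps_side2 : ∀ j, Set.BijOn toFun (side2 j) (edge j)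
  -- (B7): the complement of the patches maps bijectively onto the complement of the
  -- realization of the graph (face by face)
  maps_complement : Set.BijOn toFun (⋃ j, patch j)ᶜ (⋃ j, edge j)ᶜ
  -- (B8)
  maps_patch : ∀ j, Set.BijOn toFun (interior (patch j)) (edge j)ᶜ

/-- The degree of a vertex `v` in the graph underlying a blow-up datum: the number of edges
incident to `v`. -/
noncomputable def BlowupData.degG {S : Type*} [TopologicalSpace S] (bd : BlowupData S)
    (v : S) : ℕ :=
  Nat.card {j : Fin bd.n // (bd.ends j).1 = v ∨ (bd.ends j).2 = v}

/-- The realization of the graph underlying a blow-up datum. -/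
def BlowupData.realization {S : Type*} [TopologicalSpace S] (bd : BlowupData S) : Set S :=
  ⋃ j, bd.edge j

noncomputable section
open Polynomial OnePoint

/-- The Riemann sphere, modelled as the one-point compactification of `ℂ`. -/
abbrev RiemannSphere := OnePoint ℂ

namespace RatSphere

/-- The degree of the rational map determined by `f ∈ ℂ(z)`: the maximum of the degrees of
its (coprime) numerator and denominator. -/
def rdeg (f : RatFunc ℂ) : ℕ := max f.num.natDegree f.denom.natDegree

/-- The rational function `w ↦ f (1/w)`, obtained by reflecting numerator and denominator. -/
def invComp (f : RatFunc ℂ) : RatFunc ℂ :=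
  algebraMap (Polynomial ℂ) (RatFunc ℂ) (Polynomial.reflect (rdeg f) f.num) /
    algebraMap (Polynomial ℂ) (RatFunc ℂ) (Polynomial.reflect (rdeg f) f.denom)

/-- Evaluation of a rational function at a finite point of the sphere, with value `∞` at
poles. -/
def evalFin (f : RatFunc ℂ) (z : ℂ) : RiemannSphere :=
  if f.denom.eval z = 0 then ∞ else ((f.num.eval z / f.denom.eval z : ℂ) : RiemannSphere)

/-- The self-map of the Riemann sphere induced by a rational function. -/
def evalSphere (f : RatFunc ℂ) (z : RiemannSphere) : RiemannSphere :=
  OnePoint.rec (evalFin (invComp f) 0) (evalFin f) z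

/-- The local degree of the rational map `f` at a finite point `z`: the order of vanishing of
`f - f z` at `z` if `z` is not a pole, and the order of the pole otherwise. -/
def locDegFin (f : RatFunc ℂ) (z : ℂ) : ℕ :=
  if f.denom.eval z = 0 then Polynomial.rootMultiplicity z f.denom
  else Polynomial.rootMultiplicity z (f - RatFunc.C (f.num.eval z / f.denom.eval z)).num

/-- The local degree of the rational map `f` at a point of the Riemann sphere (at `∞` it is
computed in the coordinate `w = 1/z`). -/
def locDeg (f : RatFunc ℂ) (z : RiemannSphere) : ℕ :=
  OnePoint.rec (locDegFin (invComp f) 0) (locDegFin f) z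

/-- The multiplicity of `z` as a fixed point of `f`: the order of vanishing of `f(w) - w` at
`w = z` for finite `z`, and at `∞` the order of vanishing of `1/f(1/w) - w` at `w = 0`. -/
def fixMult (f : RatFunc ℂ) (z : RiemannSphere) : ℕ :=
  OnePoint.rec (Polynomial.rootMultiplicity 0 ((invComp f)⁻¹ - RatFunc.X).num)
    (fun w => Polynomial.rootMultiplicity w (f - RatFunc.X).num) z

/-- A rational map is critically fixed if each critical point (point of local degree `≥ 2`)
is a fixed point. -/
def CriticallyFixed (f : RatFunc ℂ) : Prop :=
  ∀ z : RiemannSphere, 2 ≤ locDeg f z → evalSphere f z = z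

end RatSphere

open RatSphere

/-- The set of pullbacks of a curve `Γ` under `f`: the connected components of the preimage
`f ⁻¹' Γ`. -/
def pullbacks (f : RiemannSphere → RiemannSphere) (Γ : Set RiemannSphere) :
    Set (Set RiemannSphere) :=
  {δ | ∃ x ∈ f ⁻¹' Γ, δ = connectedComponentIn (f ⁻¹' Γ) x}

/-- The complexity of a curve `A` relative to the spanning-tree edges `T` of the blow-up
datum `bd`: the sum of the intersection numbers of `A` with the tree edges, rel the
vertex set. -/
noncomputable def complexity (bd : BlowupData RiemannSphere) (T : Finset (Fin bd.n))
    (A : Set RiemannSphere) : ℕ :=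
  ∑ j ∈ T, interNum A (bd.edge j) ↑bd.Vset

namespace PCL

/-! ### Continuous logarithms -/

def HasLog {X : Type*} [TopologicalSpace X] (f : X → ℂ) (K : Set X) : Prop :=
  ∃ g : X → ℂ, ContinuousOn g K ∧ ∀ z ∈ K, Complex.exp (g z) = f z

section log
variable {X Y : Type*} [TopologicalSpace X] [TopologicalSpace Y]

theorem HasLog.mono {f : X → ℂ} {K L : Set X} (h : HasLog f K) (hL : L ⊆ K) : HasLog f L := by
  obtain ⟨g, hg, h⟩ := h
  exact ⟨g, hg.mono hL, fun z hz => h z (hL hz)⟩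

theorem HasLog.congr {f f' : X → ℂ} {K : Set X} (h : HasLog f K) (hf : ∀ z ∈ K, f z = f' z) :
    HasLog f' K := by
  obtain ⟨g, hg, h⟩ := h
  exact ⟨g, hg, fun z hz => (h z hz).trans (hf z hz)⟩

theorem HasLog.mul {f f' : X → ℂ} {K : Set X} (h : HasLog f K) (h' : HasLog f' K) :
    HasLog (fun z => f z * f' z) K := by
  obtain ⟨g, hg, h⟩ := h
  obtain ⟨g', hg', h'⟩ := h'
  exact ⟨fun z => g z + g' z, hg.add hg', fun z hz => by rw [Complex.exp_add, h z hz, h' z hz]⟩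

theorem HasLog.inv {f : X → ℂ} {K : Set X} (h : HasLog f K) : HasLog (fun z => (f z)⁻¹) K := by
  obtain ⟨g, hg, h⟩ := h
  exact ⟨fun z => - g z, hg.neg, fun z hz => by rw [Complex.exp_neg, h z hz]⟩

theorem HasLog.div {f f' : X → ℂ} {K : Set X} (h : HasLog f K) (h' : HasLog f' K) :
    HasLog (fun z => f z / f' z) K := by
  simpa only [div_eq_mul_inv] using h.mul h'.inv

theorem HasLog.zpow {f : X → ℂ} {K : Set X} (h : HasLog f K) (n : ℤ) :
    HasLog (fun z => (f z) ^ n) K := by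
  obtain ⟨g, hg, h⟩ := h
  exact ⟨fun z => n * g z, continuousOn_const.mul hg, fun z hz => by
    rw [Complex.exp_int_mul, h z hz]⟩

theorem HasLog.comp {f : X → ℂ} {K : Set X} (h : HasLog f K) {u : Y → X} {L : Set Y}
    (hu : ContinuousOn u L) (hm : Set.MapsTo u L K) : HasLog (fun y => f (u y)) L := by
  obtain ⟨g, hg, h⟩ := h
  exact ⟨fun y => g (u y), hg.comp hu hm, fun z hz => h _ (hm hz)⟩

theorem HasLog.const {c : ℂ} (hc : c ≠ 0) (K : Set X) : HasLog (fun _ => c) K :=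
  ⟨fun _ => Complex.log c, continuousOn_const, fun _ _ => Complex.exp_log hc⟩

theorem hasLog_of_near {f : X → ℂ} {K : Set X} (hf : ContinuousOn f K)
    (h : ∀ z ∈ K, ‖f z - 1‖ < 1) : HasLog f K := by
  have hs : ∀ z ∈ K, f z ∈ Complex.slitPlane := fun z hz => by
    have := Complex.mem_slitPlane_of_norm_lt_one (h z hz)
    simpa using this
  refine ⟨fun z => Complex.log (f z), hf.clog hs, fun z hz => Complex.exp_log ?_⟩
  exact Complex.slitPlane_ne_zero (hs z hz)

theorem hasLog_near_const {f : X → ℂ} {K : Set X} (hf : ContinuousOn f K) (c : ℂ) (hc : c ≠ 0)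
    (h : ∀ z ∈ K, ‖f z - c‖ < ‖c‖) : HasLog f K := by
  have : HasLog (fun z => f z / c) K := by
    refine hasLog_of_near (hf.div_const c) fun z hz => ?_
    have : f z / c - 1 = (f z - c) / c := by field_simp
    rw [this, norm_div, div_lt_one (norm_pos_iff.2 hc)]
    exact h z hz
  refine ((this.mul (HasLog.const hc K))).congr fun z _ => ?_
  field_simp

theorem hasLog_shift {K : Set ℂ} {a b : ℂ} (h : ∀ z ∈ K, ‖a - b‖ < ‖z - a‖) :
    HasLog (fun z => (z - b) / (z - a)) K := by
  have hne : ∀ z ∈ K, z - a ≠ 0 := fun z hz => by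
    have := h z hz
    exact norm_pos_iff.1 (lt_of_le_of_lt (norm_nonneg _) this)
  refine hasLog_of_near ?_ fun z hz => ?_
  · exact ContinuousOn.div (by fun_prop) (by fun_prop) hne
  · have h1 := hne z hz
    have : (z - b) / (z - a) - 1 = (a - b) / (z - a) := by field_simp; ring
    rw [this, norm_div, div_lt_one (norm_pos_iff.2 h1)]
    exact h z hz

theorem int_const {S : Set X} (hS : IsPreconnected S) {g : X → ℂ} (hg : ContinuousOn g S)
    (h : ∀ z ∈ S, Complex.exp (g z) = 1) {x y : X} (hx : x ∈ S) (hy : y ∈ S) : g x = g y := by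
  refine hS.induction₂ (fun x y => g x = g y) (fun x hx => ?_) (fun _ _ _ _ _ _ h h' => h.trans h')
    (fun _ _ _ _ h => h.symm) hx hy
  have h1 := Metric.continuousWithinAt_iff'.1 (hg x hx) 1 one_pos
  filter_upwards [h1, self_mem_nhdsWithin] with y hy hyS
  obtain ⟨m, hm⟩ := Complex.exp_eq_one_iff.1 (h x hx)
  obtain ⟨n, hn⟩ := Complex.exp_eq_one_iff.1 (h y hyS)
  have h2 : g y - g x = ((n - m : ℤ) : ℂ) * (2 * Real.pi * Complex.I) := by
    rw [hm, hn]; push_cast; ring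
  rw [dist_eq_norm, h2] at hy
  have h3 : ‖(2 * Real.pi * Complex.I : ℂ)‖ = 2 * Real.pi := by
    simp [abs_of_pos Real.pi_pos]
  rw [norm_mul, h3, Complex.norm_intCast] at hy
  have hpi := Real.pi_gt_three
  have h4 : |((n - m : ℤ) : ℝ)| < 1 := by
    by_contra hcon
    push Not at hcon
    nlinarith
  have h5 : n - m = 0 := by
    have : |n - m| < 1 := by exact_mod_cast h4
    exact Int.abs_lt_one_iff.1 this
  rw [h5] at h2
  have : g y - g x = 0 := by simpa using h2
  exact (sub_eq_zero.1 this).symm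

theorem glue_cont {K₁ K₂ : Set X} (h₁ : IsClosed K₁) (h₂ : IsClosed K₂) {g₁ g₂ : X → Y}
    (hg₁ : ContinuousOn g₁ K₁) (hg₂ : ContinuousOn g₂ K₂) (h : ∀ z ∈ K₁ ∩ K₂, g₁ z = g₂ z) :
    ∃ g : X → Y, ContinuousOn g (K₁ ∪ K₂) ∧ (∀ z ∈ K₁, g z = g₁ z) ∧ (∀ z ∈ K₂, g z = g₂ z) := by
  classical
  refine ⟨fun z => if z ∈ K₁ then g₁ z else g₂ z, ?_, fun z hz => by simp [hz], fun z hz => ?_⟩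
  · refine ContinuousOn.union_of_isClosed (hg₁.congr fun z hz => by simp [hz])
      (hg₂.congr fun z hz => ?_) h₁ h₂
    by_cases hz1 : z ∈ K₁
    · simp [hz1, h z ⟨hz1, hz⟩]
    · simp [hz1]
  · by_cases hz1 : z ∈ K₁
    · simp [hz1, h z ⟨hz1, hz⟩]
    · simp [hz1]

theorem HasLog.glue {K₁ K₂ : Set X} (h₁ : IsClosed K₁) (h₂ : IsClosed K₂)
    (hc : IsPreconnected (K₁ ∩ K₂)) {f : X → ℂ} (hf₁ : HasLog f K₁) (hf₂ : HasLog f K₂) :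
    HasLog f (K₁ ∪ K₂) := by
  obtain ⟨g₁, hg₁, e₁⟩ := hf₁
  obtain ⟨g₂, hg₂, e₂⟩ := hf₂
  have hex : ∀ z ∈ K₁ ∩ K₂, Complex.exp (g₁ z - g₂ z) = 1 := fun z hz => by
    rw [Complex.exp_sub, e₁ z hz.1, e₂ z hz.2, div_self]
    rw [← e₁ z hz.1]; exact Complex.exp_ne_zero _
  have : ∃ c : ℂ, Complex.exp c = 1 ∧ ∀ z ∈ K₁ ∩ K₂, g₁ z = g₂ z + c := by
    by_cases hne : (K₁ ∩ K₂).Nonempty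
    · obtain ⟨x, hx⟩ := hne
      refine ⟨g₁ x - g₂ x, hex x hx, fun z hz => ?_⟩
      have := int_const hc ((hg₁.mono Set.inter_subset_left).sub (hg₂.mono Set.inter_subset_right))
        hex hz hx
      rw [show g₁ x - g₂ x = g₁ z - g₂ z from this.symm]; ring
    · exact ⟨0, by simp, fun z hz => absurd ⟨z, hz⟩ hne⟩
  obtain ⟨c, hc1, hc2⟩ := this
  obtain ⟨g, hg, a1, a2⟩ := glue_cont h₁ h₂ hg₁ (hg₂.add (continuousOn_const (c := c)))
    (fun z hz => hc2 z hz)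
  refine ⟨g, hg, fun z hz => ?_⟩
  rcases hz with hz | hz
  · rw [a1 z hz, e₁ z hz]
  · rw [a2 z hz]
    change Complex.exp (g₂ z + c) = _
    rw [Complex.exp_add, hc1, e₂ z hz, mul_one]

/-- Compact set with an injective real coordinate. -/
theorem hasLog_of_inj [T2Space X] {S : Set X} (hS : IsCompact S) {u : X → ℝ} (hu : ContinuousOn u S)
    (hi : Set.InjOn u S) {f : X → ℂ} (hf : ContinuousOn f S) (h0 : ∀ z ∈ S, f z ≠ 0) :
    HasLog f S := by
  have hScl : ∀ t : Set ℝ, IsClosed t → IsClosed (S ∩ u ⁻¹' t) := fun t ht =>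
    hu.preimage_isClosed_of_isClosed hS.isClosed ht
  have key : ∀ a b : ℝ, HasLog f (S ∩ u ⁻¹' (Set.uIcc a b)) := by
    intro a b
    refine isPreconnected_univ.induction₂ (fun a b => HasLog f (S ∩ u ⁻¹' (Set.uIcc a b)))
      (fun t _ => ?_) ?_ ?_ (Set.mem_univ a) (Set.mem_univ b)
    · have : ∃ O : Set X, IsOpen O ∧ (∀ s ∈ S, u s = t → s ∈ O) ∧ HasLog f (S ∩ O) := by
        by_cases hs : ∃ s ∈ S, u s = t
        · obtain ⟨s, hs, hst⟩ := hs
          have h1 := Metric.continuousWithinAt_iff'.1 (hf s hs) ‖f s‖ (norm_pos_iff.2 (h0 s hs))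
          obtain ⟨O, hO, hsO, hO2⟩ := mem_nhdsWithin.1 h1
          refine ⟨O, hO, fun s' hs' h' => ?_, ?_⟩
          · rw [hi hs' hs (h'.trans hst.symm)]; exact hsO
          · refine hasLog_near_const (hf.mono Set.inter_subset_left) (f s) (h0 s hs) fun z hz => ?_
            have := hO2 ⟨hz.2, hz.1⟩
            simpa [dist_eq_norm] using this
        · push Not at hs
          exact ⟨∅, isOpen_empty, fun s hs' h => absurd h (hs s hs'),
            ⟨0, by simp, by simp⟩⟩
      obtain ⟨O, hO, h1, h2⟩ := this
      have hcomp : IsCompact (u '' (S \ O)) := (hS.diff hO).image_of_continuousOn (hu.mono Set.sdiff_subset)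
      have htn : (u '' (S \ O))ᶜ ∈ 𝓝 t := by
        refine hcomp.isClosed.isOpen_compl.mem_nhds ?_
        rintro ⟨s, hs, hst⟩
        exact hs.2 (h1 s hs.1 hst)
      obtain ⟨ε, hε, hb⟩ := Metric.mem_nhds_iff.1 htn
      rw [nhdsWithin_univ]
      filter_upwards [Metric.ball_mem_nhds t hε] with y hy
      refine h2.mono fun s hs => ⟨hs.1, ?_⟩
      by_contra hsO
      have h3 : u s ∈ Metric.ball t ε := by
        have h4 : Set.uIcc t y ⊆ Metric.ball t ε := by
          rw [← segment_eq_uIcc]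
          exact (convex_ball t ε).segment_subset (Metric.mem_ball_self hε) hy
        exact h4 hs.2
      exact hb h3 ⟨s, ⟨hs.1, hsO⟩, rfl⟩
    · intro a b c _ _ _ hab hbc
      have hsub : ∀ t : ℝ, (S ∩ u ⁻¹' {t}).Subsingleton := fun t x hx y hy =>
        hi hx.1 hy.1 (by rw [hx.2, hy.2])
      by_cases hb : b ∈ Set.uIcc a c
      · have hun : Set.uIcc a c = Set.uIcc a b ∪ Set.uIcc b c := by
          ext x; simp only [Set.mem_uIcc, Set.mem_union] at *; grind
        have hin : Set.uIcc a b ∩ Set.uIcc b c ⊆ {b} := by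
          intro x; simp only [Set.mem_uIcc, Set.mem_inter_iff, Set.mem_singleton_iff] at *; grind
        rw [hun, Set.preimage_union, Set.inter_union_distrib_left]
        refine HasLog.glue (hScl _ isClosed_Icc) (hScl _ isClosed_Icc) ?_ hab hbc
        refine Set.Subsingleton.isPreconnected ((hsub b).anti fun x hx => ⟨hx.1.1, hin ⟨hx.1.2, hx.2.2⟩⟩)
      · have : Set.uIcc a c ⊆ Set.uIcc a b ∨ Set.uIcc a c ⊆ Set.uIcc b c := by
          simp only [Set.mem_uIcc] at hb
          rcases le_total a c with h1 | h1 <;> rcases le_total a b with h2 | h2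
          · left; intro x; simp only [Set.mem_uIcc]; grind
          · right; intro x; simp only [Set.mem_uIcc]; grind
          · right; intro x; simp only [Set.mem_uIcc]; grind
          · left; intro x; simp only [Set.mem_uIcc]; grind
        rcases this with h | h
        · exact hab.mono fun x hx => ⟨hx.1, h hx.2⟩
        · exact hbc.mono fun x hx => ⟨hx.1, h hx.2⟩
    · intro a b _ _ h
      rwa [Set.uIcc_comm]
  obtain ⟨r, hr⟩ := (hS.image_of_continuousOn hu).isBounded.subset_closedBall 0
  refine (key (-r) r).mono fun s hs => ⟨hs, ?_⟩
  have := hr ⟨s, hs, rfl⟩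
  rw [Real.closedBall_eq_Icc] at this
  simp only [zero_sub, zero_add] at this
  exact Set.Icc_subset_uIcc this

theorem hasLog_univ {X : Type*} [TopologicalSpace X] [SimplyConnectedSpace X]
    [LocallyPathConnectedSpace X] {f : X → ℂ} (hf : Continuous f)
    (h0 : ∀ z, f z ≠ 0) : HasLog f Set.univ := by
  have hsc : IsSimplyConnected (Set.univ : Set X) := by
    have h2 : SimplyConnectedSpace (Set.univ : Set X) :=
      (Homeomorph.Set.univ X).toHomotopyEquiv.simplyConnectedSpace
    exact h2
  obtain ⟨g, hg, h⟩ := Complex.exists_continuousOn_eqOn_exp_comp hsc isOpen_univ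
    hf.continuousOn (by rintro ⟨z, -, hz⟩; exact h0 z hz)
  exact ⟨g, hg, fun z hz => h hz⟩

theorem tietze {X : Type*} [TopologicalSpace X] [NormalSpace X] {K : Set X} (hK : IsClosed K)
    {g : X → ℂ} (hg : ContinuousOn g K) : ∃ g' : X → ℂ, Continuous g' ∧ ∀ z ∈ K, g' z = g z := by
  obtain ⟨G, hG⟩ := ContinuousMap.exists_restrict_eq hK ⟨K.domRestrict g, hg.domRestrict⟩
  refine ⟨G, G.continuous, fun z hz => ?_⟩
  have := congrArg (fun φ : C(K, ℂ) => φ ⟨z, hz⟩) hG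
  exact this

theorem hasLog_closedBall {f : ℂ → ℂ} {R : ℝ} (hR : 0 < R)
    (hf : ContinuousOn f (Metric.closedBall 0 R)) (h0 : ∀ z ∈ Metric.closedBall 0 R, f z ≠ 0) :
    HasLog f (Metric.closedBall 0 R) := by
  let r : ℂ → ℂ := fun z => ((R / max R ‖z‖ : ℝ) : ℂ) * z
  have hpos : ∀ z : ℂ, 0 < max R ‖z‖ := fun z => lt_max_of_lt_left hR
  have hr : Continuous r := by
    refine Continuous.mul (Complex.continuous_ofReal.comp ?_) continuous_id
    exact Continuous.div continuous_const (by fun_prop) fun z => (hpos z).ne'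
  have hm : ∀ z, r z ∈ Metric.closedBall (0 : ℂ) R := fun z => by
    rw [mem_closedBall_zero_iff, norm_mul, Complex.norm_real, Real.norm_of_nonneg
      (by have := hpos z; positivity), div_mul_eq_mul_div, div_le_iff₀ (hpos z)]
    exact mul_le_mul_of_nonneg_left (le_max_right _ _) hR.le
  have he : ∀ z ∈ Metric.closedBall (0 : ℂ) R, r z = z := fun z hz => by
    rw [mem_closedBall_zero_iff] at hz
    simp [r, max_eq_left hz, hR.ne']
  have h1 : HasLog (fun z => f (r z)) (Set.univ : Set ℂ) :=
    hasLog_univ (hf.comp_continuous hr hm) fun z => h0 _ (hm z)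
  exact (h1.mono (Set.subset_univ _)).congr fun z hz => by rw [he z hz]

theorem no_log_sphere (p : ℂ) {r : ℝ} (hr : 0 < r) :
    ¬ HasLog (fun z => z - p) (Metric.sphere p r) := by
  rintro ⟨g, hg, h⟩
  have hm : ∀ t : ℝ, p + r * Complex.exp (t * Complex.I) ∈ Metric.sphere p r := fun t => by
    simp [Complex.norm_exp_ofReal_mul_I, abs_of_pos hr]
  let k : ℝ → ℂ := fun t => g (p + r * Complex.exp (t * Complex.I)) - t * Complex.I - Complex.log r
  have hk : Continuous k := by
    refine Continuous.sub (Continuous.sub (hg.comp_continuous (by fun_prop) hm) (by fun_prop))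
      continuous_const
  have hr' : (r : ℂ) ≠ 0 := by exact_mod_cast hr.ne'
  have := int_const isPreconnected_univ hk.continuousOn (fun t _ => by
    simp only [k]
    rw [Complex.exp_sub, Complex.exp_sub, h _ (hm t), Complex.exp_log hr']
    have := Complex.exp_ne_zero (t * Complex.I)
    field_simp
    ring) (Set.mem_univ 0) (Set.mem_univ (2 * Real.pi))
  simp [k] at this
  have h2 : (2 * Real.pi * Complex.I : ℂ) = 0 := by linear_combination this
  simp at h2

theorem hasLog_sphere_sub {p : ℂ} {r : ℝ} (hr : 0 < r) {K : Set ℂ} (hK : IsClosed K)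
    (hKs : K ⊆ Metric.sphere p r) {f : ℂ → ℂ} (hf : ContinuousOn f K) (h0 : ∀ z ∈ K, f z ≠ 0) :
    ∃ n : ℤ, HasLog (fun z => f z * (z - p) ^ n) K := by
  have hKc : IsCompact K := (isCompact_sphere p r).of_isClosed_subset hK hKs
  have hcA : IsClosed {z : ℂ | 0 ≤ (z - p).im} := isClosed_le (by fun_prop) (by fun_prop)
  have hcB : IsClosed {z : ℂ | (z - p).im ≤ 0} := isClosed_le (by fun_prop) (by fun_prop)
  set A := K ∩ {z : ℂ | 0 ≤ (z - p).im} with hA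
  set B := K ∩ {z : ℂ | (z - p).im ≤ 0} with hB
  have hAB : A ∪ B = K := by
    rw [hA, hB, ← Set.inter_union_distrib_left, Set.inter_eq_left]
    intro z _
    exact le_total (0:ℝ) (z - p).im
  have hsq : ∀ z ∈ K, (z - p).re ^ 2 + (z - p).im ^ 2 = r ^ 2 := fun z hz => by
    have := hKs hz
    rw [mem_sphere_iff_norm] at this
    rw [← this, ← Complex.normSq_eq_norm_sq, Complex.normSq_apply]; ring
  have hAc : IsClosed A := hK.inter hcA
  have hBc : IsClosed B := hK.inter hcB
  obtain ⟨gA, hgA, eA⟩ : HasLog f A := by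
    refine hasLog_of_inj (hKc.inter_right hcA) (u := fun z => (z - p).re) (by fun_prop) ?_
      (hf.mono Set.inter_subset_left) fun z hz => h0 z hz.1
    intro x hx y hy hxy
    have h1 := hsq x hx.1
    have h2 := hsq y hy.1
    have h3 : 0 ≤ (x - p).im := hx.2
    have h4 : 0 ≤ (y - p).im := hy.2
    simp only at hxy
    have h5 : (x - p).im = (y - p).im := by
      rw [hxy] at h1; exact (sq_eq_sq₀ h3 h4).1 (by linarith)
    exact sub_left_injective (Complex.ext hxy h5)
  obtain ⟨gB, hgB, eB⟩ : HasLog f B := by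
    refine hasLog_of_inj (hKc.inter_right hcB) (u := fun z => (z - p).re) (by fun_prop) ?_
      (hf.mono Set.inter_subset_left) fun z hz => h0 z hz.1
    intro x hx y hy hxy
    have h1 := hsq x hx.1
    have h2 := hsq y hy.1
    have h3 : (x - p).im ≤ 0 := hx.2
    have h4 : (y - p).im ≤ 0 := hy.2
    simp only at hxy
    have h5 : (x - p).im = (y - p).im := by
      rw [hxy] at h1
      have := (sq_eq_sq₀ (neg_nonneg.2 h3) (neg_nonneg.2 h4)).1 (by nlinarith)
      linarith
    exact sub_left_injective (Complex.ext hxy h5)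
  have hinter0 : ∀ z ∈ A ∩ B, z = p + r ∨ z = p - r := by
    rintro z ⟨hzA, hzB⟩
    have h1 := hsq z hzA.1
    have h3 : 0 ≤ (z - p).im := hzA.2
    have h4 : (z - p).im ≤ 0 := hzB.2
    have h5 : (z - p).im = 0 := le_antisymm h4 h3
    rw [h5] at h1
    have h6 : (z - p).re = r ∨ (z - p).re = -r := sq_eq_sq_iff_eq_or_eq_neg.1 (by linarith)
    rcases h6 with h6 | h6
    · left
      have : z - p = r := Complex.ext (by simpa using h6) (by simpa using h5)
      rw [← this]; ring
    · right
      have : z - p = -r := Complex.ext (by simpa using h6) (by simpa using h5)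
      linear_combination this
  have hex : ∀ z ∈ A ∩ B, ∃ n : ℤ, gA z - gB z = n * (2 * Real.pi * Complex.I) := fun z hz => by
    refine Complex.exp_eq_one_iff.1 ?_
    rw [Complex.exp_sub, eA z hz.1, eB z hz.2, div_self (h0 z hz.1.1)]
  by_cases hboth : p + r ∈ A ∩ B ∧ p - r ∈ A ∩ B
  · obtain ⟨c1, hc1⟩ := hex _ hboth.1
    obtain ⟨c2, hc2⟩ := hex _ hboth.2
    let n : ℤ := c1 - c2
    have hw0 : ∀ z ∈ K, z - p ≠ 0 := fun z hz h => by
      have := hKs hz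
      rw [mem_sphere_iff_norm, h] at this
      simp at this; exact hr.ne this
    let lA : ℂ → ℂ := fun z => Complex.log (-Complex.I * (z - p)) + Real.pi / 2 * Complex.I
    let lB : ℂ → ℂ := fun z => Complex.log (Complex.I * (z - p)) + 3 * Real.pi / 2 * Complex.I
    have hexpA : Complex.exp (Real.pi / 2 * Complex.I) = Complex.I := Complex.exp_pi_div_two_mul_I
    have hexpB : Complex.exp (3 * Real.pi / 2 * Complex.I) = - Complex.I := by
      have : (3 * Real.pi / 2 * Complex.I : ℂ) = Real.pi * Complex.I + Real.pi / 2 * Complex.I := by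
        ring
      rw [this, Complex.exp_add, Complex.exp_pi_mul_I, hexpA]; ring
    have slit : ∀ w : ℂ, w ≠ 0 → 0 ≤ w.re → w ∈ Complex.slitPlane := fun w hw hre => by
      rw [Complex.mem_slitPlane_iff]
      rcases hre.lt_or_eq with h | h
      · exact Or.inl h
      · right; intro h'; exact hw (Complex.ext h.symm h')
    have hlA : ContinuousOn lA A := by
      refine ContinuousOn.add (ContinuousOn.clog (by fun_prop) fun z hz => slit _ ?_ ?_)
        continuousOn_const
      · simp [hw0 z hz.1]
      · have : 0 ≤ (z - p).im := hz.2
        simpa using this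
    have hlB : ContinuousOn lB B := by
      refine ContinuousOn.add (ContinuousOn.clog (by fun_prop) fun z hz => slit _ ?_ ?_)
        continuousOn_const
      · simp [hw0 z hz.1]
      · have : (z - p).im ≤ 0 := hz.2
        simpa using this
    have elA : ∀ z ∈ A, Complex.exp (lA z) = z - p := fun z hz => by
      simp only [lA]
      rw [Complex.exp_add, hexpA, Complex.exp_log (by simp [hw0 z hz.1])]
      linear_combination (-(z - p)) * Complex.I_mul_I
    have elB : ∀ z ∈ B, Complex.exp (lB z) = z - p := fun z hz => by
      simp only [lB]
      rw [Complex.exp_add, hexpB, Complex.exp_log (by simp [hw0 z hz.1])]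
      linear_combination (-(z - p)) * Complex.I_mul_I
    have hrC : (r : ℂ) ≠ 0 := by exact_mod_cast hr.ne'
    have logI : Complex.log (Complex.I * r) = Complex.log r + Real.pi / 2 * Complex.I := by
      rw [mul_comm, Complex.log_ofReal_mul hr Complex.I_ne_zero, Complex.log_I, Complex.ofReal_log hr.le]
    have lognI : Complex.log (-Complex.I * r) = Complex.log r - Real.pi / 2 * Complex.I := by
      rw [mul_comm, Complex.log_ofReal_mul hr (by simp), Complex.log_neg_I, Complex.ofReal_log hr.le]
      ring
    have v1 : lA (p + r) - lB (p + r) = - (2 * Real.pi * Complex.I) := by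
      simp only [lA, lB]
      rw [show p + r - p = (r : ℂ) by ring, logI, lognI]; ring
    have v2 : lA (p - r) - lB (p - r) = 0 := by
      simp only [lA, lB]
      rw [show -Complex.I * (p - r - p) = Complex.I * r by ring,
        show Complex.I * (p - r - p) = -Complex.I * r by ring, logI, lognI]; ring
    obtain ⟨g, hg, a1, a2⟩ := glue_cont hAc hBc
      (hgA.add (continuousOn_const (c := (n : ℂ)) |>.mul hlA))
      ((hgB.add (continuousOn_const (c := (n : ℂ)) |>.mul hlB)).add
        (continuousOn_const (c := (c2 : ℂ) * (2 * Real.pi * Complex.I)))) (fun z hz => by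
        change gA z + n * lA z = gB z + n * lB z + c2 * (2 * Real.pi * Complex.I)
        rcases hinter0 z hz with rfl | rfl
        · have : (n : ℂ) = c1 - c2 := by simp [n]
          rw [this]
          linear_combination hc1 + ((c1 : ℂ) - c2) * v1
        · linear_combination hc2 + (n : ℂ) * v2)
    refine ⟨n, g, hAB ▸ hg, fun z hz => ?_⟩
    rw [← hAB] at hz
    rcases hz with hz | hz
    · rw [a1 z hz]
      change Complex.exp (gA z + n * lA z) = _
      rw [Complex.exp_add, Complex.exp_int_mul, eA z hz, elA z hz]
    · rw [a2 z hz]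
      change Complex.exp (gB z + n * lB z + c2 * (2 * Real.pi * Complex.I)) = _
      rw [Complex.exp_add, Complex.exp_add, Complex.exp_int_mul, eB z hz, elB z hz,
        Complex.exp_int_mul_two_pi_mul_I, mul_one]
  · refine ⟨0, ?_⟩
    have hss : (A ∩ B).Subsingleton := by
      intro x hx y hy
      rcases hinter0 x hx with rfl | rfl <;> rcases hinter0 y hy with rfl | rfl
      · rfl
      · exact absurd ⟨hx, hy⟩ hboth
      · exact absurd ⟨hy, hx⟩ hboth
      · rfl
    have := HasLog.glue hAc hBc hss.isPreconnected ⟨gA, hgA, eA⟩ ⟨gB, hgB, eB⟩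
    rw [hAB] at this
    simpa using this

end log

end PCL

namespace PCL

theorem isPreconnected_norm_gt {R : ℝ} (hR : 0 < R) : IsPreconnected {z : ℂ | R < ‖z‖} := by
  have : {z : ℂ | R < ‖z‖} = Complex.exp '' {w : ℂ | Real.log R < w.re} := by
    ext z
    constructor
    · intro hz
      have hz' : R < ‖z‖ := hz
      have h0 : z ≠ 0 := norm_pos_iff.1 (hR.trans hz')
      exact ⟨Complex.log z, by
        simpa [Complex.log_re] using Real.log_lt_log hR hz', Complex.exp_log h0⟩
    · rintro ⟨w, hw, rfl⟩
      have hw' : Real.log R < w.re := hw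
      simp only [Set.mem_ofPred_eq, Complex.norm_exp]
      exact (Real.log_lt_iff_lt_exp hR).1 hw'
  rw [this]
  refine IsPreconnected.image ?_ _ Complex.continuous_exp.continuousOn
  exact (convex_halfSpace_re_gt _).isPreconnected

theorem cci_disjoint {X : Type*} [TopologicalSpace X] {F : Set X} {x y : X}
    (h : y ∉ connectedComponentIn F x) (z : X) (hz : z ∈ connectedComponentIn F x) :
    z ∉ connectedComponentIn F y := by
  intro hz'
  have h1 := connectedComponentIn_eq hz
  have h2 := connectedComponentIn_eq hz'
  have hy : y ∈ F := by
    by_contra hy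
    rw [connectedComponentIn_eq_empty hy] at hz'
    exact hz'
  exact h (by rw [h1, ← h2]; exact mem_connectedComponentIn hy)

theorem frontier_cci {K : Set ℂ} (hK : IsClosed K) (p : ℂ) :
    frontier (connectedComponentIn Kᶜ p) ⊆ K := by
  intro z hz
  by_contra hzK
  have ho : IsOpen (connectedComponentIn Kᶜ z) := hK.isOpen_compl.connectedComponentIn
  have hzz : z ∈ connectedComponentIn Kᶜ z := mem_connectedComponentIn hzK
  have hop : IsOpen (connectedComponentIn Kᶜ p) := hK.isOpen_compl.connectedComponentIn
  rw [hop.frontier_eq] at hz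
  obtain ⟨y, hy1, hy2⟩ := mem_closure_iff.1 hz.1 _ ho hzz
  exact cci_disjoint hz.2 y hy2 hy1

theorem same_comp_aux {K : Set ℂ} (hK : IsCompact K) {p q : ℂ} (hp : p ∉ K) (hq : q ∉ K)
    (h : HasLog (fun z => (z - p) / (z - q)) K)
    (hb : Bornology.IsBounded (connectedComponentIn Kᶜ p)) : q ∈ connectedComponentIn Kᶜ p := by
  by_contra hqC
  set C := connectedComponentIn Kᶜ p with hC
  have hCo : IsOpen C := hK.isClosed.isOpen_compl.connectedComponentIn
  have hpC : p ∈ C := mem_connectedComponentIn hp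
  have hfr := frontier_cci hK.isClosed p
  rw [← hC] at hfr
  obtain ⟨g, hg, e⟩ := h
  obtain ⟨G, hG, eG⟩ := tietze hK.isClosed hg
  have hqcl : q ∉ closure C := fun hq' => by
    rw [closure_eq_interior_union_frontier, hCo.interior_eq] at hq'
    rcases hq' with h | h
    · exact hqC h
    · exact hq (hfr h)
  have hinter : ∀ z ∈ closure C ∩ Cᶜ, z ∈ K := fun z hz => hfr (by
    rw [hCo.frontier_eq]; exact hz)
  obtain ⟨F, hF, a1, a2⟩ := glue_cont (K₁ := closure C) (K₂ := Cᶜ) isClosed_closure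
    hCo.isClosed_compl (g₁ := fun z => Complex.exp (G z) * (z - q)) (g₂ := fun z => z - p)
    (by fun_prop) (by fun_prop) (fun z hz => by
      have hzK := hinter z hz
      rw [eG z hzK, e z hzK]
      have : z - q ≠ 0 := sub_ne_zero.2 fun h => hqcl (h ▸ hz.1)
      field_simp)
  have huniv : closure C ∪ Cᶜ = Set.univ := by
    ext z; simp only [Set.mem_union, Set.mem_univ, iff_true]
    by_cases hz : z ∈ C
    · exact Or.inl (subset_closure hz)
    · exact Or.inr hz
  rw [huniv] at hF
  have hlog : HasLog F Set.univ := by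
    refine hasLog_univ (continuousOn_univ.1 hF) fun z => ?_
    by_cases hz : z ∈ closure C
    · rw [a1 z hz]
      exact mul_ne_zero (Complex.exp_ne_zero _) (sub_ne_zero.2 fun h => hqcl (h ▸ hz))
    · rw [a2 z (fun h => hz (subset_closure h))]
      exact sub_ne_zero.2 fun h => hz (subset_closure (h ▸ hpC))
  obtain ⟨R, hR⟩ := hb.subset_ball p
  have hR0 : 0 < R := by
    have := hR hpC
    simpa using this
  refine no_log_sphere p hR0 ((hlog.mono (Set.subset_univ _)).congr fun z hz => a2 z fun hzC => ?_)
  have h1 := hR hzC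
  rw [Metric.mem_ball] at h1
  rw [Metric.mem_sphere] at hz
  exact absurd hz h1.ne

theorem same_comp {K : Set ℂ} (hK : IsCompact K) {p q : ℂ} (hp : p ∉ K) (hq : q ∉ K)
    (h : HasLog (fun z => (z - p) / (z - q)) K) : q ∈ connectedComponentIn Kᶜ p := by
  by_cases hbp : Bornology.IsBounded (connectedComponentIn Kᶜ p)
  · exact same_comp_aux hK hp hq h hbp
  by_cases hbq : Bornology.IsBounded (connectedComponentIn Kᶜ q)
  · have := same_comp_aux hK hq hp (h.inv.congr fun z _ => by simp) hbq
    rw [← connectedComponentIn_eq this]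
    exact mem_connectedComponentIn hq
  obtain ⟨R, hR⟩ := hK.isBounded.subset_closedBall 0
  have hR' : ∀ z ∈ K, ‖z‖ ≤ max R 1 := fun z hz => by
    have := hR hz
    rw [mem_closedBall_zero_iff] at this
    exact this.trans (le_max_left _ _)
  have hR1 : 0 < max R 1 := lt_max_of_lt_right one_pos
  have hc := isPreconnected_norm_gt hR1
  have hsub : {z : ℂ | max R 1 < ‖z‖} ⊆ Kᶜ := fun z hz hzK => absurd (hR' z hzK) (not_le.2 hz)
  have far : ∀ C : Set ℂ, ¬ Bornology.IsBounded C → ∃ z ∈ C, max R 1 < ‖z‖ := by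
    intro C hC
    by_contra hcon
    push Not at hcon
    exact hC (Metric.isBounded_closedBall.subset (fun z hz => by
      rw [mem_closedBall_zero_iff]; exact hcon z hz : C ⊆ Metric.closedBall 0 (max R 1)))
  obtain ⟨x, hx, hx1⟩ := far _ hbp
  obtain ⟨y, hy, hy1⟩ := far _ hbq
  have h1 := hc.subset_connectedComponentIn hx1 hsub
  have h2 := h1 hy1
  rw [← connectedComponentIn_eq hx] at h2
  by_contra hcon
  exact cci_disjoint hcon y h2 hy

theorem hasLog_of_conn {K : Set ℂ} (hK : IsClosed K) {D : Set ℂ} (hD : IsPreconnected D)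
    (hDK : ∀ z ∈ D, z ∉ K) {p q : ℂ} (hp : p ∈ D) (hq : q ∈ D) :
    HasLog (fun z => (z - p) / (z - q)) K := by
  refine hD.induction₂ (fun p q => HasLog (fun z => (z - p) / (z - q)) K) (fun x hx => ?_) ?_ ?_ hp hq
  · obtain ⟨ε, hε, hb⟩ := Metric.isOpen_iff.1 hK.isOpen_compl x (hDK x hx)
    refine nhdsWithin_le_nhds ?_
    filter_upwards [Metric.ball_mem_nhds x hε] with y hy
    refine (hasLog_shift (a := x) (b := y) fun z hz => ?_).inv.congr fun z _ => by simp
    have h1 : ¬ dist z x < ε := fun h => hb h hz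
    rw [← dist_eq_norm, ← dist_eq_norm, dist_comm x y]
    exact lt_of_lt_of_le hy (not_lt.1 h1)
  · intro x y z hx hy hz h1 h2
    refine (h1.mul h2).congr fun w hw => ?_
    have : w - y ≠ 0 := sub_ne_zero.2 fun h => hDK y hy (h ▸ hw)
    field_simp
  · intro x y _ _ h
    exact h.inv.congr fun z _ => by simp

theorem janiszewski {K₁ K₂ : Set ℂ} (h₁ : IsCompact K₁) (h₂ : IsCompact K₂)
    (hc : IsPreconnected (K₁ ∩ K₂)) {D₁ D₂ : Set ℂ} (hD₁ : IsPreconnected D₁)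
    (hD₂ : IsPreconnected D₂) (d₁ : ∀ z ∈ D₁, z ∉ K₁) (d₂ : ∀ z ∈ D₂, z ∉ K₂) {p q : ℂ}
    (hp₁ : p ∈ D₁) (hp₂ : p ∈ D₂) (hq₁ : q ∈ D₁) (hq₂ : q ∈ D₂) :
    q ∈ connectedComponentIn (K₁ ∪ K₂)ᶜ p := by
  refine same_comp (h₁.union h₂) ?_ ?_ ?_
  · rintro (h | h)
    exacts [d₁ _ hp₁ h, d₂ _ hp₂ h]
  · rintro (h | h)
    exacts [d₁ _ hq₁ h, d₂ _ hq₂ h]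
  · exact HasLog.glue h₁.isClosed h₂.isClosed hc (hasLog_of_conn h₁.isClosed hD₁ d₁ hp₁ hq₁)
      (hasLog_of_conn h₂.isClosed hD₂ d₂ hp₂ hq₂)

theorem hasLog_fill {K : Set ℂ} {R : ℝ} (hR : 0 < R) (hKR : K ⊆ Metric.closedBall 0 R) {δ : ℝ}
    (hδ : 0 < δ) (s : Finset ℂ) :
    ∀ (A : Set ℂ) (f : ℂ → ℂ), IsClosed A → ContinuousOn f A → (∀ z ∈ A, f z ≠ 0) → K ⊆ A →
    (∀ a ∈ s, HasLog (fun z => z - a) K) → (∀ a ∈ s, ∀ z ∈ K, δ < dist z a) →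
    Metric.closedBall 0 R ⊆ A ∪ (⋃ a ∈ s, Metric.ball a δ) → HasLog f K := by
  classical
  induction s using Finset.induction_on with
  | empty =>
    intro A f hA hf h0 hKA _ _ hcov
    simp only [Finset.notMem_empty, Set.iUnion_of_empty, Set.iUnion_empty, Set.union_empty] at hcov
    exact (hasLog_closedBall hR (hf.mono hcov) fun z hz => h0 z (hcov hz)).mono hKR
  | insert a s _ ih =>
    intro A f hA hf h0 hKA hl hd hcov
    have hA1 : IsClosed (A \ Metric.ball a δ) := hA.sdiff Metric.isOpen_ball
    have hX : IsClosed (A ∩ Metric.sphere a δ) := hA.inter Metric.isClosed_sphere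
    obtain ⟨n, g, hg, e⟩ := hasLog_sphere_sub hδ hX Set.inter_subset_right
      (hf.mono Set.inter_subset_left) fun z hz => h0 z hz.1
    obtain ⟨G, hG, eG⟩ := tietze hX hg
    have hza : ∀ z ∈ A \ Metric.ball a δ, z - a ≠ 0 := fun z hz h => hz.2 (by
      rw [sub_eq_zero.1 h]; exact Metric.mem_ball_self hδ)
    obtain ⟨F, hF, a1, a2⟩ := glue_cont (K₁ := A \ Metric.ball a δ) (K₂ := Metric.closedBall a δ)
      hA1 Metric.isClosed_closedBall (g₁ := fun z => f z * (z - a) ^ n)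
      (g₂ := fun z => Complex.exp (G z))
      ((hf.mono Set.sdiff_subset).mul (ContinuousOn.zpow₀ (by fun_prop) n
        fun z hz => Or.inl (hza z hz))) (by fun_prop) (fun z hz => by
        have : z ∈ A ∩ Metric.sphere a δ := ⟨hz.1.1, by
          have h1 := hz.1.2
          have h2 := hz.2
          rw [Metric.mem_ball, not_lt] at h1
          rw [Metric.mem_closedBall] at h2
          exact le_antisymm h2 h1⟩
        rw [eG z this, e z this])
    have hKA1 : K ⊆ A \ Metric.ball a δ := fun z hz => ⟨hKA hz, fun h => by
      have := hd a (Finset.mem_insert_self _ _) z hz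
      exact absurd h (not_lt.2 this.le)⟩
    have hlog : HasLog F K := by
      refine ih ((A \ Metric.ball a δ) ∪ Metric.closedBall a δ) F
        (hA1.union Metric.isClosed_closedBall) hF ?_ (hKA1.trans Set.subset_union_left)
        (fun b hb => hl b (Finset.mem_insert_of_mem hb))
        (fun b hb => hd b (Finset.mem_insert_of_mem hb)) ?_
      · rintro z (hz | hz)
        · rw [a1 z hz]
          exact mul_ne_zero (h0 z hz.1) (zpow_ne_zero _ (hza z hz))
        · rw [a2 z hz]; exact Complex.exp_ne_zero _
      · intro z hz
        by_cases hzb : z ∈ Metric.ball a δ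
        · exact Or.inl (Or.inr (Metric.ball_subset_closedBall hzb))
        rcases hcov hz with h | h
        · exact Or.inl (Or.inl ⟨h, hzb⟩)
        · simp only [Finset.mem_insert, Set.iUnion_iUnion_eq_or_left, Set.mem_union] at h
          rcases h with h | h
          · exact absurd h hzb
          · exact Or.inr h
    refine (hlog.mul ((hl a (Finset.mem_insert_self _ _)).zpow (-n))).congr fun z hz => ?_
    rw [a1 z (hKA1 hz), zpow_neg, mul_assoc, mul_inv_cancel₀, mul_one]
    exact zpow_ne_zero _ (hza z (hKA1 hz))

theorem hasLog_open {K N : Set ℂ} (hK : IsCompact K) (hN : IsOpen N) (hKN : K ⊆ N) {f : ℂ → ℂ}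
    (hf : ContinuousOn f N) (h0 : ∀ z ∈ N, f z ≠ 0) (hl : ∀ a, a ∉ N → HasLog (fun z => z - a) K) :
    HasLog f K := by
  obtain ⟨R, hR⟩ := hK.isBounded.subset_closedBall 0
  set R' := max R 1
  have hR' : 0 < R' := lt_max_of_lt_right one_pos
  have hKR : K ⊆ Metric.closedBall 0 R' := hR.trans (Metric.closedBall_subset_closedBall (le_max_left _ _))
  obtain ⟨δ, hδ, hd⟩ : ∃ δ > 0, ∀ z ∈ K, ∀ a, a ∉ N → δ < dist z a := by
    obtain ⟨ε, hε, h⟩ := hK.exists_thickening_subset_open hN hKN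
    refine ⟨ε / 2, half_pos hε, fun z hz a ha => ?_⟩
    by_contra hcon
    push Not at hcon
    refine ha (h (Metric.mem_thickening_iff.2 ⟨z, hz, ?_⟩))
    rw [dist_comm]; linarith
  have hcomp : IsCompact (Metric.closedBall (0 : ℂ) R' \ N) := (isCompact_closedBall 0 R').diff hN
  obtain ⟨t, ht, htc⟩ := hcomp.elim_nhds_subcover (fun a => Metric.ball a δ)
    fun a _ => Metric.ball_mem_nhds a hδ
  have htN : ∀ a ∈ t, a ∉ N := fun a ha => (ht a ha).2
  have hop : IsOpen (⋃ a ∈ t, Metric.ball a δ) := isOpen_biUnion fun a _ => Metric.isOpen_ball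
  have hsub : Metric.closedBall 0 R' \ (⋃ a ∈ t, Metric.ball a δ) ⊆ N := fun z hz => by
    by_contra hzN
    exact hz.2 (htc ⟨hz.1, hzN⟩)
  refine hasLog_fill hR' hKR hδ t (Metric.closedBall 0 R' \ (⋃ a ∈ t, Metric.ball a δ)) f
    (Metric.isClosed_closedBall.sdiff hop) (hf.mono hsub) (fun z hz => h0 z (hsub hz)) ?_
    (fun a ha => hl a (htN a ha)) (fun a ha z hz => hd z hz a (htN a ha)) ?_
  · intro z hz
    refine ⟨hKR hz, fun h => ?_⟩
    simp only [Set.mem_iUnion] at h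
    obtain ⟨a, ha, hza⟩ := h
    exact absurd hza (not_lt.2 (hd z hz a (htN a ha)).le)
  · intro z hz
    by_cases h : z ∈ (⋃ a ∈ t, Metric.ball a δ)
    · exact Or.inr h
    · exact Or.inl ⟨hz, h⟩

end PCL

namespace PCL

theorem circle_no_inj_real (f : Circle → ℝ) (hf : Continuous f) : ¬ Function.Injective f := by
  intro hi
  let h : ℝ → ℝ := fun t => f (Circle.exp t) - f (Circle.exp (t + Real.pi))
  have hc : Continuous h := by fun_prop
  have h1 : h Real.pi = - h 0 := by
    have : Circle.exp (Real.pi + Real.pi) = Circle.exp 0 := by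
      rw [← two_mul, Circle.exp_two_pi, Circle.exp_zero]
    simp only [h, this, zero_add]; ring
  obtain ⟨t, ht⟩ : ∃ t, h t = 0 := by
    rcases le_total 0 (h 0) with h0 | h0
    · exact mem_range_of_exists_le_of_exists_ge hc ⟨Real.pi, by linarith⟩ ⟨0, h0⟩
    · exact mem_range_of_exists_le_of_exists_ge hc ⟨0, h0⟩ ⟨Real.pi, by linarith⟩
  have h2 := hi (sub_eq_zero.1 ht)
  rw [Circle.exp_add] at h2
  have h3 : Circle.exp Real.pi = 1 := by simpa using h2.symm
  have h4 := congrArg (fun c : Circle => (c : ℂ)) h3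
  simp [Complex.exp_pi_mul_I] at h4
  norm_num [Complex.ext_iff] at h4

theorem circle_inj_surj (f : Circle → Circle) (hf : Continuous f) (hi : Function.Injective f) :
    Function.Surjective f := by
  intro c
  by_contra hc
  push Not at hc
  refine circle_no_inj_real (fun x => Complex.arg (f x * c⁻¹ * Circle.exp Real.pi : Circle)) ?_ ?_
  · rw [continuous_iff_continuousAt]
    intro x
    have hsl : ((f x * c⁻¹ * Circle.exp Real.pi : Circle) : ℂ) ∈ Complex.slitPlane := by
      rw [Complex.mem_slitPlane_iff_arg]
      refine ⟨fun h => ?_, Circle.coe_ne_zero _⟩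
      have h2 : f x * c⁻¹ * Circle.exp Real.pi = Circle.exp Real.pi := by
        apply Circle.injective_arg
        change Complex.arg (f x * c⁻¹ * Circle.exp Real.pi : Circle) = Complex.arg (Circle.exp Real.pi)
        rw [h, Circle.arg_exp (by linarith [Real.pi_pos]) le_rfl]
      have h3 : f x * c⁻¹ = 1 := by simpa using h2
      exact hc x (mul_inv_eq_one.1 h3)
    have := Complex.continuousAt_arg hsl
    exact ContinuousAt.comp (f := fun x => ((f x * c⁻¹ * Circle.exp Real.pi : Circle) : ℂ)) this
      (by fun_prop)
  · intro x y hxy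
    have := Circle.injective_arg hxy
    apply hi
    simpa using this

theorem circle_range_eq {X : Type*} [TopologicalSpace X] [T2Space X] {γ σ : Circle → X}
    (hγ : Continuous γ) (hγi : Function.Injective γ) (hσ : Continuous σ)
    (hσi : Function.Injective σ) (h : Set.range σ ⊆ Set.range γ) : Set.range σ = Set.range γ := by
  have he : IsClosedEmbedding γ := hγ.isClosedEmbedding hγi
  choose u hu using fun x => h (Set.mem_range_self x)
  have huc : Continuous u := he.isEmbedding.continuous_iff.2 (by
    have : γ ∘ u = σ := funext hu
    rw [this]; exact hσ)
  have hui : Function.Injective u := fun x y hxy => hσi (by rw [← hu, ← hu, hxy])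
  have hus := circle_inj_surj u huc hui
  refine Set.Subset.antisymm h ?_
  rintro _ ⟨c, rfl⟩
  obtain ⟨x, rfl⟩ := hus c
  exact ⟨x, (hu x).symm⟩

theorem no_log_circle : ¬ HasLog (fun z : Circle => (z : ℂ)) Set.univ := by
  rintro ⟨g, hg, h⟩
  let k : ℝ → ℂ := fun t => g (Circle.exp t) - t * Complex.I
  have hk : Continuous k := by
    have := continuousOn_univ.1 hg
    fun_prop
  have := int_const isPreconnected_univ hk.continuousOn (fun t _ => by
    simp only [k]
    rw [Complex.exp_sub, show Complex.exp (g (Circle.exp t)) = (Circle.exp t : ℂ) from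
      h _ (Set.mem_univ _), Circle.coe_exp, div_self (Complex.exp_ne_zero _)]) (Set.mem_univ 0) (Set.mem_univ (2 * Real.pi))
  simp [k] at this
  have h2 : (2 * Real.pi * Complex.I : ℂ) = 0 := by linear_combination this
  simp at h2

theorem exists_inverse {γ : Circle → ℂ} (hγ : Continuous γ) (hγi : Function.Injective γ) :
    ∃ F : ℂ → ℂ, Continuous F ∧ ∀ x, F (γ x) = x := by
  have he : IsClosedEmbedding γ := hγ.isClosedEmbedding hγi
  obtain ⟨G, hG⟩ := ContinuousMap.exists_extension he ⟨fun x : Circle => (x : ℂ), by fun_prop⟩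
  refine ⟨G, G.continuous, fun x => ?_⟩
  exact congrArg (fun φ : C(Circle, ℂ) => φ x) hG

theorem exists_inside {γ : Circle → ℂ} (hγ : Continuous γ) (hγi : Function.Injective γ) :
    ∃ p, p ∉ Set.range γ ∧ ¬ HasLog (fun z => z - p) (Set.range γ) := by
  by_contra hcon
  push Not at hcon
  obtain ⟨F, hF, e⟩ := exists_inverse hγ hγi
  have hl : HasLog F (Set.range γ) := by
    refine hasLog_open (N := {z | F z ≠ 0}) (isCompact_range hγ) (isOpen_ne_fun hF continuous_const)
      ?_ hF.continuousOn (fun z hz => hz) fun a ha => hcon a fun h => ha ?_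
    · rintro _ ⟨x, rfl⟩
      change F (γ x) ≠ 0
      rw [e]; exact Circle.coe_ne_zero _
    · obtain ⟨x, rfl⟩ := h
      change F (γ x) ≠ 0
      rw [e]; exact Circle.coe_ne_zero _
  refine no_log_circle ((hl.comp hγ.continuousOn (fun x _ => Set.mem_range_self x)).congr
    fun x _ => e x)

theorem hasLog_of_unbounded {K : Set ℂ} (hK : IsCompact K) {a : ℂ}
    (h : ¬ Bornology.IsBounded (connectedComponentIn Kᶜ a)) : HasLog (fun z => z - a) K := by
  obtain ⟨R, hR⟩ := hK.isBounded.subset_closedBall 0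
  have : ∃ q ∈ connectedComponentIn Kᶜ a, max R 0 < ‖q‖ := by
    by_contra hcon
    push Not at hcon
    refine h ((Metric.isBounded_closedBall (x := (0 : ℂ)) (r := max R 0)).subset fun z hz => ?_)
    rw [mem_closedBall_zero_iff]; exact hcon z hz
  obtain ⟨q, hq, hqR⟩ := this
  have ha : a ∈ Kᶜ := by
    by_contra ha
    rw [connectedComponentIn_eq_empty ha] at hq
    exact hq
  have hq0 : q ≠ 0 := norm_pos_iff.1 (lt_of_le_of_lt (le_max_right _ _) hqR)
  have h1 := hasLog_of_conn hK.isClosed (isPreconnected_connectedComponentIn (F := Kᶜ) (x := a))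
    (fun z hz => connectedComponentIn_subset _ _ hz) (mem_connectedComponentIn ha) hq
  have h2 : HasLog (fun z => z - q) K := by
    refine hasLog_near_const (by fun_prop) (-q) (neg_ne_zero.2 hq0) fun z hz => ?_
    have := hR hz
    rw [mem_closedBall_zero_iff] at this
    rw [norm_neg]
    simpa using lt_of_le_of_lt (this.trans (le_max_left _ _)) hqR
  refine (h1.mul h2).congr fun z hz => ?_
  have : z - q ≠ 0 := sub_ne_zero.2 fun h => connectedComponentIn_subset _ _ hq (h ▸ hz)
  field_simp

theorem hasLog_outside {J : Set ℂ} (hJ : IsCompact J) (hJc : IsConnected J) {p : ℂ}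
    (hU : Bornology.IsBounded (connectedComponentIn Jᶜ p)) {K : Set ℂ} (hK : IsCompact K)
    (hKU : K ⊆ connectedComponentIn Jᶜ p) {a : ℂ} (ha : a ∉ connectedComponentIn Jᶜ p) :
    HasLog (fun z => z - a) K := by
  refine hasLog_of_unbounded hK ?_
  intro hb
  set U := connectedComponentIn Jᶜ p with hUdef
  set C := connectedComponentIn Kᶜ a with hC
  have hCo : IsOpen C := hK.isClosed.isOpen_compl.connectedComponentIn
  have haC : a ∈ C := mem_connectedComponentIn fun h => ha (hKU h)
  have hfr : frontier C ⊆ K := frontier_cci hK.isClosed a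
  have hJK : ∀ z ∈ J, z ∉ K := fun z hz hzK => connectedComponentIn_subset _ _ (hKU hzK) hz
  -- a component of Jᶜ other than U
  have comp : ∀ b, b ∉ U → b ∉ J → (∀ z ∈ connectedComponentIn Jᶜ b, z ∉ K) ∧
      (∃ j ∈ J, j ∈ closure (connectedComponentIn Jᶜ b)) := by
    intro b hbU hbJ
    refine ⟨fun z hz hzK => cci_disjoint hbU z (hKU hzK) hz, ?_⟩
    have hne : (frontier (connectedComponentIn Jᶜ b)).Nonempty := by
      rw [Set.nonempty_iff_ne_empty]
      intro he
      have hcl := isClopen_iff_frontier_eq_empty.2 he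
      rcases isClopen_iff.1 hcl with h | h
      · have : b ∈ connectedComponentIn Jᶜ b := mem_connectedComponentIn hbJ
        rw [h] at this; exact this
      · obtain ⟨j, hj⟩ := hJc.nonempty
        have : j ∈ connectedComponentIn Jᶜ b := by rw [h]; trivial
        exact connectedComponentIn_subset _ _ this hj
    obtain ⟨j, hj⟩ := hne
    exact ⟨j, frontier_cci hJ.isClosed b hj, frontier_subset_closure hj⟩
  have hJC : (J ∩ C).Nonempty := by
    by_cases haJ : a ∈ J
    · exact ⟨a, haJ, haC⟩
    obtain ⟨h1, j, hj, hjc⟩ := comp a ha haJ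
    have hV : connectedComponentIn Jᶜ a ⊆ C :=
      isPreconnected_connectedComponentIn.subset_connectedComponentIn
        (mem_connectedComponentIn haJ) h1
    have := closure_mono hV hjc
    rw [closure_eq_interior_union_frontier, hCo.interior_eq] at this
    rcases this with h | h
    · exact ⟨j, hj, h⟩
    · exact absurd (hfr h) (hJK j hj)
  obtain ⟨j0, hj0, hj0C⟩ := hJC
  have hJC : J ⊆ C := by
    have := hJc.isPreconnected.subset_connectedComponentIn hj0
      (show J ⊆ Kᶜ from hJK)
    rwa [← connectedComponentIn_eq hj0C] at this
  obtain ⟨b, hbb⟩ : ∃ b : ℂ, b ∉ U ∪ C := by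
    by_contra hcon
    push Not at hcon
    have : Bornology.IsBounded (Set.univ : Set ℂ) := (hU.union hb).subset fun z _ => hcon z
    exact NormedSpace.unbounded_univ ℝ ℂ this
  have hbJ : b ∉ J := fun h => hbb (Or.inr (hJC h))
  obtain ⟨h1, j, hj, hjc⟩ := comp b (fun h => hbb (Or.inl h)) hbJ
  obtain ⟨y, hyC, hyV⟩ := mem_closure_iff.1 hjc C hCo (hJC hj)
  have hV := (isPreconnected_connectedComponentIn (F := Jᶜ) (x := b)).subset_connectedComponentIn
    hyV (show _ ⊆ Kᶜ from h1)
  rw [← connectedComponentIn_eq hyC] at hV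
  exact hbb (Or.inr (hV (mem_connectedComponentIn hbJ)))

theorem hasLog_exhaust {U : Set ℂ} (hU : IsOpen U) (hUc : IsPreconnected U) {f : ℂ → ℂ}
    (h : ∀ K, IsCompact K → K ⊆ U → HasLog f K) : HasLog f U := by
  rcases U.eq_empty_or_nonempty with rfl | ⟨p, hp⟩
  · exact ⟨0, by simp, by simp⟩
  obtain ⟨g0, -, hg0⟩ := h {p} isCompact_singleton (by simpa using hp)
  have hg0 := hg0 p rfl
  have h0 : f p ≠ 0 := by rw [← hg0]; exact Complex.exp_ne_zero _
  -- normalised logs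
  have norm : ∀ K, IsCompact K → K ⊆ U → p ∈ K → ∃ g : ℂ → ℂ, ContinuousOn g K ∧
      (∀ z ∈ K, Complex.exp (g z) = f z) ∧ g p = g0 p := by
    intro K hK hKU hpK
    obtain ⟨g, hg, e⟩ := h K hK hKU
    refine ⟨fun z => g z + (g0 p - g p), hg.add continuousOn_const, fun z hz => ?_, by ring⟩
    rw [Complex.exp_add, Complex.exp_sub, e z hz, hg0, e p hpK, div_self h0, mul_one]
  have uniq : ∀ K, IsPreconnected K → p ∈ K → ∀ g g' : ℂ → ℂ, ContinuousOn g K →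
      ContinuousOn g' K → (∀ z ∈ K, Complex.exp (g z) = f z) →
      (∀ z ∈ K, Complex.exp (g' z) = f z) → g p = g0 p → g' p = g0 p → ∀ z ∈ K, g z = g' z := by
    intro K hK hpK g g' hg hg' e e' h1 h2 z hz
    have := int_const hK (hg.sub hg') (fun z hz => by
      change Complex.exp (g z - g' z) = 1
      rw [Complex.exp_sub, e z hz, e' z hz, div_self]
      rw [← e z hz]; exact Complex.exp_ne_zero _) hz hpK
    change g z - g' z = g p - g' p at this
    rw [h1, h2, sub_self] at this
    exact sub_eq_zero.1 this
  have hpath : ∀ x ∈ U, ∃ K, IsCompact K ∧ K ⊆ U ∧ p ∈ K ∧ x ∈ K ∧ IsPreconnected K := by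
    intro x hx
    have hpc : IsPathConnected U := (hU.isConnected_iff_isPathConnected).1 ⟨⟨p, hp⟩, hUc⟩
    obtain ⟨γ, hγ⟩ := hpc.joinedIn p hp x hx
    refine ⟨Set.range γ, isCompact_range γ.continuous, ?_, ⟨0, by simp⟩, ⟨1, by simp⟩,
      isPreconnected_range γ.continuous⟩
    rintro _ ⟨t, rfl⟩
    exact hγ t
  choose! K hKc hKU hpK hxK hKp using hpath
  choose! G hG eG nG using norm
  have key : ∀ x ∈ U, ∀ L, IsCompact L → L ⊆ U → p ∈ L → IsPreconnected L → x ∈ L →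
      G (K x) x = G L x := by
    intro x hx L hL hLU hpL hLp hxL
    have hLK := (hKc x hx).union hL
    have hLKU := Set.union_subset (hKU x hx) hLU
    have hpU : p ∈ K x ∪ L := Or.inr hpL
    have e1 := uniq (K x) (hKp x hx) (hpK x hx) (G (K x)) (G (K x ∪ L))
      (hG _ (hKc x hx) (hKU x hx) (hpK x hx)) ((hG _ hLK hLKU hpU).mono Set.subset_union_left)
      (eG _ (hKc x hx) (hKU x hx) (hpK x hx)) (fun z hz => eG _ hLK hLKU hpU z (Or.inl hz))
      (nG _ (hKc x hx) (hKU x hx) (hpK x hx)) (nG _ hLK hLKU hpU) x (hxK x hx)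
    have e2 := uniq L hLp hpL (G L) (G (K x ∪ L))
      (hG _ hL hLU hpL) ((hG _ hLK hLKU hpU).mono Set.subset_union_right)
      (eG _ hL hLU hpL) (fun z hz => eG _ hLK hLKU hpU z (Or.inr hz))
      (nG _ hL hLU hpL) (nG _ hLK hLKU hpU) x hxL
    rw [e1, e2]
  refine ⟨fun x => G (K x) x, fun x hx => ?_, fun x hx => eG _ (hKc x hx) (hKU x hx) (hpK x hx) x
    (hxK x hx)⟩
  obtain ⟨ε, hε, hb⟩ := Metric.nhds_basis_closedBall.mem_iff.1 (hU.mem_nhds hx)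
  have hL : IsCompact (K x ∪ Metric.closedBall x ε) := (hKc x hx).union (isCompact_closedBall x ε)
  have hLU : K x ∪ Metric.closedBall x ε ⊆ U := Set.union_subset (hKU x hx) hb
  have hpL : p ∈ K x ∪ Metric.closedBall x ε := Or.inl (hpK x hx)
  have hLp : IsPreconnected (K x ∪ Metric.closedBall x ε) :=
    IsPreconnected.union x (hxK x hx) (Metric.mem_closedBall_self hε.le) (hKp x hx)
      (convex_closedBall x ε).isPreconnected
  have hn : K x ∪ Metric.closedBall x ε ∈ 𝓝 x :=
    Filter.mem_of_superset (Metric.closedBall_mem_nhds x hε) Set.subset_union_right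
  have hcont := (hG _ hL hLU hpL).continuousAt hn
  refine ContinuousAt.continuousWithinAt (hcont.congr ?_)
  filter_upwards [hn] with y hy
  exact (key y (hLU hy) _ hL hLU hpL hLp hy).symm

def AllLogs (U : Set ℂ) : Prop :=
  ∀ f : ℂ → ℂ, ContinuousOn f U → (∀ z ∈ U, f z ≠ 0) → HasLog f U

theorem allLogs_comp {J : Set ℂ} (hJ : IsCompact J) (hJc : IsConnected J) {p : ℂ}
    (hU : Bornology.IsBounded (connectedComponentIn Jᶜ p)) :
    AllLogs (connectedComponentIn Jᶜ p) := by
  intro f hf h0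
  have ho : IsOpen (connectedComponentIn Jᶜ p) := hJ.isClosed.isOpen_compl.connectedComponentIn
  refine hasLog_exhaust ho isPreconnected_connectedComponentIn fun K hK hKU => ?_
  exact hasLog_open hK ho hKU hf h0 fun a ha => hasLog_outside hJ hJc hU hK hKU ha

end PCL

namespace PCL
open Metric

theorem log_diff {U : Set ℂ} (hU : IsOpen U) {f g : ℂ → ℂ} (hg : ContinuousOn g U)
    (hf : DifferentiableOn ℂ f U) (e : ∀ z ∈ U, Complex.exp (g z) = f z) :
    DifferentiableOn ℂ g U := by
  intro z hz
  have h0 : f z ≠ 0 := by rw [← e z hz]; exact Complex.exp_ne_zero _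
  have hfd : DifferentiableAt ℂ f z := hf.differentiableAt (hU.mem_nhds hz)
  have hd : DifferentiableAt ℂ (fun y => g z + Complex.log (f y / f z)) z := by
    refine (differentiableAt_const _).add (DifferentiableAt.clog (hfd.div_const _) ?_)
    simp [div_self h0]
  refine (hd.congr_of_eventuallyEq ?_).differentiableWithinAt
  have hc := Metric.continuousAt_iff'.1 (hg.continuousAt (hU.mem_nhds hz)) 1 one_pos
  filter_upwards [hc, hU.mem_nhds hz] with y hy hyU
  rw [← e y hyU, ← e z hz, ← Complex.exp_sub, Complex.log_exp]
  · ring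
  all_goals
    rw [dist_eq_norm] at hy
    have h1 := Complex.abs_im_le_norm (g y - g z)
    have h2 := Real.pi_gt_three
    have h3 := abs_lt.1 (lt_of_le_of_lt h1 hy)
    linarith [h3.1, h3.2]

/-- Disc automorphism. -/
def mob (a z : ℂ) : ℂ := (z - a) / (1 - (starRingEnd ℂ) a * z)

theorem mob_denom {a z : ℂ} (ha : ‖a‖ < 1) (hz : ‖z‖ < 1) : 1 - (starRingEnd ℂ) a * z ≠ 0 := by
  intro h
  have h1 : (starRingEnd ℂ) a * z = 1 := (sub_eq_zero.1 h).symm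
  have h2 := congrArg norm h1
  rw [norm_mul, Complex.norm_conj, norm_one] at h2
  nlinarith [norm_nonneg a, norm_nonneg z]

theorem mob_lt {a z : ℂ} (ha : ‖a‖ < 1) (hz : ‖z‖ < 1) : ‖mob a z‖ < 1 := by
  rw [mob, norm_div, div_lt_one (norm_pos_iff.2 (mob_denom ha hz))]
  refine lt_of_pow_lt_pow_left₀ 2 (norm_nonneg _) ?_
  have ha2 : ‖a‖ ^ 2 < 1 := by nlinarith [norm_nonneg a]
  have hz2 : ‖z‖ ^ 2 < 1 := by nlinarith [norm_nonneg z]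
  rw [← Complex.normSq_eq_norm_sq, Complex.normSq_apply] at *
  rw [← Complex.normSq_eq_norm_sq, Complex.normSq_apply]
  simp only [Complex.sub_re, Complex.sub_im, Complex.one_re, Complex.one_im, Complex.mul_re,
    Complex.mul_im, Complex.conj_re, Complex.conj_im]
  nlinarith [mul_pos (sub_pos.2 ha2) (sub_pos.2 hz2)]

theorem mob_inj {a z w : ℂ} (ha : ‖a‖ < 1) (hz : ‖z‖ < 1) (hw : ‖w‖ < 1) (h : mob a z = mob a w) :
    z = w := by
  rw [mob, mob, div_eq_div_iff (mob_denom ha hz) (mob_denom ha hw)] at h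
  have h1 : (z - w) * (1 - (starRingEnd ℂ) a * a) = 0 := by linear_combination h
  rcases mul_eq_zero.1 h1 with h2 | h2
  · exact sub_eq_zero.1 h2
  · exact absurd h2 (mob_denom ha ha)

theorem mob_deriv {a z : ℂ} (ha : ‖a‖ < 1) (hz : ‖z‖ < 1) :
    HasDerivAt (mob a) ((1 - ‖a‖ ^ 2) / (1 - (starRingEnd ℂ) a * z) ^ 2) z := by
  have h1 : HasDerivAt (fun z => z - a) 1 z := (hasDerivAt_id z).sub_const a
  have h2 : HasDerivAt (fun z => 1 - (starRingEnd ℂ) a * z) (-(starRingEnd ℂ) a) z := by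
    simpa using ((hasDerivAt_id z).const_mul ((starRingEnd ℂ) a)).const_sub 1
  refine (h1.div h2 (mob_denom ha hz)).congr_deriv ?_
  congr 1
  have : ((‖a‖ : ℂ)) ^ 2 = (starRingEnd ℂ) a * a := by
    rw [← Complex.normSq_eq_conj_mul_self, Complex.normSq_eq_norm_sq]; push_cast; rfl
  rw [this]; ring

def RFam (U : Set ℂ) (p : ℂ) : Set (ℂ → ℂ) :=
  {h | DifferentiableOn ℂ h U ∧ Set.InjOn h U ∧ (∀ z ∈ U, ‖h z‖ < 1) ∧ h p = 0}

/-- Square root trick. -/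
theorem rfam_improve {U : Set ℂ} (hU : IsOpen U) (hl : AllLogs U) {p : ℂ} (hp : p ∈ U)
    {h : ℂ → ℂ} (hh : h ∈ RFam U p) (hd : deriv h p ≠ 0) {w : ℂ} (hw : ‖w‖ < 1)
    (hwU : ∀ z ∈ U, h z ≠ w) : ∃ H ∈ RFam U p, ‖deriv h p‖ < ‖deriv H p‖ := by
  obtain ⟨h1, h2, h3, h4⟩ := hh
  have hk : DifferentiableOn ℂ (fun z => mob w (h z)) U := fun z hz =>
    ((mob_deriv hw (h3 z hz)).differentiableAt.comp z
      (h1.differentiableAt (hU.mem_nhds hz))).differentiableWithinAt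
  have hk0 : ∀ z ∈ U, mob w (h z) ≠ 0 := fun z hz => by
    rw [mob]
    exact div_ne_zero (sub_ne_zero.2 (hwU z hz)) (mob_denom hw (h3 z hz))
  obtain ⟨L, hL, eL⟩ := hl _ hk.continuousOn hk0
  have hLd := log_diff hU hL hk eL
  let s : ℂ → ℂ := fun z => Complex.exp (L z / 2)
  have hs2 : ∀ z ∈ U, s z ^ 2 = mob w (h z) := fun z hz => by
    simp only [s]
    rw [← Complex.exp_nat_mul, ← show Complex.exp (L z) = mob w (h z) from eL z hz]; congr 1; push_cast; ring
  have hsd : DifferentiableOn ℂ s U := (hLd.div_const 2).cexp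
  have hs1 : ∀ z ∈ U, ‖s z‖ < 1 := fun z hz => by
    have := mob_lt hw (h3 z hz)
    rw [← hs2 z hz, norm_pow] at this
    exact (pow_lt_one_iff_of_nonneg (norm_nonneg _) two_ne_zero).1 this
  have hsi : Set.InjOn s U := fun x hx y hy hxy => by
    have : s x ^ 2 = s y ^ 2 := by rw [hxy]
    rw [hs2 x hx, hs2 y hy] at this
    exact h2 hx hy (mob_inj hw (h3 x hx) (h3 y hy) this)
  have hs0 : s p ≠ 0 := Complex.exp_ne_zero _
  have hsp := hs1 p hp
  have hHd : ∀ z ∈ U, HasDerivAt (fun z => mob (s p) (s z))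
      ((1 - ‖s p‖ ^ 2) / (1 - (starRingEnd ℂ) (s p) * s z) ^ 2 * deriv s z) z := fun z hz =>
    (mob_deriv hsp (hs1 z hz)).comp z (hsd.differentiableAt (hU.mem_nhds hz)).hasDerivAt
  refine ⟨fun z => mob (s p) (s z), ⟨fun z hz => (hHd z hz).differentiableAt.differentiableWithinAt,
    fun x hx y hy hxy => hsi hx hy (mob_inj hsp (hs1 x hx) (hs1 y hy) hxy),
    fun z hz => mob_lt hsp (hs1 z hz), by simp [mob]⟩, ?_⟩
  -- derivative computation
  have e1 : HasDerivAt (fun z => s z ^ 2) (2 * s p * deriv s p) p := by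
    refine HasDerivAt.congr_deriv ((hsd.differentiableAt (hU.mem_nhds hp)).hasDerivAt.pow 2) ?_
    simp
  have e2 : HasDerivAt (fun z => mob w (h z)) ((1 - ‖w‖ ^ 2) * deriv h p) p := by
    have := (mob_deriv hw (h3 p hp)).comp p (h1.differentiableAt (hU.mem_nhds hp)).hasDerivAt
    refine HasDerivAt.congr_deriv this ?_
    simp [h4]
  have e3 : 2 * s p * deriv s p = (1 - ‖w‖ ^ 2) * deriv h p := by
    refine e1.unique (e2.congr_of_eventuallyEq ?_)
    filter_upwards [hU.mem_nhds hp] with z hz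
    exact hs2 z hz
  have e4 : ‖w‖ = ‖s p‖ ^ 2 := by
    rw [← norm_pow, hs2 p hp, h4]; simp [mob]
  rw [(hHd p hp).deriv]
  set σ := ‖s p‖ with hσ
  have hσ0 : 0 < σ := norm_pos_iff.2 hs0
  have n3 : 2 * σ * ‖deriv s p‖ = (1 - σ ^ 4) * ‖deriv h p‖ := by
    have := congrArg norm e3
    rw [norm_mul, norm_mul, norm_mul, e4] at this
    have h5 : ‖(1 - ((σ ^ 2 : ℝ) : ℂ) ^ 2 : ℂ)‖ = 1 - σ ^ 4 := by
      have : (1 - ((σ ^ 2 : ℝ) : ℂ) ^ 2 : ℂ) = ((1 - σ ^ 4 : ℝ) : ℂ) := by push_cast; ring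
      rw [this, Complex.norm_real, Real.norm_of_nonneg]
      have : σ ^ 4 ≤ 1 := pow_le_one₀ hσ0.le hsp.le
      linarith
    rw [h5] at this
    simpa using this
  have hconj : (starRingEnd ℂ) (s p) * s p = ((σ ^ 2 : ℝ) : ℂ) := by
    rw [← Complex.normSq_eq_conj_mul_self, Complex.normSq_eq_norm_sq]
  have hpos : 0 < 1 - σ ^ 2 := by nlinarith
  have n4 : ‖((1 - (σ : ℂ) ^ 2) / (1 - (starRingEnd ℂ) (s p) * s p) ^ 2 : ℂ)‖ = 1 / (1 - σ ^ 2) := by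
    rw [hconj]
    have : ((1 - (σ : ℂ) ^ 2) / (1 - ((σ ^ 2 : ℝ) : ℂ)) ^ 2 : ℂ) = ((1 / (1 - σ ^ 2) : ℝ) : ℂ) := by
      have h6 : (1 - (σ : ℂ) ^ 2) ≠ 0 := by exact_mod_cast hpos.ne'
      push_cast
      field_simp
    rw [this, Complex.norm_real, Real.norm_of_nonneg (by positivity)]
  rw [norm_mul, n4]
  have hdpos : 0 < ‖deriv h p‖ := norm_pos_iff.2 hd
  rw [one_div, ← div_eq_inv_mul, lt_div_iff₀ hpos]
  have h7 : ‖deriv s p‖ = (1 - σ ^ 4) * ‖deriv h p‖ / (2 * σ) := by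
    rw [← n3]; field_simp
  rw [h7, lt_div_iff₀ (by positivity)]
  have h8 : 0 < (1 - σ ^ 2) * (1 - σ) ^ 2 := by
    have : 0 < 1 - σ := by linarith
    positivity
  nlinarith [mul_pos h8 hdpos]

theorem inj_limit {ι : Type*} {l : Filter ι} [l.NeBot] {U : Set ℂ} (hU : IsOpen U)
    (hUc : IsPreconnected U) {F : ι → ℂ → ℂ} {h : ℂ → ℂ} (hF : TendstoLocallyUniformlyOn F h l U)
    (hFd : ∀ n, DifferentiableOn ℂ (F n) U) (hFi : ∀ n, Set.InjOn (F n) U)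
    (hd : DifferentiableOn ℂ h U) (hnc : ∃ x ∈ U, ∃ y ∈ U, h x ≠ h y) : Set.InjOn h U := by
  intro a ha b hb hab
  by_contra hne
  have han : AnalyticOnNhd ℂ (fun z => h z - h a) U := (hd.sub_const _).analyticOnNhd hU
  rcases (han b hb).eventually_eq_zero_or_eventually_ne_zero with h1 | h1
  · have := han.eqOn_zero_of_preconnected_of_eventuallyEq_zero hUc hb h1
    obtain ⟨x, hx, y, hy, hxy⟩ := hnc
    have e1 := this hx
    have e2 := this hy
    simp only [Pi.zero_apply, sub_eq_zero] at e1 e2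
    exact hxy (e1.trans e2.symm)
  rw [eventually_nhdsWithin_iff] at h1
  have h2 : ∀ᶠ z in 𝓝 b, z ≠ a := isOpen_ne.mem_nhds (Ne.symm hne)
  obtain ⟨r, hr, hball⟩ := Metric.nhds_basis_closedBall.mem_iff.1 ((h1.and h2).and (hU.mem_nhds hb))
  have hsph : ∀ z ∈ sphere b r, h z - h a ≠ 0 := fun z hz => by
    refine (hball (sphere_subset_closedBall hz)).1.1 ?_
    rintro rfl
    simp at hz
    exact hr.ne hz
  have hbU : closedBall b r ⊆ U := fun z hz => (hball hz).2
  have hsc : IsCompact (sphere b r) := isCompact_sphere b r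
  have hsn : (sphere b r).Nonempty := NormedSpace.sphere_nonempty.2 hr.le
  obtain ⟨z0, hz0, hmin⟩ := hsc.exists_isMinOn hsn
    ((hd.continuousOn.mono (sphere_subset_closedBall.trans hbU)).sub
      (continuousOn_const (c := h a))).norm
  set m := ‖h z0 - h a‖ with hm
  have hm0 : 0 < m := norm_pos_iff.2 (hsph z0 hz0)
  have hmin' : ∀ z ∈ sphere b r, m ≤ ‖h z - h a‖ := fun z hz => hmin hz
  have hunif : TendstoUniformlyOn F h l (insert a (closedBall b r)) := by
    refine (tendstoLocallyUniformlyOn_iff_forall_isCompact hU).1 hF _ ?_ ?_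
    · exact Set.insert_subset ha hbU
    · exact (isCompact_closedBall b r).insert a
  have hev := Metric.tendstoUniformlyOn_iff.1 hunif (m / 4) (by positivity)
  obtain ⟨n, hn⟩ := hev.exists
  have hna := hn a (Set.mem_insert _ _)
  have key : ‖(F n b - F n a)⁻¹‖ ≤ (m / 2)⁻¹ := by
    have hnv : ∀ z ∈ closedBall b r, F n z - F n a ≠ 0 := fun z hz h0 =>
      (hball hz).1.2 (hFi n (hbU hz) ha (sub_eq_zero.1 h0))
    refine Complex.norm_le_of_forall_mem_frontier_norm_le (f := fun z => (F n z - F n a)⁻¹)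
      (U := ball b r) isBounded_ball ?_ ?_ (subset_closure (mem_ball_self hr))
    · refine DifferentiableOn.diffContOnCl ?_
      rw [closure_ball b hr.ne']
      exact (((hFd n).mono hbU).sub_const _).inv hnv
    · intro z hz
      rw [frontier_ball b hr.ne'] at hz
      rw [norm_inv]
      refine inv_anti₀ (by positivity) ?_
      have h5 := hmin' z hz
      have h6 := hn z (Set.mem_insert_of_mem _ (sphere_subset_closedBall hz))
      have h7 : ‖h z - h a‖ ≤ ‖F n z - F n a‖ + dist (h z) (F n z) + dist (h a) (F n a) := by
        rw [dist_eq_norm, dist_eq_norm]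
        calc ‖h z - h a‖ = ‖(F n z - F n a) + (h z - F n z) - (h a - F n a)‖ := by congr 1; ring
          _ ≤ _ := (norm_sub_le _ _).trans (add_le_add_left (norm_add_le _ _) _)
      linarith
  rw [norm_inv] at key
  have h8 : m / 2 ≤ ‖F n b - F n a‖ := by
    have hpos : 0 < ‖F n b - F n a‖ := norm_pos_iff.2 fun h0 =>
      hne (hFi n ha hb (sub_eq_zero.1 h0).symm)
    exact (inv_le_inv₀ hpos (by positivity)).1 key
  have h9 := hn b (Set.mem_insert_of_mem _ (mem_closedBall_self hr.le))
  have h10 : ‖F n b - F n a‖ ≤ dist (h b) (F n b) + dist (h a) (F n a) := by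
    rw [dist_comm, dist_eq_norm, dist_eq_norm]
    calc ‖F n b - F n a‖ = ‖(F n b - h b) + (h a - F n a)‖ := by rw [hab]; congr 1; ring
      _ ≤ _ := norm_add_le _ _
  linarith

theorem inverse_diff {U : Set ℂ} (hU : IsOpen U) {h φ : ℂ → ℂ}
    (hd : DifferentiableOn ℂ h U) (hi : Set.InjOn h U) (hφ : ∀ z ∈ U, φ (h z) = z) :
    DifferentiableOn ℂ φ (h '' U) ∧ IsOpen (h '' U) := by
  have han := hd.analyticOnNhd hU
  have hopen : ∀ x ∈ U, 𝓝 (h x) ≤ Filter.map h (𝓝 x) := by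
    intro x hx
    rcases (han x hx).eventually_constant_or_nhds_le_map_nhds with h1 | h1
    · exfalso
      obtain ⟨ε, hε, hb⟩ := Metric.mem_nhds_iff.1 (h1.and (hU.mem_nhds hx))
      have hy : x + (ε / 2 : ℝ) ∈ ball x ε := by
        simp [abs_of_pos hε, hε]
      have h2 := hi (hb hy).2 hx (hb hy).1
      simp [hε.ne'] at h2
    · exact h1
  have hcont : ∀ x ∈ U, ContinuousAt φ (h x) := by
    intro x hx
    rw [ContinuousAt, hφ x hx]
    intro s hs
    refine hopen x hx (Filter.mem_map.2 ?_)
    filter_upwards [hs, hU.mem_nhds hx] with y hy hyU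
    change φ (h y) ∈ s
    rwa [hφ y hyU]
  have himg : ∀ x ∈ U, ∀ N ∈ 𝓝 x, h '' N ∈ 𝓝 (h x) := fun x hx N hN =>
    hopen x hx (Filter.mem_map.2 (Filter.mem_of_superset hN (Set.subset_preimage_image _ _)))
  have good : ∀ x ∈ U, deriv h x ≠ 0 → DifferentiableAt ℂ φ (h x) := by
    intro x hx hx0
    refine (HasDerivAt.of_local_left_inverse (f := h) (f' := deriv h x) (hcont x hx) ?_ hx0 ?_).differentiableAt
    · rw [hφ x hx]; exact (hd.differentiableAt (hU.mem_nhds hx)).hasDerivAt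
    · filter_upwards [himg x hx U (hU.mem_nhds hx)] with y hy
      obtain ⟨z, hz, rfl⟩ := hy
      rw [hφ z hz]
  refine ⟨?_, ?_⟩
  · rintro _ ⟨x, hx, rfl⟩
    refine DifferentiableAt.differentiableWithinAt ?_
    rcases (han.deriv x hx).eventually_eq_zero_or_eventually_ne_zero with h1 | h1
    · exfalso
      obtain ⟨ε, hε, hb⟩ := Metric.mem_nhds_iff.1 (h1.and (hU.mem_nhds hx))
      have hy : x + (ε / 2 : ℝ) ∈ ball x ε := by
        simp [abs_of_pos hε, hε]
      have h3 : h (x + (ε / 2 : ℝ)) = h x := isOpen_ball.is_const_of_deriv_eq_zero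
        (convex_ball x ε).isPreconnected (hd.mono fun z hz => (hb hz).2) (fun z hz => (hb hz).1) hy
        (mem_ball_self hε)
      have h2 := hi (hb hy).2 hx h3
      simp [hε.ne'] at h2
    · rw [eventually_nhdsWithin_iff] at h1
      have hN := h1.and (hU.mem_nhds hx)
      have hmem := himg x hx _ hN
      refine DifferentiableOn.differentiableAt ?_ hmem
      refine (Complex.differentiableOn_compl_singleton_and_continuousAt_iff hmem).1 ⟨?_, hcont x hx⟩
      rintro _ ⟨⟨y, hy, rfl⟩, hyx⟩
      refine (good y hy.2 (hy.1 ?_)).differentiableWithinAt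
      rintro rfl
      exact hyx rfl
  · rw [isOpen_iff_mem_nhds]
    rintro _ ⟨x, hx, rfl⟩
    exact himg x hx U (hU.mem_nhds hx)

theorem riemann_map {U : Set ℂ} (hU : IsOpen U) (hUc : IsPreconnected U)
    (hb : Bornology.IsBounded U) (hl : AllLogs U) {p : ℂ} (hp : p ∈ U) :
    ∃ φ : ℂ → ℂ, DifferentiableOn ℂ φ (ball 0 1) ∧ Set.InjOn φ (ball 0 1) ∧ φ '' ball 0 1 = U ∧
      φ 0 = p := by
  obtain ⟨R, hR⟩ := hb.subset_ball p
  have hR0 : 0 < R := by simpa using hR hp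
  have h0mem : (fun z => (z - p) / R) ∈ RFam U p := by
    refine ⟨by fun_prop, fun x _ y _ hxy => ?_, fun z hz => ?_, by simp⟩
    · have hRC : (R : ℂ) ≠ 0 := by exact_mod_cast hR0.ne'
      simp only at hxy
      field_simp at hxy
      exact sub_left_injective hxy
    · have := hR hz
      rw [mem_ball_iff_norm] at this
      rw [norm_div, Complex.norm_real, Real.norm_of_nonneg hR0.le, div_lt_one hR0]
      exact this
  have lip : ∀ x ∈ U, ∀ ε > 0, ball x ε ⊆ U → ∀ h ∈ RFam U p, Set.MapsTo h (ball x ε)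
      (closedBall (h x) 2) := by
    intro x hx ε _ hxε h hh y hy
    rw [mem_closedBall, dist_eq_norm]
    have h1 := hh.2.2.1 x hx
    have h2 := hh.2.2.1 y (hxε hy)
    linarith [norm_sub_le (h y) (h x)]
  let D : Set ℝ := (fun h => ‖deriv h p‖) '' RFam U p
  have hDbdd : BddAbove D := by
    obtain ⟨ε, hε, hbε⟩ := Metric.isOpen_iff.1 hU p hp
    refine ⟨2 / ε, ?_⟩
    rintro _ ⟨h, hh, rfl⟩
    exact Complex.norm_deriv_le_div_of_mapsTo_ball (hh.1.mono hbε) (lip p hp ε hε hbε h hh) hε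
  have hDne : D.Nonempty := ⟨_, _, h0mem, rfl⟩
  obtain ⟨u, -, hu, huD⟩ := exists_seq_tendsto_sSup hDne hDbdd
  have hpos : 0 < sSup D := by
    refine lt_of_lt_of_le ?_ (le_csSup hDbdd ⟨_, h0mem, rfl⟩)
    have : HasDerivAt (fun z => (z - p) / R) (1 / R) p := ((hasDerivAt_id p).sub_const p).div_const _
    simp only [this.deriv]
    simp [hR0.ne']
  choose F hF hFu using huD
  let l : Filter ℕ := (Filter.hyperfilter ℕ : Ultrafilter ℕ)
  have hlim : ∀ z, ∃ w, z ∈ U → Filter.Tendsto (fun n => F n z) l (𝓝 w) := by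
    intro z
    by_cases hz : z ∈ U
    · obtain ⟨w, -, hw⟩ := (isCompact_closedBall (0 : ℂ) 1).ultrafilter_le_nhds
        ((Filter.hyperfilter ℕ).map fun n => F n z) (by
          rw [Filter.le_principal_iff, Ultrafilter.coe_map]
          refine Filter.mem_map.2 (Filter.Eventually.of_forall fun n => ?_)
          change F n z ∈ closedBall 0 1
          rw [mem_closedBall_zero_iff]
          exact ((hF n).2.2.1 z hz).le)
      exact ⟨w, fun _ => hw⟩
    · exact ⟨0, fun h => absurd h hz⟩
  choose h hh using hlim
  have hunif : TendstoLocallyUniformlyOn F h l U := by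
    rw [Metric.tendstoLocallyUniformlyOn_iff]
    intro ε hε x hx
    obtain ⟨r, hr, hbr⟩ := Metric.isOpen_iff.1 hU x hx
    set η := min r (ε * r / 8) with hη
    have hη0 : 0 < η := by positivity
    have est : ∀ y ∈ ball x η, ∀ n, dist (F n y) (F n x) ≤ ε / 4 := by
      intro y hy n
      have hyr : y ∈ ball x r := ball_subset_ball (min_le_left _ _) hy
      have h1 := Complex.dist_le_div_mul_dist_of_mapsTo_ball ((hF n).1.mono hbr)
        (lip x hx r hr hbr _ (hF n)) hyr
      have h2 : dist y x ≤ ε * r / 8 := (le_of_lt hy).trans (min_le_right _ _)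
      calc _ ≤ 2 / r * dist y x := h1
        _ ≤ 2 / r * (ε * r / 8) := by gcongr
        _ = ε / 4 := by field_simp; norm_num
    refine ⟨ball x η, mem_nhdsWithin_of_mem_nhds (ball_mem_nhds x hη0), ?_⟩
    have h3 := Metric.tendsto_nhds.1 (hh x hx) (ε / 4) (by positivity)
    filter_upwards [h3] with n hn y hy
    have hyU : y ∈ U := hbr (ball_subset_ball (min_le_left _ _) hy)
    have h4 : dist (h y) (h x) ≤ ε / 4 :=
      le_of_tendsto ((hh y hyU).dist (hh x hx)) (Filter.Eventually.of_forall (est y hy))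
    have h5 := est y hy n
    have h6 := dist_triangle4 (h y) (h x) (F n x) (F n y)
    rw [dist_comm (h x), dist_comm (F n x) (F n y)] at h6
    linarith
  have hFd : ∀ n, DifferentiableOn ℂ (F n) U := fun n => (hF n).1
  have hd : DifferentiableOn ℂ h U := hunif.differentiableOn (Filter.Eventually.of_forall hFd) hU
  have hderiv : ‖deriv h p‖ = sSup D := by
    have h1 := (hunif.deriv (Filter.Eventually.of_forall hFd) hU).tendsto_at hp
    have h2 : Filter.Tendsto u l (𝓝 (sSup D)) := hu.mono_left (by
      rw [← Nat.cofinite_eq_atTop]; exact Filter.hyperfilter_le_cofinite)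
    refine tendsto_nhds_unique h1.norm (h2.congr fun n => ?_)
    exact (hFu n).symm
  have hd0 : deriv h p ≠ 0 := norm_pos_iff.1 (hderiv ▸ hpos)
  have hp0 : h p = 0 := by
    refine tendsto_nhds_unique (hh p hp) ?_
    refine tendsto_const_nhds.congr fun n => ((hF n).2.2.2).symm
  have hle : ∀ z ∈ U, ‖h z‖ ≤ 1 := fun z hz =>
    le_of_tendsto (hh z hz).norm (Filter.Eventually.of_forall fun n => ((hF n).2.2.1 z hz).le)
  have hnc : ∃ x ∈ U, ∃ y ∈ U, h x ≠ h y := by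
    by_contra hcon
    push Not at hcon
    refine hd0 ?_
    have : h =ᶠ[𝓝 p] fun _ => h p := by
      filter_upwards [hU.mem_nhds hp] with z hz
      exact hcon z hz p hp
    rw [this.deriv_eq]; simp
  have hlt : ∀ z ∈ U, ‖h z‖ < 1 := by
    intro z hz
    refine lt_of_le_of_ne (hle z hz) fun h1 => ?_
    have := Complex.eqOn_of_isPreconnected_of_isMaxOn_norm hUc hU hd hz (fun y hy => by
      simp only [Function.comp_apply]
      change ‖h y‖ ≤ ‖h z‖
      rw [h1]; exact hle y hy)
    have h2 := this hp
    simp only [Function.const_apply, hp0] at h2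
    rw [← h2] at h1
    simp at h1
  have hi : Set.InjOn h U := inj_limit hU hUc hunif hFd (fun n => (hF n).2.1) hd hnc
  have hfam : h ∈ RFam U p := ⟨hd, hi, hlt, hp0⟩
  have himg : h '' U = ball 0 1 := by
    refine Set.Subset.antisymm ?_ ?_
    · rintro _ ⟨z, hz, rfl⟩
      rw [mem_ball_zero_iff]; exact hlt z hz
    · intro w hw
      by_contra hcon
      obtain ⟨H, hH, hlt'⟩ := rfam_improve hU hl hp hfam hd0 (mem_ball_zero_iff.1 hw)
        fun z hz hzw => hcon ⟨z, hz, hzw⟩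
      rw [hderiv] at hlt'
      exact absurd (le_csSup hDbdd ⟨H, hH, rfl⟩) (not_le.2 hlt')
  let φ : ℂ → ℂ := Function.invFunOn h U
  have hφ : ∀ z ∈ U, φ (h z) = z := fun z hz => hi.leftInvOn_invFunOn hz
  have hφ' : ∀ w ∈ ball (0 : ℂ) 1, φ w ∈ U ∧ h (φ w) = w := fun w hw => by
    rw [← himg] at hw
    exact ⟨Function.invFunOn_mem hw, Function.invFunOn_eq hw⟩
  refine ⟨φ, ?_, ?_, ?_, ?_⟩
  · have := (inverse_diff hU hd hi hφ).1
    rwa [himg] at this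
  · intro x hx y hy hxy
    rw [← (hφ' x hx).2, ← (hφ' y hy).2, hxy]
  · refine Set.Subset.antisymm ?_ ?_
    · rintro _ ⟨w, hw, rfl⟩
      exact (hφ' w hw).1
    · intro z hz
      refine ⟨h z, ?_, hφ z hz⟩
      rw [← himg]; exact ⟨z, hz, rfl⟩
  · rw [← hp0]; exact hφ p hp

end PCL

namespace PCL
open Metric MeasureTheory

theorem length_area {ψ : ℂ → ℂ} {W : Set ℂ} (hW : IsOpen W) (hd : DifferentiableOn ℂ ψ W)
    (hi : Set.InjOn ψ W) (hb : volume (ψ '' W) ≠ ⊤) (M : ℝ) {s : ℝ} (hs : 0 < s) :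
    ∃ u < M, ∫⁻ θ in {θ : ℝ | (u + θ * Complex.I : ℂ) ∈ W},
      ENNReal.ofReal (‖deriv ψ (u + θ * Complex.I)‖ ^ 2) ≤ ENNReal.ofReal (s ^ 2) := by
  by_contra hcon
  push Not at hcon
  have hdet : ∀ z, |((ContinuousLinearMap.restrictScalars ℝ
      (ContinuousLinearMap.toSpanSingleton ℂ (deriv ψ z))).det)| = ‖deriv ψ z‖ ^ 2 := by
    intro z
    have : (ContinuousLinearMap.restrictScalars ℝ
      (ContinuousLinearMap.toSpanSingleton ℂ (deriv ψ z))).det = ‖deriv ψ z‖ ^ 2 := by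
      simp [ContinuousLinearMap.det, LinearMap.det_restrictScalars, Algebra.norm_complex_apply,
        Complex.normSq_eq_norm_sq]
    rw [this, abs_of_nonneg (by positivity)]
  have h1 := lintegral_abs_det_fderiv_eq_addHaar_image volume hW.measurableSet
    (f := ψ) (f' := fun z => ContinuousLinearMap.restrictScalars ℝ
      (ContinuousLinearMap.toSpanSingleton ℂ (deriv ψ z)))
    (fun z hz => ((hd.differentiableAt (hW.mem_nhds hz)).hasDerivAt.hasFDerivAt.restrictScalars
      ℝ).hasFDerivWithinAt) hi
  simp only [hdet] at h1
  have hmeas : Measurable (W.indicator fun z => ENNReal.ofReal (‖deriv ψ z‖ ^ 2)) := by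
    refine Measurable.indicator ?_ hW.measurableSet
    exact ((measurable_deriv ψ).norm.pow_const 2).ennreal_ofReal
  rw [← lintegral_indicator hW.measurableSet,
    ← (Complex.volume_preserving_equiv_real_prod.symm).lintegral_comp_emb
      Complex.measurableEquivRealProd.symm.measurableEmbedding, Measure.volume_eq_prod,
    lintegral_prod (fun z => W.indicator (fun x => ENNReal.ofReal (‖deriv ψ x‖ ^ 2))
        (Complex.measurableEquivRealProd.symm z))
      (hmeas.comp Complex.measurableEquivRealProd.symm.measurable).aemeasurable] at h1
  refine hb (h1.symm.trans (top_le_iff.1 ?_))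
  calc (⊤ : ENNReal) = ∫⁻ u in Set.Iio M, ENNReal.ofReal (s ^ 2) := by
        rw [setLIntegral_const, Real.volume_Iio, ENNReal.mul_top]
        simpa using hs.ne'
    _ ≤ ∫⁻ u in Set.Iio M, _ := by
        refine setLIntegral_mono' measurableSet_Iio fun u hu => ?_
        refine (hcon u hu).le.trans (le_of_eq ?_)
        have hm : MeasurableSet {θ : ℝ | (u + θ * Complex.I : ℂ) ∈ W} :=
          (hW.preimage (f := fun θ : ℝ => (u + θ * Complex.I : ℂ)) (by fun_prop)).measurableSet
        rw [← lintegral_indicator hm]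
        refine lintegral_congr fun θ => ?_
        have e : Complex.measurableEquivRealProd.symm (u, θ) = u + θ * Complex.I := by
          rw [Complex.measurableEquivRealProd_symm_apply]
          simp [Complex.ext_iff]
        rw [e]
        rfl
    _ ≤ _ := setLIntegral_le_lintegral _ _

theorem slice_est {ψ : ℂ → ℂ} {W : Set ℂ} (hW : IsOpen W) (hd : DifferentiableOn ℂ ψ W)
    {u s : ℝ} (hs : 0 < s) (h : ∫⁻ θ in {θ : ℝ | (u + θ * Complex.I : ℂ) ∈ W},
      ENNReal.ofReal (‖deriv ψ (u + θ * Complex.I)‖ ^ 2) ≤ ENNReal.ofReal (s ^ 2))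
    {a b : ℝ} (hab : a ≤ b) (hπ : b - a ≤ 4) (hin : ∀ θ ∈ Set.Icc a b, (u + θ * Complex.I : ℂ) ∈ W) :
    ‖ψ (u + b * Complex.I) - ψ (u + a * Complex.I)‖ ≤ 3 * s := by
  have hdd := hd.deriv hW
  let g : ℝ → ℂ := fun θ => deriv ψ (u + θ * Complex.I)
  have hgc : ContinuousOn g (Set.Icc a b) := by
    refine hdd.continuousOn.comp (Continuous.continuousOn (by fun_prop)) hin
  have hder : ∀ θ ∈ Set.uIcc a b, HasDerivAt (fun θ : ℝ => ψ (u + θ * Complex.I)) (g θ * Complex.I) θ := by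
    intro θ hθ
    rw [Set.uIcc_of_le hab] at hθ
    have h1 := (hd.differentiableAt (hW.mem_nhds (hin θ hθ))).hasDerivAt
    have h2 : HasDerivAt (fun θ : ℝ => (u + θ * Complex.I : ℂ)) Complex.I θ := by
      have := ((hasDerivAt_id θ).ofReal_comp.mul_const Complex.I).const_add (u : ℂ)
      simpa using this
    have := HasDerivAt.comp_ofReal (z := θ) (e := fun w : ℂ => ψ (u + w * Complex.I))
      (e' := g θ * Complex.I) (by
        have h3 : HasDerivAt (fun w : ℂ => (u + w * Complex.I : ℂ)) Complex.I (θ : ℂ) := by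
          have := ((hasDerivAt_id (θ : ℂ)).mul_const Complex.I).const_add (u : ℂ)
          simpa using this
        exact HasDerivAt.comp (θ : ℂ) h1 h3)
    exact this
  have hgc' : ContinuousOn (fun θ => g θ * Complex.I) (Set.uIcc a b) := by
    rw [Set.uIcc_of_le hab]; exact hgc.mul continuousOn_const
  rw [← intervalIntegral.integral_eq_sub_of_hasDerivAt hder hgc'.intervalIntegrable]
  have hsq : ∫ θ in a..b, ‖g θ‖ ^ 2 ≤ s ^ 2 := by
    rw [intervalIntegral.integral_of_le hab]
    have hinter0 : IntegrableOn (fun θ => ‖g θ‖ ^ 2) (Set.Ioc a b) :=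
      ((hgc.norm.pow 2).integrableOn_Icc).mono_set Set.Ioc_subset_Icc_self
    refine (ENNReal.ofReal_le_ofReal_iff (by positivity)).1 ?_
    rw [ofReal_integral_eq_lintegral_ofReal hinter0 (Filter.Eventually.of_forall fun x => by positivity)]
    refine le_trans (lintegral_mono_set ?_) h
    intro θ hθ
    exact hin θ (Set.Ioc_subset_Icc_self hθ)
  have hi1 : IntervalIntegrable (fun θ => ‖g θ‖ ^ 2) volume a b := by
    refine ContinuousOn.intervalIntegrable ?_
    rw [Set.uIcc_of_le hab]; exact hgc.norm.pow 2
  calc _ ≤ ∫ θ in a..b, ‖g θ * Complex.I‖ := intervalIntegral.norm_integral_le_integral_norm hab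
    _ ≤ ∫ θ in a..b, (‖g θ‖ ^ 2 * (1 / (2 * s)) + s / 2) := by
        refine intervalIntegral.integral_mono_on hab hgc'.norm.intervalIntegrable
          ((hi1.mul_const _).add intervalIntegrable_const) fun θ _ => ?_
        rw [norm_mul, Complex.norm_I, mul_one]
        have := sq_nonneg (‖g θ‖ - s)
        have h2 : ‖g θ‖ ^ 2 * (1 / (2 * s)) + s / 2 - ‖g θ‖ = (‖g θ‖ - s) ^ 2 / (2 * s) := by
          field_simp; ring
        have h3 : 0 ≤ (‖g θ‖ - s) ^ 2 / (2 * s) := by positivity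
        linarith
    _ = (∫ θ in a..b, ‖g θ‖ ^ 2) * (1 / (2 * s)) + (b - a) * (s / 2) := by
        rw [intervalIntegral.integral_add (hi1.mul_const _) intervalIntegrable_const,
          intervalIntegral.integral_mul_const, intervalIntegral.integral_const, smul_eq_mul]
    _ ≤ s ^ 2 * (1 / (2 * s)) + 4 * (s / 2) := by gcongr
    _ ≤ 3 * s := by
        have : s ^ 2 * (1 / (2 * s)) = s / 2 := by field_simp
        linarith

/-- Crosscuts with small image. -/
theorem crosscut {φ : ℂ → ℂ} (hd : DifferentiableOn ℂ φ (ball 0 1)) (hi : Set.InjOn φ (ball 0 1))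
    (hb : Bornology.IsBounded (φ '' ball 0 1)) {ζ : ℂ} (hζ : ‖ζ‖ = 1) {s δ : ℝ} (hs : 0 < s)
    (hδ : 0 < δ) : ∃ ρ, 0 < ρ ∧ ρ < δ ∧ ∀ z ∈ ball (0 : ℂ) 1 ∩ sphere ζ ρ,
      ∀ w ∈ ball (0 : ℂ) 1 ∩ sphere ζ ρ, dist (φ z) (φ w) ≤ 3 * s := by
  have hζ0 : ζ ≠ 0 := norm_pos_iff.1 (by rw [hζ]; exact one_pos)
  let k : ℂ → ℂ := fun w => ζ * (1 - Complex.exp w)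
  let W : Set ℂ := {w | |w.im| < Real.pi / 2 ∧ ‖k w‖ < 1}
  have hkd : Differentiable ℂ k := by simp only [k]; fun_prop
  have hWo : IsOpen W := by
    have h1 : IsOpen {w : ℂ | |w.im| < Real.pi / 2} :=
      isOpen_lt (Complex.continuous_im).abs continuous_const
    have h2 : IsOpen {w : ℂ | ‖k w‖ < 1} := isOpen_lt hkd.continuous.norm continuous_const
    exact h1.inter h2
  have hkW : Set.MapsTo k W (ball 0 1) := fun w hw => mem_ball_zero_iff.2 hw.2
  have hki : Set.InjOn k W := by
    intro x hx y hy hxy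
    have h1 : Complex.exp x = Complex.exp y := by
      have := mul_left_cancel₀ hζ0 hxy
      exact sub_right_injective this
    have hx1 := abs_lt.1 hx.1
    have hy1 := abs_lt.1 hy.1
    have hpi := Real.pi_pos
    exact Complex.exp_inj_of_neg_pi_lt_of_le_pi (by linarith) (by linarith) (by linarith) (by linarith) h1
  have hψd : DifferentiableOn ℂ (φ ∘ k) W := hd.comp hkd.differentiableOn hkW
  have hψi : Set.InjOn (φ ∘ k) W := hi.comp hki hkW
  have hvol : volume ((φ ∘ k) '' W) ≠ ⊤ := by
    refine (hb.subset ?_).measure_lt_top.ne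
    rintro _ ⟨w, hw, rfl⟩
    exact ⟨_, hkW hw, rfl⟩
  obtain ⟨u, hu, hlt⟩ := length_area hWo hψd hψi hvol (Real.log δ) hs
  have hnk : ∀ u θ : ℝ, ‖k (u + θ * Complex.I)‖ ^ 2 = 1 - 2 * Real.exp u * Real.cos θ + Real.exp u ^ 2 := by
    intro u θ
    simp only [k]
    rw [norm_mul, hζ, one_mul, ← Complex.normSq_eq_norm_sq, Complex.exp_add, Complex.exp_mul_I,
      ← Complex.ofReal_exp, ← Complex.ofReal_cos, ← Complex.ofReal_sin, Complex.normSq_apply]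
    simp [-Complex.ofReal_exp, -Complex.ofReal_cos, -Complex.ofReal_sin]
    nlinarith [Real.sin_sq_add_cos_sq θ]
  have hmem : ∀ z ∈ ball (0 : ℂ) 1 ∩ sphere ζ (Real.exp u), ∃ θ : ℝ, |θ| < Real.pi / 2 ∧
      Real.exp u < 2 * Real.cos θ ∧ z = k (u + θ * Complex.I) := by
    rintro z ⟨hz1, hz2⟩
    rw [mem_ball_zero_iff] at hz1
    rw [mem_sphere_iff_norm] at hz2
    have hn : ‖1 - z / ζ‖ = Real.exp u := by
      have : z - ζ = -(ζ * (1 - z / ζ)) := by field_simp; ring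
      rw [this, norm_neg, norm_mul, hζ, one_mul] at hz2; exact hz2
    have hne : 1 - z / ζ ≠ 0 := norm_pos_iff.1 (by rw [hn]; exact Real.exp_pos u)
    have hzk : z = k (u + (1 - z / ζ).arg * Complex.I) := by
      have : Complex.log (1 - z / ζ) = u + (1 - z / ζ).arg * Complex.I := by
        rw [Complex.log, hn, Real.log_exp]
      simp only [k]
      rw [← this, Complex.exp_log hne]; field_simp; ring
    have h3 : ‖z‖ ^ 2 < 1 := by nlinarith [norm_nonneg z]
    have h4 := hnk u (1 - z / ζ).arg
    rw [← hzk] at h4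
    have hc : Real.exp u < 2 * Real.cos (1 - z / ζ).arg := by
      have := Real.exp_pos u
      by_contra hcon
      push Not at hcon
      nlinarith
    refine ⟨_, ?_, hc, hzk⟩
    rw [Complex.abs_arg_lt_pi_div_two_iff]
    left
    have h5 := Complex.cos_arg hne
    rw [h5] at hc
    have h6 : 0 < (1 - z / ζ).re / ‖1 - z / ζ‖ := by linarith [Real.exp_pos u]
    have := (div_pos_iff_of_pos_right (norm_pos_iff.2 hne)).1 h6
    exact this
  have key : ∀ a b : ℝ, a ≤ b → |a| < Real.pi / 2 → |b| < Real.pi / 2 → Real.exp u < 2 * Real.cos a →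
      Real.exp u < 2 * Real.cos b →
      dist (φ (k (u + b * Complex.I))) (φ (k (u + a * Complex.I))) ≤ 3 * s := by
    intro a b hab ha hb hca hcb
    rw [dist_eq_norm]
    have ha' := abs_lt.1 ha
    have hb' := abs_lt.1 hb
    refine slice_est (ψ := φ ∘ k) hWo hψd hs hlt hab (by linarith [Real.pi_lt_four]) ?_
    intro θ hθ
    have hc : Real.exp u < 2 * Real.cos θ := by
      have hpi := Real.pi_pos
      rcases le_total 0 θ with h0 | h0
      · have := Real.cos_le_cos_of_nonneg_of_le_pi h0 (by linarith) hθ.2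
        linarith
      · have := Real.cos_le_cos_of_nonneg_of_le_pi (x := -θ) (y := -a) (by linarith) (by linarith)
          (by linarith [hθ.1])
        rw [Real.cos_neg, Real.cos_neg] at this
        linarith
    refine ⟨?_, ?_⟩
    · have : (u + θ * Complex.I : ℂ).im = θ := by simp
      rw [this, abs_lt]
      constructor <;> linarith [hθ.1, hθ.2]
    · have h4 := hnk u θ
      have := Real.exp_pos u
      by_contra hcon
      push Not at hcon
      nlinarith
  refine ⟨Real.exp u, Real.exp_pos u, ?_, ?_⟩
  · calc Real.exp u < Real.exp (Real.log δ) := Real.exp_lt_exp.2 hu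
      _ = δ := Real.exp_log hδ
  · intro z hz w hw
    obtain ⟨a, ha, hca, rfl⟩ := hmem z hz
    obtain ⟨b, hb, hcb, rfl⟩ := hmem w hw
    rcases le_total a b with hab | hab
    · rw [dist_comm]; exact key a b hab ha hb hca hcb
    · exact key b a hab hb ha hcb hca

end PCL

namespace PCL
open Metric

theorem small_arc {γ : Circle → ℂ} (hγ : Continuous γ) (hγi : Function.Injective γ) {ε : ℝ}
    (hε : 0 < ε) : ∃ s > 0, ∀ E : Set ℂ, E ⊆ Set.range γ → (∀ x ∈ E, ∀ y ∈ E, dist x y ≤ s) →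
      ∃ J' : Set ℂ, E ⊆ J' ∧ J' ⊆ Set.range γ ∧ IsCompact J' ∧ IsPreconnected J' ∧
        ∀ x ∈ J', ∀ y ∈ J', dist x y ≤ ε := by
  obtain ⟨F, hF, e⟩ := exists_inverse hγ hγi
  have hu := CompactSpace.uniformContinuous_of_continuous hγ
  obtain ⟨δ, hδ, hδ'⟩ := Metric.uniformContinuous_iff.1 hu (ε / 2) (by positivity)
  obtain ⟨η, hη, hη'⟩ := Metric.continuous_iff.1 Circle.exp.continuous 0 δ hδ
  have harg : ContinuousAt Complex.arg 1 := Complex.continuousAt_arg (by simp)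
  obtain ⟨κ, hκ, hκ'⟩ := Metric.continuousAt_iff.1 harg (η / 2) (by positivity)
  have hK : IsCompact (Set.range γ) := isCompact_range hγ
  have hFu := hK.uniformContinuousOn_of_continuous hF.continuousOn
  obtain ⟨s, hs, hs'⟩ := Metric.uniformContinuousOn_iff.1 hFu κ hκ
  refine ⟨s / 2, by positivity, fun E hE hEd => ?_⟩
  rcases E.eq_empty_or_nonempty with rfl | ⟨x0, hx0⟩
  · exact ⟨∅, Set.Subset.rfl, Set.empty_subset _, isCompact_empty, isPreconnected_empty, by simp⟩
  obtain ⟨a0, rfl⟩ := hE hx0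
  have hc : Continuous fun t : ℝ => γ (a0 * Circle.exp t) := by fun_prop
  refine ⟨(fun t : ℝ => γ (a0 * Circle.exp t)) '' Set.Icc (-(η / 2)) (η / 2), ?_, ?_,
    isCompact_Icc.image hc, isPreconnected_Icc.image _ hc.continuousOn, ?_⟩
  · intro x hx
    obtain ⟨a, rfl⟩ := hE hx
    have h1 := hs' _ (hE hx) _ (hE hx0) (lt_of_le_of_lt (hEd _ hx _ hx0) (by linarith))
    rw [e, e] at h1
    have h2 : dist ((a / a0 : Circle) : ℂ) 1 < κ := by
      rw [dist_eq_norm] at h1 ⊢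
      have : ((a / a0 : Circle) : ℂ) - 1 = (a - a0) / a0 := by
        rw [Circle.coe_div, sub_div, div_self a0.coe_ne_zero]
      rw [this, norm_div, Circle.norm_coe, div_one]; exact h1
    have h3 := hκ' h2
    rw [Complex.arg_one, Real.dist_0_eq_abs, abs_lt] at h3
    refine ⟨Complex.arg ((a / a0 : Circle) : ℂ), ⟨h3.1.le, h3.2.le⟩, ?_⟩
    simp only [Circle.exp_arg]
    congr 1
    rw [mul_div_cancel]
  · rintro _ ⟨t, -, rfl⟩
    exact ⟨_, rfl⟩
  · have h4 : ∀ t ∈ Set.Icc (-(η / 2)) (η / 2), dist (γ (a0 * Circle.exp t)) (γ a0) < ε / 2 := by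
      intro t ht
      refine hδ' ?_
      have h5 := hη' t (by rw [Real.dist_0_eq_abs, abs_lt]; constructor <;> linarith [ht.1, ht.2])
      rw [Circle.exp_zero] at h5
      have h6 : dist (a0 * Circle.exp t) a0 = dist (Circle.exp t) 1 := by
        change dist ((a0 * Circle.exp t : Circle) : ℂ) (a0 : ℂ) =
          dist ((Circle.exp t : Circle) : ℂ) ((1 : Circle) : ℂ)
        rw [dist_eq_norm, dist_eq_norm]
        have : ((a0 * Circle.exp t : Circle) : ℂ) - a0 = a0 * ((Circle.exp t : Circle) - ((1 : Circle) : ℂ)) := by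
          rw [Circle.coe_mul, Circle.coe_one]; ring
        rw [this, norm_mul, Circle.norm_coe, one_mul]
      rw [h6]; exact h5
    rintro _ ⟨t, ht, rfl⟩ _ ⟨t', ht', rfl⟩
    have := dist_triangle_right (γ (a0 * Circle.exp t)) (γ (a0 * Circle.exp t')) (γ a0)
    have := h4 t ht
    have := h4 t' ht'
    simp only
    linarith

theorem isPreconnected_compl_closedBall (a : ℂ) {r : ℝ} (hr : 0 < r) :
    IsPreconnected (closedBall a r)ᶜ := by
  have := (isPreconnected_norm_gt hr).image (fun z => z + a) (by fun_prop)
  convert this using 1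
  ext z
  constructor
  · intro hz
    rw [Set.mem_compl_iff, mem_closedBall, not_le, dist_eq_norm] at hz
    exact ⟨z - a, hz, by simp⟩
  · rintro ⟨w, hw, rfl⟩
    rw [Set.mem_compl_iff, mem_closedBall, not_le, dist_eq_norm]
    simpa using hw

/-- The standing hypotheses on a Riemann map. -/
structure RM (γ : Circle → ℂ) (p : ℂ) (φ g : ℂ → ℂ) : Prop where
  hγ : Continuous γ
  hγi : Function.Injective γ
  hp : p ∉ Set.range γ
  hb : Bornology.IsBounded (connectedComponentIn (Set.range γ)ᶜ p)
  hd : DifferentiableOn ℂ φ (ball 0 1)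
  hi : Set.InjOn φ (ball 0 1)
  img : φ '' ball 0 1 = connectedComponentIn (Set.range γ)ᶜ p
  h0 : φ 0 = p
  gd : DifferentiableOn ℂ g (connectedComponentIn (Set.range γ)ᶜ p)
  gφ : ∀ z ∈ ball (0 : ℂ) 1, g (φ z) = z

theorem exists_RM {γ : Circle → ℂ} (hγ : Continuous γ) (hγi : Function.Injective γ) {p : ℂ}
    (hp : p ∉ Set.range γ) (hb : Bornology.IsBounded (connectedComponentIn (Set.range γ)ᶜ p)) :
    ∃ φ g, RM γ p φ g := by
  have hJ : IsCompact (Set.range γ) := isCompact_range hγ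
  have hJc : IsConnected (Set.range γ) := isConnected_range hγ
  obtain ⟨φ, h1, h2, h3, h4⟩ := riemann_map hJ.isClosed.isOpen_compl.connectedComponentIn
    isPreconnected_connectedComponentIn hb (allLogs_comp hJ hJc hb) (mem_connectedComponentIn hp)
  have hg : ∀ z ∈ ball (0 : ℂ) 1, Function.invFunOn φ (ball 0 1) (φ z) = z :=
    fun z hz => h2.leftInvOn_invFunOn hz
  have := (inverse_diff isOpen_ball h1 h2 hg).1
  rw [h3] at this
  exact ⟨φ, _, hγ, hγi, hp, hb, h1, h2, h3, h4, this, hg⟩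

namespace RM
variable {γ : Circle → ℂ} {p : ℂ} {φ g : ℂ → ℂ}

theorem cJ (h : RM γ p φ g) : IsCompact (Set.range γ) := isCompact_range h.hγ

theorem mem (h : RM γ p φ g) {z : ℂ} (hz : z ∈ ball (0 : ℂ) 1) :
    φ z ∈ connectedComponentIn (Set.range γ)ᶜ p := by
  rw [← h.img]; exact ⟨z, hz, rfl⟩

theorem notJ (_h : RM γ p φ g) {z : ℂ} (hz : z ∈ connectedComponentIn (Set.range γ)ᶜ p) :
    z ∉ Set.range γ := connectedComponentIn_subset _ _ hz

theorem gmem (h : RM γ p φ g) {w : ℂ} (hw : w ∈ connectedComponentIn (Set.range γ)ᶜ p) :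
    g w ∈ ball (0 : ℂ) 1 ∧ φ (g w) = w := by
  rw [← h.img] at hw
  obtain ⟨z, hz, rfl⟩ := hw
  rw [h.gφ z hz]; exact ⟨hz, rfl⟩

/-- A connected set avoiding `J` and meeting `U` pulls back to a connected subset of the disc. -/
theorem pull (h : RM γ p φ g) {D : Set ℂ} (hD : IsPreconnected D) (hDJ : ∀ z ∈ D, z ∉ Set.range γ)
    {x : ℂ} (hx : x ∈ ball (0 : ℂ) 1) (hxD : φ x ∈ D) :
    IsPreconnected (g '' D) ∧ D ⊆ connectedComponentIn (Set.range γ)ᶜ p := by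
  have hsub : D ⊆ connectedComponentIn (Set.range γ)ᶜ p := by
    rw [connectedComponentIn_eq (h.mem hx)]
    exact hD.subset_connectedComponentIn hxD hDJ
  exact ⟨hD.image _ (h.gd.continuousOn.mono hsub), hsub⟩

theorem small (h : RM γ p φ g) {ζ : ℂ} (hζ : ‖ζ‖ = 1) {ε : ℝ} (hε : 0 < ε) :
    ∃ ρ > 0, ∃ a, ∀ z ∈ ball (0 : ℂ) 1 ∩ ball ζ ρ, φ z ∈ closedBall a ε := by
  -- reduce to small epsilon
  have hsub : ball (0 : ℂ) (1 / 2) ⊆ ball 0 1 := ball_subset_ball (by norm_num)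
  have hopen := (inverse_diff isOpen_ball (h.hd.mono hsub) (h.hi.mono hsub)
    (fun z hz => h.gφ z (hsub hz))).2
  obtain ⟨r, hr, hrb⟩ := Metric.isOpen_iff.1 hopen (φ 0) ⟨0, by simp, rfl⟩
  set ε' := min ε (r / 2) with hε'
  have hε'0 : 0 < ε' := lt_min hε (by positivity)
  obtain ⟨s, hs, harc⟩ := small_arc h.hγ h.hγi (ε := ε' / 2) (by positivity)
  set s' := min (s / 3) (ε' / 6) with hs'
  have hs'0 : 0 < s' := lt_min (by positivity) (by positivity)
  obtain ⟨ρ, hρ, hρ2, hdiam⟩ := crosscut h.hd h.hi (by rw [h.img]; exact h.hb) hζ hs'0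
    (δ := 1 / 2) (by norm_num)
  set C := ball (0 : ℂ) 1 ∩ sphere ζ ρ with hC
  -- base point of the crosscut
  have hbase : ∃ c, c ∈ C := by
    refine ⟨ζ * (1 - ρ), ?_, ?_⟩
    · rw [mem_ball_zero_iff, norm_mul, hζ, one_mul]
      have : (1 - ρ : ℂ) = ((1 - ρ : ℝ) : ℂ) := by push_cast; ring
      rw [this, Complex.norm_real, Real.norm_of_nonneg (by linarith)]; linarith
    · rw [mem_sphere_iff_norm]
      have : ζ * (1 - ρ) - ζ = -(ζ * (ρ : ℝ)) := by ring
      rw [this, norm_neg, norm_mul, hζ, one_mul, Complex.norm_real, Real.norm_of_nonneg hρ.le]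
  obtain ⟨c, hc⟩ := hbase
  set a := φ c with ha
  set X := closure (φ '' C) with hX
  have hXdiam : ∀ x ∈ X, ∀ y ∈ X, dist x y ≤ 3 * s' := by
    have h1 : ∀ x ∈ X, ∀ y ∈ φ '' C, dist x y ≤ 3 * s' := by
      intro x hx y hy
      refine closure_minimal (s := φ '' C) (t := {x | dist x y ≤ 3 * s'}) ?_
        (isClosed_le (by fun_prop) continuous_const) hx
      rintro _ ⟨z, hz, rfl⟩
      obtain ⟨w, hw, rfl⟩ := hy
      exact hdiam z hz w hw
    intro x hx y hy
    exact closure_minimal (s := φ '' C) (t := {y | dist x y ≤ 3 * s'}) (fun y hy => h1 x hx y hy)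
      (isClosed_le (by fun_prop) continuous_const) hy
  have haX : a ∈ X := subset_closure ⟨c, hc, rfl⟩
  have hXc : IsCompact X := Metric.isCompact_of_isClosed_isBounded isClosed_closure
    (Metric.isBounded_closedBall.subset fun x hx => mem_closedBall.2 (hXdiam x hx a haX))
  obtain ⟨J', hEJ', hJ'J, hJ'c, hJ'p, hJ'd⟩ := harc (X ∩ Set.range γ) Set.inter_subset_right
    (fun x hx y hy => (hXdiam x hx.1 y hy.1).trans (by
      have := min_le_left (s / 3) (ε' / 6); linarith))
  have h3s : 3 * s' ≤ ε' / 2 := by have := min_le_right (s / 3) (ε' / 6); linarith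
  -- treat the (impossible) case of empty intersection uniformly
  obtain ⟨J'', hE2, hJ2J, hJ2c, hJ2p, hJ2b⟩ : ∃ J'' : Set ℂ, X ∩ Set.range γ ⊆ J'' ∧
      J'' ⊆ Set.range γ ∧ IsCompact J'' ∧ IsPreconnected J'' ∧ J'' ⊆ closedBall a ε' := by
    rcases (X ∩ Set.range γ).eq_empty_or_nonempty with he | ⟨x, hx⟩
    · exact ⟨∅, by rw [he], Set.empty_subset _, isCompact_empty, isPreconnected_empty,
        Set.empty_subset _⟩
    · refine ⟨J', hEJ', hJ'J, hJ'c, hJ'p, fun y hy => ?_⟩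
      rw [mem_closedBall]
      have h1 := hJ'd y hy x (hEJ' hx)
      have h2 := hXdiam x hx.1 a haX
      linarith [dist_triangle y x a]
  refine ⟨ρ, hρ, a, fun z hz => ?_⟩
  refine closedBall_subset_closedBall (min_le_left ε (r / 2)) ?_
  by_contra hcon
  have hXb : X ⊆ closedBall a ε' := fun x hx => mem_closedBall.2 (by
    have := hXdiam x hx a haX; linarith)
  have hinter : (X ∪ J'') ∩ Set.range γ = J'' := by
    rw [Set.union_inter_distrib_right, Set.inter_eq_left.2 hJ2J]
    exact Set.union_eq_right.2 hE2
  have hcnorm : c ∉ ball (0 : ℂ) (1 / 2) := by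
    intro hcb
    have h1 := hc.2
    rw [mem_ball_zero_iff] at hcb
    rw [mem_sphere_iff_norm] at h1
    have := norm_sub_norm_le ζ c
    rw [norm_sub_rev] at this
    linarith
  have hq0 : φ 0 ∉ closedBall a ε' := by
    intro hq
    rw [mem_closedBall, dist_comm] at hq
    have : a ∈ ball (φ 0) r := by
      rw [mem_ball]; have := min_le_right ε (r / 2); linarith
    obtain ⟨y, hy, hya⟩ := hrb this
    rw [h.hi (hsub hy) hc.1 hya] at hy
    exact hcnorm hy
  have hj := janiszewski (hXc.union hJ2c) h.cJ (by rw [hinter]; exact hJ2p)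
    (isPreconnected_compl_closedBall a hε'0)
    (isPreconnected_connectedComponentIn (F := (Set.range γ)ᶜ) (x := p))
    (fun z hz hz' => hz (Set.union_subset hXb hJ2b hz')) (fun z hz => h.notJ hz)
    (p := φ 0) (q := φ z) hq0 (h.mem (by simp)) hcon (h.mem hz.1)
  have hφ0 : φ 0 ∈ ((X ∪ J'') ∪ Set.range γ)ᶜ := by
    rintro (h1 | h1)
    · exact hq0 (Set.union_subset hXb hJ2b h1)
    · exact h.notJ (h.mem (by simp)) h1
  obtain ⟨hpc, hps⟩ := h.pull (x := 0) isPreconnected_connectedComponentIn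
    (D := connectedComponentIn ((X ∪ J'') ∪ Set.range γ)ᶜ (φ 0))
    (fun z hz h' => connectedComponentIn_subset _ _ hz (Or.inr h')) (by simp)
    (mem_connectedComponentIn hφ0)
  have h0m : (0 : ℂ) ∈ g '' connectedComponentIn ((X ∪ J'') ∪ Set.range γ)ᶜ (φ 0) :=
    ⟨φ 0, mem_connectedComponentIn hφ0, h.gφ 0 (by simp)⟩
  have hzm : z ∈ g '' connectedComponentIn ((X ∪ J'') ∪ Set.range γ)ᶜ (φ 0) :=
    ⟨φ z, hj, h.gφ z hz.1⟩
  obtain ⟨y, hy, hyρ⟩ := hpc.intermediate_value hzm h0m (f := fun y => dist y ζ) (by fun_prop)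
    (show ρ ∈ Set.Icc (dist z ζ) (dist 0 ζ) from ⟨(mem_ball.1 hz.2).le, by
      rw [dist_zero_left, hζ]; linarith⟩)
  obtain ⟨w, hw, rfl⟩ := hy
  have h5 := h.gmem (hps hw)
  refine connectedComponentIn_subset _ _ hw (Or.inl (Or.inl (subset_closure ⟨g w, ⟨h5.1, ?_⟩, h5.2⟩)))
  exact hyρ

end RM
end PCL

namespace PCL
open Metric

namespace RM
variable {γ : Circle → ℂ} {p : ℂ} {φ g : ℂ → ℂ}

theorem congr {φ' : ℂ → ℂ} (h : RM γ p φ g) (e : Set.EqOn φ' φ (ball 0 1)) : RM γ p φ' g where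
  hγ := h.hγ
  hγi := h.hγi
  hp := h.hp
  hb := h.hb
  hd := h.hd.congr e
  hi := fun x hx y hy hxy => h.hi hx hy (by rwa [e hx, e hy] at hxy)
  img := by rw [← h.img]; exact Set.image_congr e
  h0 := by rw [e (by simp)]; exact h.h0
  gd := h.gd
  gφ := fun z hz => by rw [e hz]; exact h.gφ z hz

theorem extend (h : RM γ p φ g) : ∃ φ', ContinuousOn φ' (closedBall 0 1) ∧ RM γ p φ' g := by
  have hcl : closedBall (0 : ℂ) 1 ⊆ closure (ball 0 1) := by
    rw [closure_ball _ one_ne_zero]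
  have hlim : ∀ x ∈ ball (0 : ℂ) 1, Filter.Tendsto φ (𝓝[ball 0 1] x) (𝓝 (φ x)) :=
    fun x hx => h.hd.continuousOn x hx
  refine ⟨extendFrom (ball 0 1) φ, continuousOn_extendFrom hcl ?_, h.congr fun x hx =>
    extendFrom_eq (hcl (ball_subset_closedBall hx)) (hlim x hx)⟩
  intro x hx
  rcases lt_or_eq_of_le (mem_closedBall_zero_iff.1 hx) with hx1 | hx1
  · exact ⟨_, hlim x (mem_ball_zero_iff.2 hx1)⟩
  · have : (𝓝[ball 0 1] x).NeBot := mem_closure_iff_nhdsWithin_neBot.1 (hcl hx)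
    refine cauchy_map_iff_exists_tendsto.1 ?_
    rw [Metric.cauchy_iff]
    refine ⟨inferInstance, fun ε hε => ?_⟩
    obtain ⟨ρ, hρ, a, ha⟩ := h.small hx1 (ε := ε / 4) (by positivity)
    refine ⟨closedBall a (ε / 4), ?_, fun y hy z hz => ?_⟩
    · refine Filter.mem_map.2 (Filter.mem_of_superset (inter_mem_nhdsWithin _ (ball_mem_nhds x hρ)) ?_)
      exact ha
    · have := dist_triangle_right y z a
      rw [mem_closedBall] at hy hz
      linarith

theorem bdry (h : RM γ p φ g) (hc : ContinuousOn φ (closedBall 0 1)) {ζ : ℂ} (hζ : ‖ζ‖ = 1) :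
    φ ζ ∈ Set.range γ := by
  have hcl : ζ ∈ closure (ball (0 : ℂ) 1) := by
    rw [closure_ball _ one_ne_zero]; exact mem_closedBall_zero_iff.2 hζ.le
  have hne : (𝓝[ball 0 1] ζ).NeBot := mem_closure_iff_nhdsWithin_neBot.1 hcl
  have ht : Filter.Tendsto φ (𝓝[ball 0 1] ζ) (𝓝 (φ ζ)) :=
    (hc ζ (mem_closedBall_zero_iff.2 hζ.le)).mono_left (nhdsWithin_mono _ ball_subset_closedBall)
  have hmem : φ ζ ∈ closure (connectedComponentIn (Set.range γ)ᶜ p) :=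
    mem_closure_of_tendsto ht (by
      filter_upwards [self_mem_nhdsWithin] with z hz
      exact h.mem hz)
  by_cases hU : φ ζ ∈ connectedComponentIn (Set.range γ)ᶜ p
  · exfalso
    have ho : IsOpen (connectedComponentIn (Set.range γ)ᶜ p) :=
      h.cJ.isClosed.isOpen_compl.connectedComponentIn
    have h1 : ContinuousAt g (φ ζ) := (h.gd.differentiableAt (ho.mem_nhds hU)).continuousAt
    have h2 : Filter.Tendsto (fun z => g (φ z)) (𝓝[ball 0 1] ζ) (𝓝 (g (φ ζ))) := h1.tendsto.comp ht
    have h3 : Filter.Tendsto (fun z => g (φ z)) (𝓝[ball 0 1] ζ) (𝓝 ζ) := by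
      refine Filter.Tendsto.congr' ?_ (Filter.tendsto_id.mono_left nhdsWithin_le_nhds)
      filter_upwards [self_mem_nhdsWithin] with z hz
      exact (h.gφ z hz).symm
    have h4 := tendsto_nhds_unique h2 h3
    have h5 := (h.gmem hU).1
    rw [h4, mem_ball_zero_iff] at h5
    linarith
  · exact frontier_cci h.cJ.isClosed p ⟨hmem, fun hh => hU (interior_subset hh)⟩

theorem not_const (h : RM γ p φ g) (hc : ContinuousOn φ (closedBall 0 1)) {w : ℂ}
    (hw : w ∈ Set.range γ) {O : Set ℂ} (hO : IsOpen O) {b : ℂ} (hb : ‖b‖ = 1) (hbO : b ∈ O) :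
    ∃ z ∈ O, ‖z‖ = 1 ∧ φ z ≠ w := by
  by_contra hcon
  push Not at hcon
  have hS : IsCompact (sphere (0 : ℂ) 1) := isCompact_sphere 0 1
  obtain ⟨htS, ht⟩ := hS.elim_nhds_subcover' (fun z _ => {x | x * (b / z) ∈ O}) (by
    intro z hz
    have hz0 : z ≠ 0 := norm_pos_iff.1 (by rw [mem_sphere_zero_iff_norm.1 hz]; exact one_pos)
    refine (hO.preimage (f := fun x => x * (b / z)) (by fun_prop)).mem_nhds ?_
    change z * (b / z) ∈ O
    rwa [mul_div_cancel₀ _ hz0])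
  have hrot : ∀ i : sphere (0 : ℂ) 1, ‖b / (i : ℂ)‖ = 1 := fun i => by
    rw [norm_div, hb, mem_sphere_zero_iff_norm.1 i.2, div_one]
  let G : ℂ → ℂ := fun x => ∏ i ∈ htS, (φ (x * (b / (i : ℂ))) - w)
  have hGc : ContinuousOn G (closedBall 0 1) := by
    refine continuousOn_finsetProd _ fun i _ => ?_
    refine (hc.comp (by fun_prop) ?_).sub continuousOn_const
    intro x hx
    rw [mem_closedBall_zero_iff] at hx ⊢
    rw [norm_mul, hrot, mul_one]; exact hx
  have hGd : DifferentiableOn ℂ G (ball 0 1) := by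
    refine DifferentiableOn.fun_finsetProd fun i _ => ?_
    refine (h.hd.comp (by fun_prop) ?_).sub_const _
    intro x hx
    rw [mem_ball_zero_iff] at hx ⊢
    rw [norm_mul, hrot, mul_one]; exact hx
  have hdc : DiffContOnCl ℂ G (ball 0 1) := ⟨hGd, by rwa [closure_ball _ one_ne_zero]⟩
  have hG0 : ‖G 0‖ ≤ 0 := by
    refine Complex.norm_le_of_forall_mem_frontier_norm_le isBounded_ball hdc (fun z hz => ?_)
      (subset_closure (by simp))
    rw [frontier_ball _ one_ne_zero] at hz
    have h1 := ht hz
    simp only [Set.mem_iUnion] at h1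
    obtain ⟨i, hi, hzi⟩ := h1
    have : G z = 0 := by
      refine Finset.prod_eq_zero hi ?_
      rw [sub_eq_zero]
      refine hcon _ hzi ?_
      rw [norm_mul, hrot, mul_one]; exact mem_sphere_zero_iff_norm.1 hz
    rw [this, norm_zero]
  have hG1 : G 0 = 0 := norm_le_zero_iff.1 hG0
  obtain ⟨i, -, hi⟩ := Finset.prod_eq_zero_iff.1 hG1
  rw [zero_mul, sub_eq_zero] at hi
  exact h.notJ (h.mem (z := 0) (by simp)) (hi ▸ hw)

end RM

theorem punctured_conn {γ : Circle → ℂ} (hγ : Continuous γ) (hγi : Function.Injective γ)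
    (x0 : Circle) : IsPreconnected (Set.range γ \ {γ x0}) := by
  have hc : Continuous fun t : ℝ => γ (x0 * Circle.exp t) := by fun_prop
  have : Set.range γ \ {γ x0} = (fun t : ℝ => γ (x0 * Circle.exp t)) '' Set.Ioo 0 (2 * Real.pi) := by
    ext z
    constructor
    · rintro ⟨⟨x, rfl⟩, hx⟩
      have hne : x ≠ x0 := fun h => hx (by rw [h]; rfl)
      have e0 : x0 * Circle.exp (Complex.arg ((x / x0 : Circle) : ℂ)) = x := by
        rw [Circle.exp_arg, mul_div_cancel]
      have hne0 : Complex.arg ((x / x0 : Circle) : ℂ) ≠ 0 := by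
        intro h0
        rw [h0, Circle.exp_zero, mul_one] at e0
        exact hne e0.symm
      have h1 := Complex.neg_pi_lt_arg ((x / x0 : Circle) : ℂ)
      have h2 := Complex.arg_le_pi ((x / x0 : Circle) : ℂ)
      have hpi := Real.pi_pos
      rcases lt_or_gt_of_ne hne0 with h3 | h3
      · refine ⟨Complex.arg ((x / x0 : Circle) : ℂ) + 2 * Real.pi, ⟨by linarith, by linarith⟩, ?_⟩
        simp only
        rw [Circle.exp_add, Circle.exp_two_pi, mul_one, e0]
      · exact ⟨_, ⟨h3, by linarith⟩, congrArg γ e0⟩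
    · rintro ⟨t, ht, rfl⟩
      refine ⟨⟨_, rfl⟩, fun h => ?_⟩
      have h1 := hγi (Set.mem_singleton_iff.1 h)
      have h2 : Circle.exp t = 1 := by simpa using h1
      rw [Circle.exp_eq_one] at h2
      obtain ⟨n, hn⟩ := h2
      have hpi := Real.pi_pos
      have h3 : (0 : ℝ) < n := by
        by_contra hcon
        push Not at hcon
        nlinarith [ht.1]
      have h4 : (n : ℝ) < 1 := by
        by_contra hcon
        push Not at hcon
        nlinarith [ht.2]
      have h5 : (0 : ℤ) < n := by exact_mod_cast h3
      have h6 : n < (1 : ℤ) := by exact_mod_cast h4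
      omega
  rw [this]
  exact isPreconnected_Ioo.image _ hc.continuousOn

theorem chord_alg {a b z : ℂ} (ha : ‖a‖ = 1) (hb : ‖b‖ = 1) (hz : ‖z‖ = 1) (hab : a ≠ b)
    (h : ((z - a) * (starRingEnd ℂ) (b - a)).im = 0) : z = a ∨ z = b := by
  have n1 : ∀ w : ℂ, ‖w‖ = 1 → w.re ^ 2 + w.im ^ 2 = 1 := fun w hw => by
    have := Complex.sq_norm w
    rw [hw, Complex.normSq_apply] at this; linarith
  have ha' := n1 a ha
  have hb' := n1 b hb
  have hz' := n1 z hz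
  obtain ⟨a1, a2⟩ := a
  obtain ⟨b1, b2⟩ := b
  obtain ⟨z1, z2⟩ := z
  simp [Complex.mul_im] at h ha' hb' hz'
  by_cases hza : z1 = a1 ∧ z2 = a2
  · left; rw [hza.1, hza.2]
  right
  have hd : (b1 - a1) ^ 2 + (b2 - a2) ^ 2 ≠ 0 := by
    intro h0
    have e1 : b1 = a1 := by nlinarith [sq_nonneg (b1 - a1), sq_nonneg (b2 - a2)]
    have e2 : b2 = a2 := by nlinarith [sq_nonneg (b1 - a1), sq_nonneg (b2 - a2)]
    exact hab (by rw [e1, e2])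
  obtain ⟨t, ht1, ht2⟩ : ∃ t : ℝ, z1 - a1 = t * (b1 - a1) ∧ z2 - a2 = t * (b2 - a2) := by
    refine ⟨((z1 - a1) * (b1 - a1) + (z2 - a2) * (b2 - a2)) / ((b1 - a1) ^ 2 + (b2 - a2) ^ 2), ?_, ?_⟩
    · field_simp; linear_combination (-(b2 - a2)) * h
    · field_simp; linear_combination (b1 - a1) * h
  have e1 : z1 = a1 + t * (b1 - a1) := by linarith
  have e2 : z2 = a2 + t * (b2 - a2) := by linarith
  have ht : t * (t - 1) * ((b1 - a1) ^ 2 + (b2 - a2) ^ 2) = 0 := by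
    rw [e1, e2] at hz'
    linear_combination hz' - ha' - t * (hb' - ha')
  rcases mul_eq_zero.1 ht with h1 | h1
  · rcases mul_eq_zero.1 h1 with h2 | h2
    · exfalso; refine hza ⟨?_, ?_⟩ <;> simp [e1, e2, h2]
    · have : t = 1 := by linarith
      simp [e1, e2, this]
  · exact absurd h1 hd

theorem chord_pos {a b : ℂ} (ha : ‖a‖ = 1) (hb : ‖b‖ = 1) (hab : a ≠ b) :
    ∃ z : ℂ, ‖z‖ = 1 ∧ 0 < ((z - a) * (starRingEnd ℂ) (b - a)).im := by
  have hd : b - a ≠ 0 := sub_ne_zero.2 hab.symm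
  have hd' : ‖b - a‖ ≠ 0 := norm_ne_zero_iff.2 hd
  refine ⟨Complex.I * (b - a) / ‖b - a‖, ?_, ?_⟩
  · rw [norm_div, norm_mul, Complex.norm_I, one_mul, Complex.norm_real, norm_norm, div_self hd']
  have haa : a * (starRingEnd ℂ) a = 1 := by
    rw [Complex.mul_conj, Complex.normSq_eq_norm_sq, ha]; simp
  have hbb : b * (starRingEnd ℂ) b = 1 := by
    rw [Complex.mul_conj, Complex.normSq_eq_norm_sq, hb]; simp
  have hdd : (b - a) * (starRingEnd ℂ) (b - a) = (‖b - a‖ : ℂ) ^ 2 := by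
    rw [Complex.mul_conj, Complex.normSq_eq_norm_sq]; push_cast; rfl
  set w := a * (starRingEnd ℂ) b - 1 with hw
  have e : (Complex.I * (b - a) / ‖b - a‖ - a) * (starRingEnd ℂ) (b - a) =
      (‖b - a‖ : ℂ) * Complex.I - w := by
    have h1 : (‖b - a‖ : ℂ) ≠ 0 := by exact_mod_cast hd'
    have h2 : a * (starRingEnd ℂ) (b - a) = w := by rw [map_sub, mul_sub, haa]
    rw [sub_mul, h2]
    congr 1
    field_simp
    linear_combination hdd
  rw [e]
  have hwn : ‖w‖ = ‖b - a‖ := by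
    have : w = -(a * (starRingEnd ℂ) (a - b)) := by rw [map_sub, mul_sub, haa, hw]; ring
    rw [this, norm_neg, norm_mul, ha, one_mul, Complex.norm_conj, norm_sub_rev]
  have hre : w.re ≠ 0 := by
    intro h0
    refine hd' ?_
    have h3 : (‖b - a‖ : ℂ) ^ 2 = 2 - a * (starRingEnd ℂ) b - (starRingEnd ℂ) (a * (starRingEnd ℂ) b) := by
      rw [← hdd]; simp only [map_sub, map_mul, Complex.conj_conj]
      linear_combination haa + hbb
    have h4 := congrArg Complex.re h3
    have h5 : (a * (starRingEnd ℂ) b).re = 1 := by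
      have : w.re = (a * (starRingEnd ℂ) b).re - 1 := by rw [hw]; simp
      linarith
    rw [Complex.sub_re, Complex.sub_re, Complex.conj_re, h5] at h4
    have h6 : ((‖b - a‖ : ℂ) ^ 2).re = ‖b - a‖ ^ 2 := by
      rw [← Complex.ofReal_pow, Complex.ofReal_re]
    rw [h6] at h4
    have h7 : ‖b - a‖ ^ 2 = 0 := by rw [h4]; norm_num
    exact pow_eq_zero_iff (two_ne_zero) |>.1 h7
  have hlt := Complex.abs_im_lt_norm.2 hre
  rw [hwn] at hlt
  have := (abs_lt.1 hlt).2
  simp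
  exact this

namespace RM
variable {γ : Circle → ℂ} {p : ℂ} {φ g : ℂ → ℂ}

theorem side (h : RM γ p φ g) (hc : ContinuousOn φ (closedBall 0 1)) {w : ℂ}
    (hw : w ∈ Set.range γ) {L : Set ℂ} (hL : IsClosed L) (hLJ : ∀ z ∈ L, z ∈ Set.range γ → z = w)
    {O : Set ℂ} (hO : IsOpen O) {b : ℂ} (hb : ‖b‖ = 1) (hbO : b ∈ O) :
    ∃ z ∈ ball (0 : ℂ) 1, z ∈ O ∧ ∃ D, IsPreconnected D ∧ φ z ∈ D ∧ (∀ y ∈ D, y ∉ L) ∧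
      (D ∩ (Set.range γ \ {w})).Nonempty := by
  obtain ⟨b', hb'O, hb'1, hb'w⟩ := h.not_const hc hw hO hb hbO
  have hbJ := h.bdry hc hb'1
  have hbL : φ b' ∉ L := fun hh => hb'w (hLJ _ hh hbJ)
  obtain ⟨r, hr, hrL⟩ := Metric.isOpen_iff.1 hL.isOpen_compl _ hbL
  have hcl : b' ∈ closure (ball (0 : ℂ) 1) := by
    rw [closure_ball _ one_ne_zero]; exact mem_closedBall_zero_iff.2 hb'1.le
  have hne : (𝓝[ball 0 1] b').NeBot := mem_closure_iff_nhdsWithin_neBot.1 hcl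
  have ht : Filter.Tendsto φ (𝓝[ball 0 1] b') (𝓝 (φ b')) :=
    (hc b' (mem_closedBall_zero_iff.2 hb'1.le)).mono_left (nhdsWithin_mono _ ball_subset_closedBall)
  have hev : ∀ᶠ z in 𝓝[ball 0 1] b', z ∈ ball (0 : ℂ) 1 ∧ z ∈ O ∧ φ z ∈ ball (φ b') r := by
    filter_upwards [self_mem_nhdsWithin, mem_nhdsWithin_of_mem_nhds (hO.mem_nhds hb'O),
      ht (ball_mem_nhds _ hr)] with z h1 h2 h3
    exact ⟨h1, h2, h3⟩
  obtain ⟨z, h1, h2, h3⟩ := hev.exists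
  exact ⟨z, h1, h2, ball (φ b') r, (convex_ball _ _).isPreconnected, h3, fun y hy => hrL hy,
    ⟨φ b', mem_ball_self hr, hbJ, hb'w⟩⟩

theorem inj_bdry (h : RM γ p φ g) (hc : ContinuousOn φ (closedBall 0 1)) {a b : ℂ}
    (ha : ‖a‖ = 1) (hb : ‖b‖ = 1) (hab : a ≠ b) : φ a ≠ φ b := by
  intro heq
  let l : ℂ → ℝ := fun z => ((z - a) * (starRingEnd ℂ) (b - a)).im
  have hl : Continuous l := by
    refine Complex.continuous_im.comp ?_
    exact (continuous_id.sub continuous_const).mul continuous_const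
  let L0 : Set ℂ := closedBall 0 1 ∩ {z | l z = 0}
  have hL0 : IsCompact L0 := (isCompact_closedBall 0 1).inter_right (isClosed_eq hl continuous_const)
  have hLc : IsCompact (φ '' L0) := hL0.image_of_continuousOn (hc.mono Set.inter_subset_left)
  have hw := h.bdry hc ha
  have hLJ : ∀ z ∈ φ '' L0, z ∈ Set.range γ → z = φ a := by
    rintro _ ⟨z, ⟨hz1, hz2⟩, rfl⟩ hzJ
    rcases lt_or_eq_of_le (mem_closedBall_zero_iff.1 hz1) with h1 | h1
    · exact absurd hzJ (h.notJ (h.mem (mem_ball_zero_iff.2 h1)))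
    · rcases chord_alg ha hb h1 hab hz2 with rfl | rfl
      · rfl
      · exact heq.symm
  obtain ⟨c1, hc1, hc1l⟩ := chord_pos ha hb hab
  obtain ⟨c2, hc2, hc2l⟩ := chord_pos hb ha hab.symm
  have hc2l' : l c2 < 0 := by
    have : ((c2 - b) * (starRingEnd ℂ) (a - b)).im = - l c2 := by
      simp only [l, Complex.mul_im, Complex.sub_re, Complex.sub_im, Complex.conj_re, Complex.conj_im]
      ring
    linarith
  obtain ⟨z1, hz1, hz1O, D1, hD1, hz1D, hD1L, x1, hx1, hx1J⟩ := h.side hc hw hLc.isClosed hLJ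
    (isOpen_lt continuous_const hl) hc1 hc1l
  obtain ⟨z2, hz2, hz2O, D2, hD2, hz2D, hD2L, x2, hx2, hx2J⟩ := h.side hc hw hLc.isClosed hLJ
    (isOpen_lt hl continuous_const) hc2 hc2l'
  obtain ⟨x0, hx0⟩ := hw
  have hJp : IsPreconnected (Set.range γ \ {φ a}) := by
    rw [← hx0]; exact punctured_conn h.hγ h.hγi x0
  have hDp : IsPreconnected ((D1 ∪ (Set.range γ \ {φ a})) ∪ D2) :=
    IsPreconnected.union x2 (Or.inr hx2J) hx2 (IsPreconnected.union x1 hx1 hx1J hD1 hJp) hD2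
  have hinter0 : φ '' L0 ∩ Set.range γ = {φ a} := by
    ext z
    constructor
    · rintro ⟨h1, h2⟩
      exact hLJ z h1 h2
    · rintro rfl
      exact ⟨⟨a, ⟨mem_closedBall_zero_iff.2 ha.le, by simp [l]⟩, rfl⟩, ⟨x0, hx0⟩⟩
  have hj := janiszewski hLc h.cJ (by rw [hinter0]; exact isPreconnected_singleton) hDp
    (isPreconnected_connectedComponentIn (F := (Set.range γ)ᶜ) (x := p))
    (by
      rintro z ((hz | hz) | hz) hzL
      · exact hD1L z hz hzL
      · exact hz.2 (hLJ z hzL hz.1)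
      · exact hD2L z hz hzL) (fun z hz => h.notJ hz)
    (p := φ z1) (q := φ z2) (Or.inl (Or.inl hz1D)) (h.mem hz1) (Or.inr hz2D) (h.mem hz2)
  have hz1m : φ z1 ∈ (φ '' L0 ∪ Set.range γ)ᶜ := by
    rintro (h1 | h1)
    · exact hD1L _ hz1D h1
    · exact h.notJ (h.mem hz1) h1
  obtain ⟨hpc, hps⟩ := h.pull (x := z1) isPreconnected_connectedComponentIn
    (D := connectedComponentIn (φ '' L0 ∪ Set.range γ)ᶜ (φ z1))
    (fun z hz h' => connectedComponentIn_subset _ _ hz (Or.inr h')) hz1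
    (mem_connectedComponentIn hz1m)
  obtain ⟨y, hy, hy0⟩ := hpc.intermediate_value (f := l)
    (show z2 ∈ _ from ⟨φ z2, hj, h.gφ z2 hz2⟩)
    (show z1 ∈ _ from ⟨φ z1, mem_connectedComponentIn hz1m, h.gφ z1 hz1⟩) hl.continuousOn
    (show (0 : ℝ) ∈ Set.Icc (l z2) (l z1) from ⟨le_of_lt hz2O, le_of_lt hz1O⟩)
  obtain ⟨v, hv, rfl⟩ := hy
  have h5 := h.gmem (hps hv)
  exact connectedComponentIn_subset _ _ hv
    (Or.inl ⟨g v, ⟨ball_subset_closedBall h5.1, hy0⟩, h5.2⟩)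

end RM

/-- Caratheodory. -/
theorem caratheodory {γ : Circle → ℂ} (hγ : Continuous γ) (hγi : Function.Injective γ) {p : ℂ}
    (hp : p ∉ Set.range γ) (hb : Bornology.IsBounded (connectedComponentIn (Set.range γ)ᶜ p)) :
    ∃ φ : ℂ → ℂ, ContinuousOn φ (closedBall 0 1) ∧ DifferentiableOn ℂ φ (ball 0 1) ∧
      Set.InjOn φ (closedBall 0 1) ∧ φ '' ball 0 1 = connectedComponentIn (Set.range γ)ᶜ p ∧
      φ '' sphere 0 1 = Set.range γ ∧ φ 0 = p := by
  obtain ⟨φ0, g, h0⟩ := exists_RM hγ hγi hp hb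
  obtain ⟨φ, hc, h⟩ := h0.extend
  refine ⟨φ, hc, h.hd, ?_, h.img, ?_, h.h0⟩
  · have hm : ∀ x ∈ ball (0 : ℂ) 1, ∀ y, ‖y‖ = 1 → φ x ≠ φ y := fun x hx y hy hxy =>
      h.notJ (h.mem hx) (hxy ▸ h.bdry hc hy)
    intro x hx y hy hxy
    rcases lt_or_eq_of_le (mem_closedBall_zero_iff.1 hx) with h1 | h1 <;>
    rcases lt_or_eq_of_le (mem_closedBall_zero_iff.1 hy) with h2 | h2
    · exact h.hi (mem_ball_zero_iff.2 h1) (mem_ball_zero_iff.2 h2) hxy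
    · exact absurd hxy (hm x (mem_ball_zero_iff.2 h1) y h2)
    · exact absurd hxy.symm (hm y (mem_ball_zero_iff.2 h2) x h1)
    · by_contra hne
      exact h.inj_bdry hc h1 h2 hne hxy
  · have hcs : Continuous fun x : Circle => φ x := by
      refine hc.comp_continuous (by fun_prop) fun x => ?_
      rw [mem_closedBall_zero_iff, Circle.norm_coe]
    have := circle_range_eq hγ hγi (σ := fun x : Circle => φ x) hcs (fun x y hxy => by
      by_contra hne
      exact h.inj_bdry hc (Circle.norm_coe x) (Circle.norm_coe y)
        (fun hh => hne (Circle.ext hh)) hxy) (by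
      rintro _ ⟨x, rfl⟩
      exact h.bdry hc (Circle.norm_coe x))
    rw [← this]
    ext z
    constructor
    · rintro ⟨x, hx, rfl⟩
      exact ⟨⟨x, by simpa [Submonoid.unitSphere] using hx⟩, rfl⟩
    · rintro ⟨x, rfl⟩
      exact ⟨x, mem_sphere_zero_iff_norm.2 (Circle.norm_coe x), rfl⟩

end PCL

namespace PCL
open Metric

/-- the finite coordinate -/
def out (x : OnePoint ℂ) : ℂ := x.elim 0 id

@[simp] lemma out_coe (z : ℂ) : out (z : OnePoint ℂ) = z := rfl
@[simp] lemma out_infty : out (∞ : OnePoint ℂ) = 0 := rfl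

lemma out_continuousAt (z : ℂ) : ContinuousAt out (z : OnePoint ℂ) := by
  rw [OnePoint.continuousAt_coe]
  exact continuousAt_id

lemma out_continuousOn {s : Set (OnePoint ℂ)} (h : (∞ : OnePoint ℂ) ∉ s) : ContinuousOn out s := by
  intro x hx
  obtain ⟨z, rfl⟩ := OnePoint.ne_infty_iff_exists.1 (fun e => h (e ▸ hx))
  exact (out_continuousAt z).continuousWithinAt

lemma coe_out {x : OnePoint ℂ} (h : x ≠ ∞) : ((out x : ℂ) : OnePoint ℂ) = x := by
  obtain ⟨z, rfl⟩ := OnePoint.ne_infty_iff_exists.1 h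
  rfl

/-- inversion as a function -/
def invF (x : OnePoint ℂ) : OnePoint ℂ := x.elim ((0 : ℂ) : OnePoint ℂ)
  (fun z => if z = 0 then ∞ else ((z⁻¹ : ℂ) : OnePoint ℂ))

@[simp] lemma invF_infty : invF ∞ = ((0 : ℂ) : OnePoint ℂ) := rfl
lemma invF_coe (z : ℂ) : invF (z : OnePoint ℂ) = if z = 0 then ∞ else ((z⁻¹ : ℂ) : OnePoint ℂ) := rfl
@[simp] lemma invF_zero : invF ((0 : ℂ) : OnePoint ℂ) = ∞ := by rw [invF_coe, if_pos rfl]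
lemma invF_ne {z : ℂ} (h : z ≠ 0) : invF (z : OnePoint ℂ) = ((z⁻¹ : ℂ) : OnePoint ℂ) := by
  rw [invF_coe, if_neg h]

lemma invF_invF (x : OnePoint ℂ) : invF (invF x) = x := by
  induction x using OnePoint.rec with
  | infty => simp
  | coe z =>
    by_cases h : z = 0
    · subst h; simp
    · rw [invF_ne h, invF_ne (inv_ne_zero h), inv_inv]

lemma tendsto_coe_cobounded :
    Filter.Tendsto (fun z : ℂ => (z : OnePoint ℂ)) (Bornology.cobounded ℂ) (𝓝 ∞) := by
  have := OnePoint.tendsto_coe_infty (X := ℂ)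
  rwa [Filter.coclosedCompact_eq_cocompact, ← Metric.cobounded_eq_cocompact] at this

lemma tendsto_infty_iff {Y : Type*} [TopologicalSpace Y] {f : OnePoint ℂ → Y} :
    ContinuousAt f ∞ ↔ Filter.Tendsto (fun z : ℂ => f z) (Bornology.cobounded ℂ) (𝓝 (f ∞)) := by
  rw [OnePoint.continuousAt_infty', Filter.coclosedCompact_eq_cocompact, ← Metric.cobounded_eq_cocompact]
  rfl

lemma invF_continuous : Continuous invF := by
  rw [continuous_iff_continuousAt]
  intro x
  induction x using OnePoint.rec with
  | infty =>
    rw [tendsto_infty_iff]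
    have h1 : Filter.Tendsto (fun z : ℂ => ((z⁻¹ : ℂ) : OnePoint ℂ)) (Bornology.cobounded ℂ)
        (𝓝 ((0 : ℂ) : OnePoint ℂ)) :=
      (OnePoint.continuous_coe.tendsto (0 : ℂ)).comp Filter.tendsto_inv₀_cobounded
    refine h1.congr' ?_
    have : ∀ᶠ z in Bornology.cobounded ℂ, z ≠ (0 : ℂ) := Bornology.eventually_ne_cobounded 0
    filter_upwards [this] with z hz
    rw [invF_ne hz]
  | coe z =>
    rw [OnePoint.continuousAt_coe]
    by_cases h : z = 0
    · subst h
      rw [continuousAt_iff_punctured_nhds]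
      have h1 := tendsto_coe_cobounded.comp (Filter.tendsto_inv₀_nhdsNE_zero (α := ℂ))
      simp only [Function.comp_apply, invF_zero]
      refine h1.congr' ?_
      filter_upwards [self_mem_nhdsWithin] with w hw
      exact (invF_ne hw).symm
    · have h1 : ContinuousAt (fun w : ℂ => ((w⁻¹ : ℂ) : OnePoint ℂ)) z :=
        (OnePoint.continuous_coe.continuousAt).comp (continuousAt_inv₀ h)
      refine h1.congr ?_
      filter_upwards [isOpen_ne.mem_nhds h] with w hw
      exact (invF_ne hw).symm

/-- inversion of the sphere -/
def invH : OnePoint ℂ ≃ₜ OnePoint ℂ where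
  toFun := invF
  invFun := invF
  left_inv := invF_invF
  right_inv := invF_invF
  continuous_toFun := invF_continuous
  continuous_invFun := invF_continuous

@[simp] lemma invH_apply (x) : invH x = invF x := rfl
@[simp] lemma invH_symm : invH.symm = invH := rfl

/-- translation by `-p` -/
def subH (p : ℂ) : OnePoint ℂ ≃ₜ OnePoint ℂ := (Homeomorph.subRight p).onePointCongr

@[simp] lemma subH_coe (p z : ℂ) : subH p (z : OnePoint ℂ) = ((z - p : ℂ) : OnePoint ℂ) := rfl
@[simp] lemma subH_infty (p : ℂ) : subH p ∞ = ∞ := rfl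
@[simp] lemma subH_symm_coe (p z : ℂ) : (subH p).symm (z : OnePoint ℂ) = ((z + p : ℂ) : OnePoint ℂ) := by
  rw [Homeomorph.symm_apply_eq]; simp
@[simp] lemma subH_symm_infty (p : ℂ) : (subH p).symm ∞ = ∞ := by
  rw [Homeomorph.symm_apply_eq]; simp

/-- complex conjugation -/
def conjH : OnePoint ℂ ≃ₜ OnePoint ℂ :=
  (Homeomorph.onePointCongr Complex.conjCLE.toHomeomorph)

@[simp] lemma conjH_coe (z : ℂ) : conjH (z : OnePoint ℂ) = ((starRingEnd ℂ z : ℂ) : OnePoint ℂ) := rfl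
@[simp] lemma conjH_infty : conjH ∞ = ∞ := rfl

/-- z ↦ 1/(z-p) -/
def toInf (p : ℂ) : OnePoint ℂ ≃ₜ OnePoint ℂ := (subH p).trans invH

@[simp] lemma toInf_infty (p : ℂ) : toInf p ∞ = ((0 : ℂ) : OnePoint ℂ) := rfl
@[simp] lemma toInf_self (p : ℂ) : toInf p (p : OnePoint ℂ) = ∞ := by
  simp [toInf]
lemma toInf_ne {p z : ℂ} (h : z ≠ p) : toInf p (z : OnePoint ℂ) = (((z - p)⁻¹ : ℂ) : OnePoint ℂ) := by
  simp [toInf, invF_ne (sub_ne_zero.2 h)]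

/-- any point can be moved to infinity -/
lemma exists_toInf (x : OnePoint ℂ) : ∃ h : OnePoint ℂ ≃ₜ OnePoint ℂ, h x = ∞ := by
  induction x using OnePoint.rec with
  | infty => exact ⟨Homeomorph.refl _, rfl⟩
  | coe z => exact ⟨toInf z, toInf_self z⟩

/-- reflection in the unit circle -/
def reflH : OnePoint ℂ ≃ₜ OnePoint ℂ := conjH.trans invH

lemma reflH_ne {z : ℂ} (h : z ≠ 0) : reflH (z : OnePoint ℂ) = (((starRingEnd ℂ z)⁻¹ : ℂ) : OnePoint ℂ) := by
  simp [reflH]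
  rw [invF_ne]; simpa using h
@[simp] lemma reflH_infty : reflH ∞ = ((0 : ℂ) : OnePoint ℂ) := rfl
@[simp] lemma reflH_zero : reflH ((0 : ℂ) : OnePoint ℂ) = ∞ := by simp [reflH]

lemma reflH_sphere {z : ℂ} (h : ‖z‖ = 1) : reflH (z : OnePoint ℂ) = z := by
  have h0 : z ≠ 0 := by intro e; simp [e] at h
  rw [reflH_ne h0]
  congr 1
  have : z * starRingEnd ℂ z = 1 := by
    rw [Complex.mul_conj, Complex.normSq_eq_norm_sq, h]; simp
  exact inv_eq_of_mul_eq_one_left this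

instance : T2Space (OnePoint ℂ) := inferInstance
instance : CompactSpace (OnePoint ℂ) := inferInstance
end PCL

namespace PCL
open Metric

lemma invFunOn_cont {X Y : Type*} [TopologicalSpace X] [TopologicalSpace Y] [T2Space Y] [Nonempty X]
    {φ : X → Y} {K : Set X}
    (hK : IsCompact K) (hφ : ContinuousOn φ K) (hi : Set.InjOn φ K) :
    ContinuousOn (Function.invFunOn φ K) (φ '' K) := by
  rw [continuousOn_iff_isClosed]
  intro t ht
  refine ⟨φ '' (K ∩ t), ((hK.inter_right ht).image_of_continuousOn
    (hφ.mono Set.inter_subset_left)).isClosed, ?_⟩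
  ext y
  constructor
  · rintro ⟨h1, x, hx, rfl⟩
    rw [Set.mem_preimage, hi.leftInvOn_invFunOn hx] at h1
    exact ⟨⟨x, ⟨hx, h1⟩, rfl⟩, ⟨x, hx, rfl⟩⟩
  · rintro ⟨⟨x, ⟨hx, h1⟩, rfl⟩, -⟩
    refine ⟨?_, ⟨x, hx, rfl⟩⟩
    rw [Set.mem_preimage, hi.leftInvOn_invFunOn hx]
    exact h1

/-- radial extension of a circle map to the disk -/
lemma radial_ext {τ : ℂ → ℂ} (hτ : ContinuousOn τ (sphere 0 1))
    (hm : ∀ z ∈ sphere (0 : ℂ) 1, τ z ∈ sphere (0 : ℂ) 1) (hi : Set.InjOn τ (sphere 0 1)) :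
    ∃ T : ℂ → ℂ, Continuous T ∧ Function.Injective T ∧ (∀ z, ‖T z‖ = ‖z‖) ∧
      ∀ z ∈ sphere (0 : ℂ) 1, T z = τ z := by
  have hu : ∀ z : ℂ, z ≠ 0 → z / (‖z‖ : ℂ) ∈ sphere (0 : ℂ) 1 := by
    intro z hz
    have : ‖z‖ ≠ 0 := norm_ne_zero_iff.2 hz
    simp [this]
  let T : ℂ → ℂ := fun z => (‖z‖ : ℂ) * τ (z / (‖z‖ : ℂ))
  have hn : ∀ z, ‖T z‖ = ‖z‖ := by
    intro z
    by_cases hz : z = 0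
    · simp [T, hz]
    · have := hm _ (hu z hz)
      simp only [mem_sphere_iff_norm, sub_zero] at this
      simp [T, this]
  refine ⟨T, ?_, ?_, hn, ?_⟩
  · rw [continuous_iff_continuousAt]
    intro z
    by_cases hz : z = 0
    · subst hz
      have h0 : T 0 = 0 := by simp [T]
      rw [ContinuousAt, h0, tendsto_zero_iff_norm_tendsto_zero]
      simp only [hn]
      have := (continuous_norm (E := ℂ)).tendsto 0
      simpa using this
    · have h1 : ContinuousOn T {z | z ≠ 0} := by
        refine ContinuousOn.mul (by fun_prop) (hτ.comp (ContinuousOn.div (by fun_prop) (by fun_prop) ?_) ?_)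
        · intro x hx; simpa using hx
        · intro x hx; exact hu x hx
      exact h1.continuousAt (isOpen_ne.mem_nhds hz)
  · intro z w h
    have hnn : ‖z‖ = ‖w‖ := by rw [← hn z, h, hn w]
    by_cases hz : z = 0
    · subst hz; symm; rw [← norm_eq_zero, ← hnn, norm_zero]
    · have hw : w ≠ 0 := by rw [← norm_ne_zero_iff, ← hnn]; exact norm_ne_zero_iff.2 hz
      have h0 : (‖z‖ : ℂ) ≠ 0 := by simpa using hz
      have h2 : τ (z / (‖z‖ : ℂ)) = τ (w / (‖w‖ : ℂ)) := by
        simp only [T] at h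
        rw [← hnn] at h ⊢
        exact mul_left_cancel₀ h0 h
      have := hi (hu z hz) (hu w hw) h2
      rw [← hnn] at this
      field_simp at this
      exact this
  · intro z hz
    simp only [mem_sphere_iff_norm, sub_zero] at hz
    simp [T, hz]

lemma bij_homeo {Φ : OnePoint ℂ → OnePoint ℂ} (hc : Continuous Φ) (hb : Function.Bijective Φ) :
    ∃ H : OnePoint ℂ ≃ₜ OnePoint ℂ, ∀ x, H x = Φ x :=
  ⟨Continuous.homeoOfEquivCompactToT2 (f := Equiv.ofBijective Φ hb) hc, fun _ => rfl⟩

theorem schoen_plane {γ : Circle → ℂ} (hγ : Continuous γ) (hγi : Function.Injective γ) :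
    ∃ (Φ : OnePoint ℂ ≃ₜ OnePoint ℂ) (φ : ℂ → ℂ), DifferentiableOn ℂ φ (ball 0 1) ∧
      (∀ z ∈ closedBall (0 : ℂ) 1, Φ (z : OnePoint ℂ) = (φ z : OnePoint ℂ)) ∧
      Φ '' ((fun z : ℂ => (z : OnePoint ℂ)) '' sphere 0 1) =
        (fun z : ℂ => (z : OnePoint ℂ)) '' Set.range γ := by
  obtain ⟨p, hp, hlog⟩ := exists_inside hγ hγi
  set J := Set.range γ with hJ
  have hJc : IsCompact J := isCompact_range hγ
  have hUb : Bornology.IsBounded (connectedComponentIn Jᶜ p) := by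
    by_contra hb
    exact hlog (hasLog_of_unbounded hJc hb)
  have hne : ∀ z ∈ J, z - p ≠ 0 := fun z hz e => hp (sub_eq_zero.1 e ▸ hz)
  obtain ⟨φ, hφc, hφd, hφi, hφU, hφJ, hφ0⟩ := caratheodory hγ hγi hp hUb
  rw [← hJ] at hφU hφJ
  let γs : Circle → ℂ := fun x => (γ x - p)⁻¹
  have hγs : Continuous γs := (hγ.sub continuous_const).inv₀ fun x => hne _ ⟨x, rfl⟩
  have hγsi : Function.Injective γs := by
    intro x y h
    exact hγi (sub_left_injective (inv_injective h))
  set Js := Set.range γs with hJs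
  have hJsc : IsCompact Js := isCompact_range hγs
  have hιc : ContinuousOn (fun z : ℂ => (z - p)⁻¹) J :=
    ContinuousOn.inv₀ (by fun_prop) hne
  have hιm : Set.MapsTo (fun z : ℂ => (z - p)⁻¹) J Js := by
    rintro _ ⟨x, rfl⟩; exact ⟨x, rfl⟩
  have hps : (0 : ℂ) ∉ Js := by
    rintro ⟨x, hx⟩
    exact inv_ne_zero (hne _ ⟨x, rfl⟩) hx
  have hUbs : Bornology.IsBounded (connectedComponentIn Jsᶜ 0) := by
    by_contra hb
    have h1 := ((hasLog_of_unbounded hJsc hb).comp hιc hιm).inv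
    exact hlog (h1.congr fun z _ => by simp)
  obtain ⟨ψ, hψc, hψd, hψi, hψU, hψJ, hψ0⟩ := caratheodory hγs hγsi hps hUbs
  rw [← hJs] at hψU hψJ
  have sb : sphere (0 : ℂ) 1 ⊆ closedBall 0 1 := sphere_subset_closedBall
  have bb : ball (0 : ℂ) 1 ⊆ closedBall 0 1 := ball_subset_closedBall
  have hcs : IsCompact (sphere (0 : ℂ) 1) := isCompact_sphere _ _
  have hφJm : ∀ z ∈ sphere (0 : ℂ) 1, φ z ∈ J := fun z hz => hφJ ▸ ⟨z, hz, rfl⟩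
  let τ : ℂ → ℂ := fun z => Function.invFunOn ψ (sphere 0 1) ((φ z - p)⁻¹)
  have hmem : ∀ z ∈ sphere (0 : ℂ) 1, (φ z - p)⁻¹ ∈ ψ '' sphere (0 : ℂ) 1 := by
    intro z hz
    rw [hψJ]
    exact hιm (hφJm z hz)
  have hψτ : ∀ z ∈ sphere (0 : ℂ) 1, ψ (τ z) = (φ z - p)⁻¹ := fun z hz =>
    Function.invFunOn_eq (hmem z hz)
  have hτm : ∀ z ∈ sphere (0 : ℂ) 1, τ z ∈ sphere (0 : ℂ) 1 := fun z hz =>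
    Function.invFunOn_mem (hmem z hz)
  have hτc : ContinuousOn τ (sphere 0 1) := by
    refine (invFunOn_cont hcs (hψc.mono sb) (hψi.mono sb)).comp
      (hιc.comp (hφc.mono sb) hφJm) hmem
  have hτi : Set.InjOn τ (sphere 0 1) := by
    intro z hz w hw h
    have h1 := hψτ z hz
    rw [h, hψτ w hw] at h1
    exact hφi (sb hz) (sb hw) (sub_left_injective (inv_injective h1)).symm
  obtain ⟨T, hTc, hTi, hTn, hTτ⟩ := radial_ext hτc hτm hτi
  have hTm : ∀ z ∈ closedBall (0 : ℂ) 1, T z ∈ closedBall (0 : ℂ) 1 := by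
    intro z hz
    simpa [hTn] using hz
  let cc : ℂ → OnePoint ℂ := fun z => (z : OnePoint ℂ)
  have hcc : Continuous cc := OnePoint.continuous_coe
  have hcci : Function.Injective cc := OnePoint.coe_injective
  let A : Set (OnePoint ℂ) := cc '' closedBall 0 1
  let B : Set (OnePoint ℂ) := reflH ⁻¹' A
  have hAc : IsClosed A := ((isCompact_closedBall _ _).image hcc).isClosed
  have hBc : IsClosed B := hAc.preimage reflH.continuous
  have hAi : (∞ : OnePoint ℂ) ∉ A := by
    rintro ⟨z, _, h⟩; exact OnePoint.coe_ne_infty z h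
  have hAB : A ∪ B = Set.univ := by
    ext x
    simp only [Set.mem_union, Set.mem_univ, iff_true]
    induction x using OnePoint.rec with
    | infty => right; exact ⟨0, by simp, by simp [cc]⟩
    | coe z =>
      by_cases hz : ‖z‖ ≤ 1
      · left; exact ⟨z, by simpa using hz, rfl⟩
      · right
        push Not at hz
        have h0 : z ≠ 0 := by intro e; simp [e] at hz; linarith
        refine ⟨(starRingEnd ℂ z)⁻¹, ?_, (reflH_ne h0).symm⟩
        simp only [mem_closedBall, dist_zero_right, norm_inv, Complex.norm_conj]
        exact inv_le_one_of_one_le₀ hz.le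
  have hcirc : ∀ x, x ∈ A → x ∈ B → ∃ z ∈ sphere (0 : ℂ) 1, x = cc z := by
    rintro _ ⟨z, hz, rfl⟩ ⟨w, hw, h⟩
    refine ⟨z, ?_, rfl⟩
    by_cases h0 : z = 0
    · subst h0; simp [cc] at h
    · simp only [cc] at h
      rw [reflH_ne h0] at h
      have h2 := OnePoint.coe_injective h
      have h3 : ‖w‖ = ‖z‖⁻¹ := by rw [h2]; simp
      simp only [mem_closedBall, dist_zero_right, mem_sphere_iff_norm, sub_zero] at hz hw ⊢
      have hzp : 0 < ‖z‖ := norm_pos_iff.2 h0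
      rw [h3] at hw
      exact le_antisymm hz ((inv_le_one₀ hzp).1 hw)
  let E : OnePoint ℂ → OnePoint ℂ := fun x => (φ (out x) : OnePoint ℂ)
  let G : OnePoint ℂ → OnePoint ℂ := fun x => (toInf p).symm (ψ (T (out (reflH x))) : OnePoint ℂ)
  have hEG : ∀ x, x ∈ A → x ∈ B → E x = G x := by
    intro x hA hB
    obtain ⟨z, hz, rfl⟩ := hcirc x hA hB
    have hz' : ‖z‖ = 1 := by simpa using hz
    simp only [E, G, cc, reflH_sphere hz', out_coe]
    rw [hTτ z hz, hψτ z hz]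
    rw [eq_comm, Homeomorph.symm_apply_eq, toInf_ne (sub_ne_zero.1 (hne _ (hφJm z hz)))]
  have hBm : ∀ x ∈ B, ∃ w ∈ closedBall (0 : ℂ) 1, reflH x = cc w := by
    rintro x ⟨w, hw, h⟩; exact ⟨w, hw, h.symm⟩
  classical
  let Φ : OnePoint ℂ → OnePoint ℂ := fun x => if x ∈ A then E x else G x
  have hΦA : ∀ x ∈ A, Φ x = E x := fun x hx => if_pos hx
  have hΦB : ∀ x ∈ B, Φ x = G x := by
    intro x hx
    by_cases h : x ∈ A
    · rw [hΦA x h, hEG x h hx]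
    · exact if_neg h
  have hEc : ContinuousOn E A := by
    refine hcc.comp_continuousOn (hφc.comp (out_continuousOn hAi) ?_)
    rintro _ ⟨z, hz, rfl⟩; exact hz
  have hGc : ContinuousOn G B := by
    refine (toInf p).symm.continuous.comp_continuousOn (hcc.comp_continuousOn (hψc.comp
      (hTc.comp_continuousOn ((out_continuousOn hAi).comp reflH.continuous.continuousOn (fun x hx => hx))) ?_))
    intro x hx
    obtain ⟨w, hw, h⟩ := hBm x hx
    simp only [Function.comp, h]
    exact hTm w hw
  have hΦc : Continuous Φ := by
    rw [← continuousOn_univ, ← hAB]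
    exact (hEc.congr hΦA).union_of_isClosed (hGc.congr hΦB) hAc hBc
  have hEi : Set.InjOn E A := by
    rintro _ ⟨z, hz, rfl⟩ _ ⟨w, hw, rfl⟩ h
    exact congrArg cc (hφi hz hw (OnePoint.coe_injective h))
  have hGi : Set.InjOn G B := by
    intro x hx y hy h
    obtain ⟨z, hz, h1⟩ := hBm x hx
    obtain ⟨w, hw, h2⟩ := hBm y hy
    have h3 := OnePoint.coe_injective ((toInf p).symm.injective h)
    rw [h1, h2] at h3
    have h4 := hTi (hψi (hTm z hz) (hTm w hw) h3)
    refine reflH.injective ?_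
    rw [h1, h2, h4]
  have hcross : ∀ x ∈ A, ∀ y ∈ B, Φ x = Φ y → x = y := by
    intro x hx y hy h
    by_cases hxB : x ∈ B
    · rw [hΦB x hxB, hΦB y hy] at h; exact hGi hxB hy h
    by_cases hyA : y ∈ A
    · rw [hΦA x hx, hΦA y hyA] at h; exact hEi hx hyA h
    exfalso
    rw [hΦA x hx, hΦB y hy] at h
    obtain ⟨z, hz, rfl⟩ := hx
    obtain ⟨w, hw, hyw⟩ := hBm y hy
    have hz1 : z ∈ ball (0 : ℂ) 1 := by
      have : ‖z‖ ≤ 1 := by simpa using hz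
      rcases this.lt_or_eq with h1 | h1
      · simpa using h1
      · exact absurd (show cc z ∈ B from ⟨z, hz, (reflH_sphere h1).symm⟩) hxB
    have hw1 : w ∈ ball (0 : ℂ) 1 := by
      have : ‖w‖ ≤ 1 := by simpa using hw
      rcases this.lt_or_eq with h1 | h1
      · simpa using h1
      · refine absurd (show y ∈ A from ⟨w, hw, ?_⟩) hyA
        refine reflH.injective ?_
        rw [hyw]; exact reflH_sphere h1
    have hq : φ z ∈ connectedComponentIn Jᶜ p := hφU ▸ ⟨z, hz1, rfl⟩
    have hv : ψ (T w) ∈ connectedComponentIn Jsᶜ 0 := hψU ▸ ⟨T w, by simpa [hTn] using hw1, rfl⟩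
    simp only [E, G, hyw, cc, out_coe] at h
    rw [eq_comm, Homeomorph.symm_apply_eq] at h
    by_cases hqp : φ z = p
    · rw [hqp, toInf_self] at h; exact OnePoint.coe_ne_infty _ h
    rw [toInf_ne hqp] at h
    have h' := OnePoint.coe_injective h
    rw [h'] at hv
    have hqp' : φ z - p ≠ 0 := sub_ne_zero.2 hqp
    have l1 := hasLog_of_conn hJc.isClosed isPreconnected_connectedComponentIn
      (fun x hx => connectedComponentIn_subset _ _ hx)
      (mem_connectedComponentIn (x := p) (F := Jᶜ) hp) hq
    have l2 := (hasLog_of_conn hJsc.isClosed isPreconnected_connectedComponentIn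
      (fun x hx => connectedComponentIn_subset _ _ hx)
      (mem_connectedComponentIn (x := (0 : ℂ)) (F := Jsᶜ) hps) hv).comp hιc hιm
    have hqJ : φ z ∉ J := fun hm => connectedComponentIn_subset _ _ hq hm
    refine hlog (((l1.div l2).mul (HasLog.const (c := -(φ z - p)) (neg_ne_zero.2 hqp') J)).congr ?_)
    intro x hx
    have a1 : x - p ≠ 0 := hne x hx
    have a2 : x - φ z ≠ 0 := fun e => hqJ (sub_eq_zero.1 e ▸ hx)
    have a3 : (x - p)⁻¹ - (φ z - p)⁻¹ ≠ 0 := by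
      rw [sub_ne_zero]; intro e
      exact a2 (sub_eq_zero.2 (sub_left_injective (inv_injective e)))
    have a4 : (x - p)⁻¹ - (φ z - p)⁻¹ = -(x - φ z) / ((x - p) * (φ z - p)) := by
      field_simp; ring
    simp only [sub_zero]
    rw [a4]
    field_simp
  have hΦi : Function.Injective Φ := by
    intro x y h
    rcases (hAB ▸ Set.mem_univ x : x ∈ A ∪ B) with hx | hx <;>
      rcases (hAB ▸ Set.mem_univ y : y ∈ A ∪ B) with hy | hy
    · rw [hΦA x hx, hΦA y hy] at h; exact hEi hx hy h
    · exact hcross x hx y hy h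
    · exact (hcross y hy x hx h.symm).symm
    · rw [hΦB x hx, hΦB y hy] at h; exact hGi hx hy h
  have hΦcoe : ∀ z ∈ closedBall (0 : ℂ) 1, Φ (z : OnePoint ℂ) = (φ z : OnePoint ℂ) :=
    fun z hz => hΦA _ ⟨z, hz, rfl⟩
  have hΦs : Function.Surjective Φ := by
    intro q
    by_contra hcon
    push Not at hcon
    induction q using OnePoint.rec with
    | infty =>
      refine hcon ∞ ?_
      rw [hΦB ∞ ⟨0, by simp, by simp [cc]⟩]
      have hT0 : T 0 = 0 := by rw [← norm_eq_zero, hTn, norm_zero]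
      simp only [G, reflH_infty, out_coe, hT0, hψ0]
      rw [Homeomorph.symm_apply_eq, toInf_infty]
    | coe q =>
      have hqJ : q ∉ J := by
        intro h
        rw [← hφJ] at h
        obtain ⟨s, hs, rfl⟩ := h
        exact hcon _ (hΦcoe s (sb hs))
      have hqU : q ∉ connectedComponentIn Jᶜ p := by
        intro h
        rw [← hφU] at h
        obtain ⟨s, hs, rfl⟩ := h
        exact hcon _ (hΦcoe s (bb hs))
      let M : OnePoint ℂ → ℂ := fun x => 1 + (q - p) * out (toInf q x)
      have hM : ∀ z : ℂ, z ≠ q → M (z : OnePoint ℂ) = (z - p) / (z - q) := by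
        intro z hz
        have : z - q ≠ 0 := sub_ne_zero.2 hz
        simp only [M, toInf_ne hz, out_coe]
        field_simp
        ring
      let g : ℂ → ℂ := fun u => M (Φ (invF (u : OnePoint ℂ)))
      have hgc : Continuous g := by
        have : ContinuousOn M {x | x ≠ (q : OnePoint ℂ)} := by
          refine continuousOn_const.add (continuousOn_const.mul
            ((out_continuousOn (s := {∞}ᶜ) (by simp)).comp (toInf q).continuous.continuousOn ?_))
          intro x hx h
          apply hx
          apply (toInf q).injective
          rw [toInf_self]; exact h
        exact this.comp_continuous (hΦc.comp (invF_continuous.comp hcc)) fun u => hcon _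
      have hg0 : ∀ u, g u ≠ 0 := by
        intro u hu
        have h1 : Φ (invF (u : OnePoint ℂ)) ≠ q := hcon _
        have h2 : Φ (invF (u : OnePoint ℂ)) ≠ p := by
          intro h
          rw [← hφ0, ← hΦcoe 0 (by simp)] at h
          have := congrArg invF (hΦi h)
          rw [invF_invF, invF_zero] at this
          exact OnePoint.coe_ne_infty _ this
        simp only [g] at hu
        generalize Φ (invF (u : OnePoint ℂ)) = y at *
        induction y using OnePoint.rec with
        | infty => simp [M] at hu
        | coe y =>
          have e1 : y ≠ q := fun e => h1 (by rw [e])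
          have e2 : y ≠ p := fun e => h2 (by rw [e])
          rw [hM y e1] at hu
          exact div_ne_zero (sub_ne_zero.2 e2) (sub_ne_zero.2 e1) hu
      have hl := hasLog_univ hgc hg0
      have hs := invFunOn_cont hcs (hφc.mono sb) (hφi.mono sb)
      rw [hφJ] at hs
      have hsm : ∀ z ∈ J, Function.invFunOn φ (sphere 0 1) z ∈ sphere (0 : ℂ) 1 ∧
          φ (Function.invFunOn φ (sphere 0 1) z) = z := by
        intro z hz
        rw [← hφJ] at hz
        exact ⟨Function.invFunOn_mem hz, Function.invFunOn_eq hz⟩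
      have hs0 : ∀ z ∈ J, Function.invFunOn φ (sphere 0 1) z ≠ 0 := by
        intro z hz e
        have := (hsm z hz).1
        rw [e] at this; simp at this
      have hl2 := hl.comp (hs.inv₀ hs0) (Set.mapsTo_univ _ _)
      refine hqU (same_comp hJc hp hqJ (hl2.congr ?_))
      intro z hz
      have hzq : z ≠ q := fun e => hqJ (e ▸ hz)
      simp only [g, Pi.inv_apply]
      rw [invF_ne (inv_ne_zero (hs0 z hz)), inv_inv, hΦcoe _ (sb (hsm z hz).1), (hsm z hz).2, hM z hzq]
  obtain ⟨H, hH⟩ := bij_homeo hΦc ⟨hΦi, hΦs⟩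
  refine ⟨H, φ, hφd, fun z hz => by rw [hH]; exact hΦcoe z hz, ?_⟩
  rw [← hφJ, Set.image_image, Set.image_image]
  refine Set.image_congr fun z hz => ?_
  rw [hH]; exact hΦcoe z (sb hz)
end PCL

namespace PCL
open Metric

lemma iso_trans {S : Type*} [TopologicalSpace S] {A B C P : Set S} (h1 : IsotopicRel A B P)
    (h2 : IsotopicRel B C P) : IsotopicRel A C P := by
  obtain ⟨H, a1, a2, a3, a4⟩ := h1
  obtain ⟨K, b1, b2, b3, b4⟩ := h2
  refine ⟨⟨fun q => K (q.1, H q), by fun_prop⟩, ?_, ?_, ?_, ?_⟩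
  · intro x; simp [a1, b1]
  · intro t; exact (b2 t).comp (a2 t)
  · intro t p hp; simp [a3 t p hp, b3 t p hp]
  · rw [← b4, ← a4, Set.image_image]; rfl

lemma iso_map {S : Type*} [TopologicalSpace S] {A B P : Set S} (h : S ≃ₜ S)
    (h1 : IsotopicRel A B P) : IsotopicRel (h '' A) (h '' B) (h '' P) := by
  obtain ⟨H, a1, a2, a3, a4⟩ := h1
  refine ⟨⟨fun q => h (H (q.1, h.symm q.2)), by fun_prop⟩, ?_, ?_, ?_, ?_⟩
  · intro x; simp [a1]
  · intro t; exact h.bijective.comp ((a2 t).comp h.symm.bijective)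
  · rintro t _ ⟨p, hp, rfl⟩; simp [a3 t p hp]
  · rw [← a4, Set.image_image, Set.image_image]; simp

/-- radius function of the radial isotopy -/
def rho (w t s : ℝ) : ℝ := s - max 0 (min t 1) / 2 * max 0 (w - |s - 1|)

lemma bump_lip (w s s' : ℝ) (h : s < s') :
    max 0 (w - |s' - 1|) - max 0 (w - |s - 1|) ≤ s' - s := by
  have h1 : |s - 1| ≤ |s' - 1| + (s' - s) := by
    have := abs_sub_abs_le_abs_sub (s - 1) (s' - 1)
    have h2 : |s - 1 - (s' - 1)| = s' - s := by
      rw [show s - 1 - (s' - 1) = -(s' - s) by ring, abs_neg, abs_of_pos (by linarith)]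
    linarith
  rcases max_cases 0 (w - |s' - 1|) with ⟨h3, _⟩ | ⟨h3, _⟩ <;>
    rcases max_cases 0 (w - |s - 1|) with ⟨h4, _⟩ | ⟨h4, _⟩ <;> rw [h3, h4] <;> linarith

lemma clamp_mem (t : ℝ) : 0 ≤ max 0 (min t 1) ∧ max 0 (min t 1) ≤ 1 :=
  ⟨le_max_left _ _, max_le zero_le_one (min_le_right _ _)⟩

lemma rho_strictMono (w t : ℝ) : StrictMono (rho w t) := by
  intro s s' h
  have := bump_lip w s s' h
  obtain ⟨h0, h1⟩ := clamp_mem t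
  unfold rho
  nlinarith

lemma rho_far {w t s : ℝ} (h : w ≤ |s - 1|) : rho w t s = s := by
  unfold rho
  rw [max_eq_left (by linarith : w - |s - 1| ≤ 0)]; ring

/-- multiplier -/
def kk (w t : ℝ) (z : ℂ) : ℝ := 1 - max 0 (min t 1) / 2 * max 0 (w - |‖z‖ - 1|) / max ‖z‖ (1 / 2)

lemma kk_mul {w : ℝ} (hw : w ≤ 1 / 2) (t : ℝ) (z : ℂ) : kk w t z * ‖z‖ = rho w t ‖z‖ := by
  unfold kk rho
  by_cases h : w ≤ |‖z‖ - 1|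
  · rw [max_eq_left (by linarith : w - |‖z‖ - 1| ≤ 0)]; ring
  · have h2 : (1 / 2 : ℝ) ≤ ‖z‖ := by
      have := neg_abs_le (‖z‖ - 1)
      push Not at h
      linarith
    rw [max_eq_left h2]
    have : ‖z‖ ≠ 0 := by positivity
    field_simp

lemma kk_far {w t : ℝ} {z : ℂ} (h : w ≤ |‖z‖ - 1|) : kk w t z = 1 := by
  unfold kk
  rw [max_eq_left (by linarith : w - |‖z‖ - 1| ≤ 0)]; simp

lemma kk_pos {w : ℝ} (hw : w ≤ 1 / 2) (t : ℝ) (z : ℂ) : 0 < kk w t z := by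
  unfold kk
  obtain ⟨h0, h1⟩ := clamp_mem t
  have h2 : max 0 (w - |‖z‖ - 1|) ≤ 1 / 2 := max_le (by norm_num) (by
    have := abs_nonneg (‖z‖ - 1); linarith)
  have h3 : (1 / 2 : ℝ) ≤ max ‖z‖ (1 / 2) := le_max_right _ _
  have h4 : 0 < max ‖z‖ (1 / 2) := by linarith
  rw [sub_pos, div_lt_one h4]
  have h5 : 0 ≤ max 0 (w - |‖z‖ - 1|) := le_max_left _ _
  nlinarith

lemma kk_cont (w : ℝ) : Continuous fun q : ℝ × ℂ => kk w q.1 q.2 := by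
  unfold kk
  refine continuous_const.sub (Continuous.div (by fun_prop) (by fun_prop) ?_)
  intro q
  have : (1 / 2 : ℝ) ≤ max ‖q.2‖ (1 / 2) := le_max_right _ _
  linarith

lemma kk_zero (w : ℝ) (z : ℂ) : kk w 0 z = 1 := by simp [kk]

/-- push a point radially -/
def push1 (w t : ℝ) (z : ℂ) : ℂ := (kk w t z : ℂ) * z

lemma push1_norm {w : ℝ} (hw : w ≤ 1 / 2) (t : ℝ) (z : ℂ) : ‖push1 w t z‖ = rho w t ‖z‖ := by
  rw [push1, norm_mul, Complex.norm_real, Real.norm_of_nonneg (kk_pos hw t z).le, kk_mul hw]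

lemma kk_congr {w t : ℝ} {z z' : ℂ} (h : ‖z‖ = ‖z'‖) : kk w t z = kk w t z' := by
  unfold kk; rw [h]

lemma push1_inj {w : ℝ} (hw : w ≤ 1 / 2) (t : ℝ) : Function.Injective (push1 w t) := by
  intro z z' h
  have h1 : ‖z‖ = ‖z'‖ := (rho_strictMono w t).injective (by
    rw [← push1_norm hw, ← push1_norm hw, h])
  simp only [push1] at h
  rw [kk_congr h1] at h
  exact mul_left_cancel₀ (by exact_mod_cast (kk_pos hw t z').ne') h

lemma push1_surj {w : ℝ} (hw : w ≤ 1 / 2) (t : ℝ) : Function.Surjective (push1 w t) := by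
  intro y
  by_cases hy : y = 0
  · exact ⟨0, by simp [push1, hy]⟩
  have hy0 : 0 < ‖y‖ := norm_pos_iff.2 hy
  have hc : Continuous (rho w t) := by unfold rho; fun_prop
  have h0 : rho w t 0 = 0 := rho_far (by norm_num; linarith)
  have hM : rho w t (‖y‖ + 2) = ‖y‖ + 2 := rho_far (by
    rw [abs_of_pos (by linarith)]; linarith)
  obtain ⟨s, ⟨hs0, _⟩, hs⟩ := intermediate_value_Icc (by linarith : (0 : ℝ) ≤ ‖y‖ + 2) hc.continuousOn
    (show ‖y‖ ∈ Set.Icc (rho w t 0) (rho w t (‖y‖ + 2)) by rw [h0, hM]; constructor <;> linarith)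
  refine ⟨((s / ‖y‖ : ℝ) : ℂ) * y, ?_⟩
  have hn : ‖((s / ‖y‖ : ℝ) : ℂ) * y‖ = s := by
    rw [norm_mul, Complex.norm_real, Real.norm_of_nonneg (by positivity)]
    field_simp
  have h2 := kk_mul hw t (((s / ‖y‖ : ℝ) : ℂ) * y)
  rw [hn, hs] at h2
  rw [push1, ← mul_assoc, ← Complex.ofReal_mul, ← mul_div_assoc, h2, div_self hy0.ne']
  simp

lemma cont_lift {Y : Type*} [TopologicalSpace Y] {g : Y × ℂ → ℂ} (hg : Continuous g) {s : Set ℂ} :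
    ContinuousOn (fun q : Y × OnePoint ℂ => ((g (q.1, out q.2) : ℂ) : OnePoint ℂ))
      (Prod.snd ⁻¹' ((fun z : ℂ => (z : OnePoint ℂ)) '' s)) := by
  rintro ⟨t, x⟩ ⟨z, _, hz⟩
  simp only at hz
  subst hz
  have h3 : ContinuousAt (fun q : Y × OnePoint ℂ => out q.2) (t, (z : OnePoint ℂ)) :=
    ContinuousAt.comp (f := Prod.snd) (x := (t, (z : OnePoint ℂ))) (out_continuousAt z) continuousAt_snd
  have h4 : ContinuousAt (fun q : Y × OnePoint ℂ => (q.1, out q.2)) (t, (z : OnePoint ℂ)) :=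
    continuousAt_fst.prodMk h3
  exact ((OnePoint.continuous_coe.comp hg).continuousAt.comp h4).continuousWithinAt

/-- the radial isotopy of the sphere -/
lemma radial_isotopy {w : ℝ} (hw0 : 0 < w) (hw : w ≤ 1 / 2) {P : Set (OnePoint ℂ)}
    (hP : ∀ z : ℂ, (z : OnePoint ℂ) ∈ P → w ≤ |‖z‖ - 1|) :
    IsotopicRel ((fun z : ℂ => (z : OnePoint ℂ)) '' sphere 0 1)
      ((fun z : ℂ => (z : OnePoint ℂ)) '' sphere 0 (1 - w / 2)) P := by
  let F : ℝ → OnePoint ℂ → OnePoint ℂ := fun t x => OnePoint.map (push1 w t) x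
  have hFc : ∀ t (z : ℂ), F t (z : OnePoint ℂ) = (push1 w t z : OnePoint ℂ) := fun _ _ => rfl
  have hFi : ∀ t, F t ∞ = ∞ := fun _ => rfl
  have hfar : ∀ t (z : ℂ), w ≤ |‖z‖ - 1| → push1 w t z = z := by
    intro t z h; simp [push1, kk_far h]
  let A : Set (ℝ × OnePoint ℂ) := Prod.snd ⁻¹' ((fun z : ℂ => (z : OnePoint ℂ)) '' closedBall 0 2)
  let B : Set (ℝ × OnePoint ℂ) := Prod.snd ⁻¹' ((fun z : ℂ => (z : OnePoint ℂ)) '' ball 0 2)ᶜ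
  have hA : IsClosed A :=
    (((isCompact_closedBall _ _).image OnePoint.continuous_coe).isClosed).preimage continuous_snd
  have hB : IsClosed B :=
    ((OnePoint.isOpenEmbedding_coe.isOpenMap _ isOpen_ball).isClosed_compl).preimage continuous_snd
  have hAB : A ∪ B = Set.univ := by
    ext ⟨t, x⟩
    simp only [A, B, Set.mem_union, Set.mem_preimage, Set.mem_univ, iff_true, Set.mem_compl_iff]
    by_cases h : x ∈ (fun z : ℂ => (z : OnePoint ℂ)) '' ball 0 2
    · left; exact Set.image_mono ball_subset_closedBall h
    · right; exact h
  have hcont : Continuous fun q : ℝ × OnePoint ℂ => F q.1 q.2 := by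
    rw [← continuousOn_univ, ← hAB]
    refine ContinuousOn.union_of_isClosed ?_ ?_ hA hB
    · have h2 : Continuous fun q : ℝ × ℂ => push1 w q.1 q.2 :=
        (Complex.continuous_ofReal.comp (kk_cont w)).mul continuous_snd
      have h1 := cont_lift h2 (s := closedBall 0 2)
      refine h1.congr ?_
      rintro ⟨t, x⟩ ⟨z, _, hz⟩
      simp only at hz
      subst hz
      rfl
    · refine continuousOn_snd.congr ?_
      rintro ⟨t, x⟩ hx
      induction x using OnePoint.rec with
      | infty => rfl
      | coe z =>
        have hz : (2 : ℝ) ≤ ‖z‖ := by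
          by_contra h
          push Not at h
          exact hx ⟨z, by simpa using h, rfl⟩
        change F t z = z
        rw [hFc, hfar]
        rw [abs_of_nonneg (by linarith)]; linarith
  refine ⟨⟨fun q => F q.1 q.2, hcont⟩, ?_, ?_, ?_, ?_⟩
  · intro x
    induction x using OnePoint.rec with
    | infty => rfl
    | coe z => change F 0 z = z; rw [hFc]; simp [push1, kk_zero]
  · intro t
    constructor
    · intro x y h
      change F t x = F t y at h
      induction x using OnePoint.rec with
      | infty =>
        induction y using OnePoint.rec with
        | infty => rfl
        | coe y => exact absurd h.symm (OnePoint.coe_ne_infty _)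
      | coe x =>
        induction y using OnePoint.rec with
        | infty => exact absurd h (OnePoint.coe_ne_infty _)
        | coe y => exact congrArg _ (push1_inj hw t (OnePoint.coe_injective h))
    · intro y
      induction y using OnePoint.rec with
      | infty => exact ⟨∞, rfl⟩
      | coe y =>
        obtain ⟨z, hz⟩ := push1_surj hw t y
        exact ⟨z, by change F t z = y; rw [hFc, hz]⟩
  · intro t p hp
    induction p using OnePoint.rec with
    | infty => rfl
    | coe z => change F t z = z; rw [hFc, hfar t z (hP z hp)]
  · have h1 : ∀ z : ℂ, ‖z‖ = 1 → push1 w 1 z = ((1 - w / 2 : ℝ) : ℂ) * z := by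
      intro z hz
      have := kk_mul hw 1 z
      rw [hz, mul_one] at this
      rw [push1, this]
      congr 2
      simp [rho, hw0.le]; ring
    ext x
    constructor
    · rintro ⟨_, ⟨z, hz, rfl⟩, rfl⟩
      have hz' : ‖z‖ = 1 := by simpa using hz
      refine ⟨push1 w 1 z, ?_, rfl⟩
      rw [h1 z hz']
      simp only [mem_sphere_iff_norm, sub_zero, norm_mul, hz', Complex.norm_real, mul_one]
      rw [Real.norm_of_nonneg (by linarith)]
    · rintro ⟨y, hy, rfl⟩
      have hy' : ‖y‖ = 1 - w / 2 := by simpa using hy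
      have hpos : (0 : ℝ) < 1 - w / 2 := by linarith
      have hn : ‖((1 - w / 2 : ℝ) : ℂ)⁻¹ * y‖ = 1 := by
        rw [norm_mul, norm_inv, Complex.norm_real, Real.norm_of_nonneg hpos.le, hy',
          inv_mul_cancel₀ hpos.ne']
      refine ⟨_, ⟨((1 - w / 2 : ℝ) : ℂ)⁻¹ * y, by simpa using hn, rfl⟩, ?_⟩
      change F 1 ((((1 - w / 2 : ℝ) : ℂ)⁻¹ * y : ℂ) : OnePoint ℂ) = (y : OnePoint ℂ)
      rw [hFc, h1 _ hn, mul_inv_cancel_left₀]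
      exact_mod_cast hpos.ne'
end PCL

namespace PCL
open Metric

lemma circle_coe_cont : Continuous fun z : Circle => (z : ℂ) := by fun_prop

lemma circle_zeros {φ : ℂ → ℂ} (hφ : DifferentiableOn ℂ φ (ball 0 1)) (hi : Set.InjOn φ (ball 0 1))
    {r : ℝ} (hr0 : 0 < r) (hr : r < 1) {c : ℂ} (hc : c ≠ 0) (d : ℝ) :
    {z ∈ sphere (0 : ℂ) r | (c * φ z).re = d}.Finite := by
  have hrm : ∀ θ : ℝ, (r : ℂ) * Complex.exp (θ * Complex.I) ∈ ball (0 : ℂ) 1 := by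
    intro θ
    simp [Complex.norm_exp_ofReal_mul_I, abs_of_pos hr0, hr]
  let u : ℝ → ℝ := fun θ => (c * φ (r * Complex.exp (θ * Complex.I))).re - d
  have hu : AnalyticOnNhd ℝ u Set.univ := by
    intro θ _
    have h1 : AnalyticAt ℝ (fun θ : ℝ => (r : ℂ) * Complex.exp (θ * Complex.I)) θ := by
      have h2 : AnalyticAt ℂ (fun z : ℂ => (r : ℂ) * Complex.exp (z * Complex.I)) (θ : ℂ) := by fun_prop
      exact (h2.restrictScalars (𝕜 := ℝ)).comp (Complex.ofRealCLM.analyticAt θ)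
    have h3 : AnalyticAt ℂ (fun z => c * φ z) ((r : ℂ) * Complex.exp (θ * Complex.I)) :=
      analyticAt_const.mul (hφ.analyticAt (isOpen_ball.mem_nhds (hrm θ)))
    have h4 := AnalyticAt.comp (f := fun θ : ℝ => (r : ℂ) * Complex.exp (θ * Complex.I)) (x := θ)
      (h3.restrictScalars (𝕜 := ℝ)) h1
    exact ((Complex.reCLM.analyticAt _).comp h4).sub analyticAt_const
  have hmem : ∀ x : Circle, (r : ℂ) * x ∈ ball (0 : ℂ) 1 := by
    intro x; rw [mem_ball_zero_iff, norm_mul, Circle.norm_coe, Complex.norm_real, Real.norm_of_nonneg hr0.le, mul_one]; exact hr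
  by_contra hinf
  have hZ : ({θ ∈ Set.Icc (-Real.pi) Real.pi | u θ = 0}).Infinite := by
    intro hfin
    refine hinf ((hfin.image fun θ : ℝ => (r : ℂ) * Complex.exp (θ * Complex.I)).subset ?_)
    rintro z ⟨hz, hz2⟩
    have hzn : ‖z‖ = r := by simpa using hz
    have he : (r : ℂ) * Complex.exp (z.arg * Complex.I) = z := by
      rw [← hzn]; exact Complex.norm_mul_exp_arg_mul_I z
    refine ⟨z.arg, ⟨⟨(Complex.neg_pi_lt_arg z).le, Complex.arg_le_pi z⟩, ?_⟩, he⟩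
    simp only [u]
    rw [he, hz2, sub_self]
  obtain ⟨x, _, hx⟩ := hZ.exists_accPt_of_subset_isCompact isCompact_Icc (Set.sep_subset _ _)
  rw [accPt_iff_frequently_nhdsNE] at hx
  have h0 := hu.eqOn_zero_of_preconnected_of_frequently_eq_zero isPreconnected_univ (Set.mem_univ x)
    (hx.mono fun y hy => hy.2)
  refine circle_no_inj_real (fun x : Circle => (c * φ (r * x)).im) ?_ ?_
  · have h1 : ContinuousOn φ (ball 0 1) := hφ.continuousOn
    exact Complex.continuous_im.comp (continuous_const.mul
      (h1.comp_continuous (by fun_prop) hmem))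
  · intro a b hab
    have hre : ∀ a : Circle, (c * φ (r * a)).re = d := by
      intro a
      have h2 := h0 (Set.mem_univ (a : ℂ).arg)
      simp only [u, Pi.zero_apply] at h2
      have h3 : Complex.exp ((a : ℂ).arg * Complex.I) = a := by
        have := Complex.norm_mul_exp_arg_mul_I (a : ℂ)
        rwa [Circle.norm_coe, Complex.ofReal_one, one_mul] at this
      rw [h3] at h2
      linarith
    have h1 : c * φ (r * a) = c * φ (r * b) := Complex.ext (by rw [hre, hre]) hab
    have h2 := hi (hmem a) (hmem b) (mul_left_cancel₀ hc h1)
    have h3 : (r : ℂ) ≠ 0 := by exact_mod_cast hr0.ne'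
    exact Circle.ext (mul_left_cancel₀ h3 h2)

/-- finite representative in the straightened situation -/
lemma finite_rep_line {γ : Circle → ℂ} (hγ : Continuous γ) (hγi : Function.Injective γ)
    {P e : Set (OnePoint ℂ)} (hP : P.Finite)
    (hPd : ∀ x ∈ P, x ∉ (fun z : ℂ => (z : OnePoint ℂ)) '' Set.range γ) {c : ℂ} (hc : c ≠ 0) {d : ℝ}
    (he : ∀ z : ℂ, (z : OnePoint ℂ) ∈ e → (c * z).re = d) :
    ∃ Γ', IsotopicRel ((fun z : ℂ => (z : OnePoint ℂ)) '' Set.range γ) Γ' P ∧ (Γ' ∩ e).Finite := by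
  obtain ⟨Φ, φ, hφd, hΦ, hΦJ⟩ := schoen_plane hγ hγi
  have hφi : Set.InjOn φ (ball 0 1) := by
    intro z hz w hw h
    have h1 := hΦ z (ball_subset_closedBall hz)
    rw [h, ← hΦ w (ball_subset_closedBall hw)] at h1
    exact OnePoint.coe_injective (Φ.injective h1)
  let P' := Φ.symm '' P
  have hP'f : P'.Finite := hP.image _
  have hw : ∃ w : ℝ, 0 < w ∧ w ≤ 1 / 2 ∧ ∀ z : ℂ, (z : OnePoint ℂ) ∈ P' → w ≤ |‖z‖ - 1| := by
    have hfin : ((fun x : OnePoint ℂ => |‖out x‖ - 1|) '' (P' \ {∞})).Finite :=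
      (hP'f.subset Set.sdiff_subset).image _
    have hpos : ∀ y ∈ ((fun x : OnePoint ℂ => |‖out x‖ - 1|) '' (P' \ {∞})), 0 < y := by
      rintro _ ⟨x, ⟨⟨p, hp, rfl⟩, hx⟩, rfl⟩
      simp only [abs_pos]
      intro h
      apply hPd p hp
      rw [← hΦJ]
      refine ⟨Φ.symm p, ⟨out (Φ.symm p), ?_, coe_out hx⟩, by simp⟩
      simp only [mem_sphere_iff_norm, sub_zero]
      linarith
    have : ∃ m : ℝ, 0 < m ∧ ∀ y ∈ ((fun x : OnePoint ℂ => |‖out x‖ - 1|) '' (P' \ {∞})), m ≤ y := by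
      rcases Set.eq_empty_or_nonempty ((fun x : OnePoint ℂ => |‖out x‖ - 1|) '' (P' \ {∞})) with h | h
      · exact ⟨1, one_pos, by rw [h]; simp⟩
      · obtain ⟨m, hm, hm2⟩ := Set.exists_min_image _ id hfin h
        exact ⟨m, hpos m hm, hm2⟩
    obtain ⟨m, hm, hm2⟩ := this
    refine ⟨min m (1 / 2), by positivity, min_le_right _ _, fun z hz => (min_le_left _ _).trans ?_⟩
    exact hm2 _ ⟨(z : OnePoint ℂ), ⟨hz, OnePoint.coe_ne_infty z⟩, rfl⟩
  obtain ⟨w, hw0, hw1, hw2⟩ := hw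
  have hiso := iso_map Φ (radial_isotopy hw0 hw1 hw2)
  rw [hΦJ] at hiso
  have hPP : Φ '' P' = P := by
    simp only [P', Set.image_image, Homeomorph.apply_symm_apply, Set.image_id']
  rw [hPP] at hiso
  refine ⟨_, hiso, ?_⟩
  have hz := circle_zeros hφd hφi (r := 1 - w / 2) (by linarith) (by linarith) hc d
  refine (hz.image fun z : ℂ => Φ (z : OnePoint ℂ)).subset ?_
  rintro _ ⟨⟨_, ⟨z, hz, rfl⟩, rfl⟩, hze⟩
  refine ⟨z, ⟨hz, ?_⟩, rfl⟩
  have hzn : ‖z‖ = 1 - w / 2 := by simpa using hz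
  simp only at hze
  rw [hΦ z (by simp [hzn]; linarith)] at hze
  exact he _ hze

lemma circle_ne_univ {γ : Circle → OnePoint ℂ} (hγ : Continuous γ) (hγi : Function.Injective γ) :
    ∃ x, x ∉ Set.range γ := by
  by_contra h
  push Not at h
  have h1 := circle_range_eq hγ hγi (σ := fun z : Circle => ((z : ℂ) : OnePoint ℂ))
    (OnePoint.continuous_coe.comp circle_coe_cont)
    (fun a b hab => Circle.ext (OnePoint.coe_injective hab)) (fun x _ => h x)
  obtain ⟨z, hz⟩ := h1 ▸ h ∞
  exact OnePoint.coe_ne_infty _ hz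

/-- planar version of a curve missing infinity -/
lemma planar {γ : Circle → OnePoint ℂ} (hγ : Continuous γ) (hγi : Function.Injective γ)
    (h : ∞ ∉ Set.range γ) : ∃ σ : Circle → ℂ, Continuous σ ∧ Function.Injective σ ∧
      ∀ x, γ x = (σ x : OnePoint ℂ) := by
  have hc : ∀ x, ((out (γ x) : ℂ) : OnePoint ℂ) = γ x := fun x => coe_out fun e => h ⟨x, e⟩
  refine ⟨fun x => out (γ x), (out_continuousOn h).comp_continuous hγ (fun x => ⟨x, rfl⟩), ?_,
    fun x => (hc x).symm⟩
  intro a b hab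
  apply hγi
  rw [← hc a, ← hc b]
  exact congrArg _ hab

theorem schoenS {γ : Circle → OnePoint ℂ} (hγ : Continuous γ) (hγi : Function.Injective γ) :
    ∃ Φ : OnePoint ℂ ≃ₜ OnePoint ℂ,
      Φ '' ((fun z : ℂ => (z : OnePoint ℂ)) '' sphere 0 1) = Set.range γ := by
  obtain ⟨x, hx⟩ := circle_ne_univ hγ hγi
  obtain ⟨h, hh⟩ := exists_toInf x
  obtain ⟨σ, hσ, hσi, e⟩ := planar (h.continuous.comp hγ) (h.injective.comp hγi) (by
    rintro ⟨y, hy⟩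
    rw [← hh] at hy
    exact hx ⟨y, h.injective hy⟩)
  obtain ⟨Φ, φ, -, -, hJ⟩ := schoen_plane hσ hσi
  refine ⟨Φ.trans h.symm, ?_⟩
  have : (Φ.trans h.symm) '' ((fun z : ℂ => (z : OnePoint ℂ)) '' sphere 0 1) =
      h.symm '' (Φ '' ((fun z : ℂ => (z : OnePoint ℂ)) '' sphere 0 1)) := by
    rw [Set.image_image h.symm]; rfl
  rw [this, hJ]
  ext y
  constructor
  · rintro ⟨_, ⟨_, ⟨t, rfl⟩, rfl⟩, rfl⟩
    exact ⟨t, by simp only; rw [← e]; simp⟩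
  · rintro ⟨t, rfl⟩
    exact ⟨_, ⟨_, ⟨t, rfl⟩, rfl⟩, by simp only; rw [← e]; simp⟩

/-- two arcs with common endpoints form a circle -/
lemma two_arcs {A B : Set (OnePoint ℂ)} {a b : OnePoint ℂ} (hA : IsArc A a b) (hB : IsArc B a b)
    (hAB : A ∩ B = {a, b}) : ∃ γ : Circle → OnePoint ℂ, Continuous γ ∧ Function.Injective γ ∧
      A ⊆ Set.range γ := by
  obtain ⟨hab, γ₁, hi₁, rfl⟩ := hA
  obtain ⟨-, γ₂, hi₂, rfl⟩ := hB
  have hsq : ∀ z : Circle, (z : ℂ).re ^ 2 + (z : ℂ).im ^ 2 = 1 := by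
    intro z
    have := Circle.normSq_coe z
    rw [Complex.normSq_apply] at this
    nlinarith
  let s : Circle → unitInterval := fun z => ⟨(1 + (z : ℂ).re) / 2, by
    have := hsq z
    constructor <;> nlinarith [sq_nonneg (z : ℂ).im]⟩
  have hs : Continuous s := by
    refine Continuous.subtype_mk ?_ _
    have : Continuous fun z : Circle => (z : ℂ).re := Complex.continuous_re.comp circle_coe_cont
    fun_prop
  have him : Continuous fun z : Circle => (z : ℂ).im := Complex.continuous_im.comp circle_coe_cont
  have hs1 : ∀ z w : Circle, s z = s w → (z : ℂ).re = (w : ℂ).re := by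
    intro z w h
    have := congrArg Subtype.val h
    simp only [s] at this
    linarith
  have hend : ∀ z : Circle, (z : ℂ).im = 0 → s z = 0 ∨ s z = 1 := by
    intro z hz
    have := hsq z
    rw [hz] at this
    have h2 : ((z : ℂ).re - 1) * ((z : ℂ).re + 1) = 0 := by nlinarith
    rcases mul_eq_zero.1 h2 with h | h
    · right; ext; simp only [s, Set.Icc.coe_one]; linarith
    · left; ext; simp only [s, Set.Icc.coe_zero]; linarith
  have hend2 : ∀ z : Circle, s z = 0 ∨ s z = 1 → (z : ℂ).im = 0 := by
    intro z h
    have h3 := hsq z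
    have : (z : ℂ).re ^ 2 = 1 := by
      rcases h with h | h
      · have := congrArg Subtype.val h
        simp only [s, Set.Icc.coe_zero] at this
        have : (z : ℂ).re = -1 := by linarith
        rw [this]; norm_num
      · have := congrArg Subtype.val h
        simp only [s, Set.Icc.coe_one] at this
        have : (z : ℂ).re = 1 := by linarith
        rw [this]; norm_num
    have : (z : ℂ).im ^ 2 = 0 := by linarith
    exact pow_eq_zero_iff (two_ne_zero) |>.1 this
  let γ : Circle → OnePoint ℂ := fun z => if 0 ≤ (z : ℂ).im then γ₁ (s z) else γ₂ (s z)
  have hcross : ∀ z w : Circle, 0 ≤ (z : ℂ).im → (w : ℂ).im < 0 → γ₁ (s z) ≠ γ₂ (s w) := by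
    intro z w _ hw h
    have hm : γ₂ (s w) ∈ Set.range γ₁ ∩ Set.range γ₂ := ⟨⟨s z, h⟩, ⟨s w, rfl⟩⟩
    rw [hAB] at hm
    refine hw.ne (hend2 w ?_)
    rcases hm with hm | hm
    · left; apply hi₂; rw [hm, γ₂.source]
    · right; apply hi₂; rw [hm, γ₂.target]
  refine ⟨γ, ?_, ?_, ?_⟩
  · refine Continuous.if_le (γ₁.continuous.comp hs) (γ₂.continuous.comp hs) continuous_const him ?_
    intro z hz
    rcases hend z hz.symm with h | h <;> simp [h]
  · intro z w h
    simp only [γ] at h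
    split_ifs at h with h1 h2 h2
    · have hre := hs1 z w (hi₁ h)
      refine Circle.ext (Complex.ext hre ?_)
      have a1 := hsq z; have a2 := hsq w
      rw [hre] at a1
      exact (sq_eq_sq₀ h1 h2).1 (by linarith)
    · exact absurd h (hcross z w h1 (not_le.1 h2))
    · exact absurd h.symm (hcross w z h2 (not_le.1 h1))
    · have hre := hs1 z w (hi₂ h)
      refine Circle.ext (Complex.ext hre ?_)
      have a1 := hsq z; have a2 := hsq w
      rw [hre] at a1
      push Not at h1 h2
      have := (sq_eq_sq₀ (neg_nonneg.2 h1.le) (neg_nonneg.2 h2.le)).1 (by rw [neg_sq, neg_sq]; linarith)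
      linarith
  · rintro _ ⟨t, rfl⟩
    have ht := t.2
    have hx : 0 ≤ 1 - (2 * (t : ℝ) - 1) ^ 2 := by nlinarith [ht.1, ht.2]
    let z : Circle := ⟨⟨2 * t - 1, Real.sqrt (1 - (2 * (t : ℝ) - 1) ^ 2)⟩, by
      change _ ∈ Metric.sphere (0 : ℂ) 1
      rw [mem_sphere_iff_norm, sub_zero, ← sq_eq_sq₀ (norm_nonneg _) zero_le_one,
        ← Complex.normSq_eq_norm_sq, Complex.normSq_apply]
      simp only
      rw [Real.mul_self_sqrt hx]; ring⟩
    refine ⟨z, ?_⟩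
    have h1 : 0 ≤ (z : ℂ).im := Real.sqrt_nonneg _
    have h2 : s z = t := by ext; simp only [s, z]; ring
    simp only [γ, if_pos h1, h2]

lemma scc_param {Γ : Set (OnePoint ℂ)} (h : IsSimpleClosedCurve Γ) :
    ∃ γ : Circle → OnePoint ℂ, Continuous γ ∧ Function.Injective γ ∧ Set.range γ = Γ := by
  obtain ⟨h⟩ := h
  refine ⟨fun z => (h.symm z : OnePoint ℂ), continuous_subtype_val.comp h.symm.continuous,
    Subtype.val_injective.comp h.symm.injective, ?_⟩
  have : (fun z => (h.symm z : OnePoint ℂ)) = Subtype.val ∘ h.symm := rfl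
  rw [this, Set.range_comp, h.symm.surjective.range_eq, Set.image_univ, Subtype.range_coe]

lemma unit_line {v z : ℂ} (hv : ‖v‖ = 1) (hz : ‖z‖ = 1) (h : z ≠ v) :
    (v * (z - v)⁻¹).re = -1 / 2 := by
  have h1 : v.re ^ 2 + v.im ^ 2 = 1 := by
    have := Complex.normSq_eq_norm_sq v
    rw [hv, Complex.normSq_apply] at this; nlinarith
  have h2 : z.re ^ 2 + z.im ^ 2 = 1 := by
    have := Complex.normSq_eq_norm_sq z
    rw [hz, Complex.normSq_apply] at this; nlinarith
  have h3 : Complex.normSq (z - v) ≠ 0 := by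
    rw [Ne, Complex.normSq_eq_zero]; exact sub_ne_zero.2 h
  rw [Complex.mul_re, Complex.inv_re, Complex.inv_im]
  field_simp
  rw [Complex.normSq_apply] 
  simp only [Complex.sub_re, Complex.sub_im]
  nlinarith

theorem finite_rep (bd : BlowupData RiemannSphere) (j : Fin bd.n) {Γ : Set RiemannSphere}
    (hΓ : IsSimpleClosedCurve Γ) (hΓP : Γ ∩ ↑bd.Vset = ∅) :
    ∃ Γ', IsotopicRel Γ Γ' ↑bd.Vset ∧ (Γ' ∩ bd.edge j).Finite := by
  obtain ⟨γ, hγ, hγi, rfl⟩ := scc_param hΓ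
  obtain ⟨σ, hσ, hσi, hsub⟩ := two_arcs (bd.side1_isArc j) (bd.side2_isArc j) (bd.side_inter j)
  obtain ⟨H, _, hH2, _, hH4⟩ := bd.side1_isotopic j
  obtain ⟨g, hg⟩ := bij_homeo (Φ := fun x => H (1, x)) (by fun_prop) (hH2 1)
  have hg' : g '' bd.side1 j = bd.edge j := by
    rw [← hH4]; exact Set.image_congr fun x _ => hg x
  obtain ⟨Φ, hΦ⟩ := schoenS (g.continuous.comp hσ) (g.injective.comp hσi)
  have hesub : bd.edge j ⊆ Φ '' ((fun z : ℂ => (z : OnePoint ℂ)) '' sphere 0 1) := by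
    rw [hΦ, ← hg', Set.range_comp]; exact Set.image_mono hsub
  have ha : (bd.ends j).1 ∈ bd.edge j := by
    obtain ⟨_, q, _, hq⟩ := bd.edge_isArc j
    rw [← hq]; exact ⟨0, q.source⟩
  obtain ⟨_, ⟨v, hv, rfl⟩, hva⟩ := hesub ha
  simp only at hva
  have hv1 : ‖v‖ = 1 := by simpa using hv
  let h : OnePoint ℂ ≃ₜ OnePoint ℂ := Φ.symm.trans (toInf v)
  have hha : h (bd.ends j).1 = ∞ := by
    simp only [h, Homeomorph.trans_apply, ← hva, Homeomorph.symm_apply_apply, toInf_self]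
  have hd : ∀ x, γ x ∉ (bd.Vset : Set (OnePoint ℂ)) := fun x hx =>
    (Set.eq_empty_iff_forall_notMem.1 hΓP (γ x)) ⟨⟨x, rfl⟩, hx⟩
  obtain ⟨α, hα, hαi, eα⟩ := planar (h.continuous.comp hγ) (h.injective.comp hγi) (by
    rintro ⟨y, hy⟩
    rw [← hha] at hy
    have := h.injective hy
    exact hd y (this ▸ (bd.ends_mem j).1))
  have hrange : (fun z : ℂ => (z : OnePoint ℂ)) '' Set.range α = h '' Set.range γ := by
    rw [← Set.range_comp, ← Set.range_comp]
    congr 1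
    funext x
    exact (eα x).symm
  obtain ⟨Γ', hiso, hfin⟩ := finite_rep_line (P := h '' (bd.Vset : Set (OnePoint ℂ)))
    (e := h '' bd.edge j) hα hαi (bd.Vset.finite_toSet.image _) (by
      rintro _ ⟨x, hx, rfl⟩ hm
      rw [hrange] at hm
      obtain ⟨_, ⟨y, rfl⟩, hy⟩ := hm
      exact hd y (h.injective hy ▸ hx)) (c := v) (by intro e; simp [e] at hv1) (d := -1 / 2) (by
      rintro z ⟨x, hx, hxz⟩
      obtain ⟨_, ⟨s, hs, rfl⟩, rfl⟩ := hesub hx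
      have hs1 : ‖s‖ = 1 := by simpa using hs
      simp only [h, Homeomorph.trans_apply, Homeomorph.symm_apply_apply] at hxz
      by_cases hsv : s = v
      · rw [hsv, toInf_self] at hxz
        exact absurd hxz.symm (OnePoint.coe_ne_infty z)
      · rw [toInf_ne hsv] at hxz
        rw [← OnePoint.coe_injective hxz]
        exact unit_line hv1 hs1 hsv)
  rw [hrange] at hiso
  have hsymm : ∀ X : Set (OnePoint ℂ), h.symm '' (h '' X) = X := by
    intro X; rw [Set.image_image]; simp
  have h2 := iso_map h.symm hiso
  rw [hsymm, hsymm] at h2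
  refine ⟨_, h2, ?_⟩
  have h3 := hfin.image h.symm
  rwa [Set.image_inter h.symm.injective, hsymm] at h3
end PCL

namespace PCL
open Metric

lemma fib_count {X ι : Type*} [Fintype ι] {f : X → X} {y : X} (D : ι → Set X)
    (hex : ∀ i, ∃ x ∈ D i, f x = y)
    (hu : ∀ i x x', x ∈ D i → x' ∈ D i → f x = y → f x' = y → x = x')
    (hd : ∀ i k x, x ∈ D i → x ∈ D k → f x = y → i = k)
    (hc : ∀ x, f x = y → ∃ i, x ∈ D i) :
    (f ⁻¹' {y}).Finite ∧ (f ⁻¹' {y}).ncard = Fintype.card ι := by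
  choose g hg hgf using hex
  have hinj : Function.Injective g := by
    intro i k h
    exact hd i k (g i) (hg i) (h ▸ hg k) (hgf i)
  have hr : f ⁻¹' {y} = Set.range g := by
    ext x
    constructor
    · intro hx
      obtain ⟨i, hi⟩ := hc x hx
      exact ⟨i, hu i _ _ (hg i) hi (hgf i) hx⟩
    · rintro ⟨i, rfl⟩
      exact hgf i
  rw [hr]
  refine ⟨Set.finite_range g, ?_⟩
  rw [← Set.image_univ, Set.ncard_image_of_injective _ hinj, Set.ncard_univ, Nat.card_eq_fintype_card]

section blow
variable (bd : BlowupData RiemannSphere)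

lemma bd_cover (x : RiemannSphere) : x ∈ (⋃ j, bd.patch j)ᶜ ∨
    ∃ j, x ∈ interior (bd.patch j) ∨ x ∈ bd.side1 j ∨ x ∈ bd.side2 j := by
  by_cases h : x ∈ ⋃ j, bd.patch j
  · right
    obtain ⟨j, hj⟩ := Set.mem_iUnion.1 h
    refine ⟨j, ?_⟩
    by_cases hi : x ∈ interior (bd.patch j)
    · exact Or.inl hi
    · right
      have : x ∈ frontier (bd.patch j) := by
        rw [(bd.patch_closed j).frontier_eq]; exact ⟨hj, hi⟩
      rw [bd.frontier_patch] at this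
      exact this
  · exact Or.inl h

lemma bd_fib_finite (y : RiemannSphere) : (bd.toFun ⁻¹' {y}).Finite := by
  have h1 : ∀ A : Set RiemannSphere, Set.InjOn bd.toFun A → (A ∩ bd.toFun ⁻¹' {y}).Finite := by
    intro A hA
    apply Set.Subsingleton.finite
    intro a ha b hb
    exact hA ha.1 hb.1 (ha.2.trans hb.2.symm)
  have h2 := (h1 _ bd.maps_complement.injOn).union (Set.finite_iUnion fun j =>
    ((h1 _ (bd.maps_patch j).injOn).union
      ((h1 _ (bd.maps_side1 j).injOn).union (h1 _ (bd.maps_side2 j).injOn))))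
  refine h2.subset ?_
  intro x hx
  rcases bd_cover bd x with h | ⟨j, h⟩
  · exact Or.inl ⟨h, hx⟩
  · right
    refine Set.mem_iUnion.2 ⟨j, ?_⟩
    rcases h with h | h | h
    · exact Or.inl ⟨h, hx⟩
    · exact Or.inr (Or.inl ⟨h, hx⟩)
    · exact Or.inr (Or.inr ⟨h, hx⟩)

lemma bd_side_patch {j} {x : RiemannSphere} (h : x ∈ bd.side1 j ∨ x ∈ bd.side2 j) :
    x ∈ bd.patch j := by
  have : x ∈ frontier (bd.patch j) := by rw [bd.frontier_patch]; exact h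
  exact (bd.patch_closed j).frontier_subset this

lemma bd_side_int {j} {x : RiemannSphere} (h : x ∈ bd.side1 j ∨ x ∈ bd.side2 j) :
    x ∉ interior (bd.patch j) := by
  have : x ∈ frontier (bd.patch j) := by rw [bd.frontier_patch]; exact h
  exact this.2

lemma bd_ends_V {j} {x : RiemannSphere} (h : x ∈ ({(bd.ends j).1, (bd.ends j).2} : Set RiemannSphere)) :
    x ∈ bd.Vset := by
  rcases h with rfl | h
  · exact (bd.ends_mem j).1
  · rw [Set.mem_singleton_iff] at h
    rw [h]; exact (bd.ends_mem j).2

lemma bd_patch_eq {j k} {x : RiemannSphere} (hx : bd.toFun x ∉ bd.Vset) (hj : x ∈ bd.patch j)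
    (hk : x ∈ bd.patch k) : j = k := by
  by_contra hne
  have h1 : x ∈ bd.edge j ∩ bd.edge k := by rw [← bd.patch_inter j k hne]; exact ⟨hj, hk⟩
  have h2 := bd_ends_V bd (bd.edge_inter j k hne h1).1
  exact hx (by rw [bd.fixes_vertices x h2]; exact h2)

lemma bd_fib_card {y : RiemannSphere} (hy : y ∉ bd.Vset) :
    (bd.toFun ⁻¹' {y}).ncard = bd.n + 1 := by
  have hcard : Fintype.card (Option (Fin bd.n)) = bd.n + 1 := by simp
  rw [← hcard]
  by_cases he : y ∈ ⋃ j, bd.edge j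
  · obtain ⟨j, hj⟩ := Set.mem_iUnion.1 he
    have huniq : ∀ k, k ≠ j → y ∉ bd.edge k := by
      intro k hk hyk
      exact hy (bd_ends_V bd (bd.edge_inter k j hk ⟨hyk, hj⟩).1)
    let D : Option (Fin bd.n) → Set RiemannSphere := fun o => match o with
      | none => bd.side1 j
      | Option.some k => if k = j then bd.side2 j else interior (bd.patch k)
    have hD1 : D none = bd.side1 j := rfl
    have hD2 : D (Option.some j) = bd.side2 j := by simp [D]
    have hD3 : ∀ k, k ≠ j → D (Option.some k) = interior (bd.patch k) := by
      intro k hk; simp [D, hk]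
    have hDp : ∀ o x, x ∈ D o → x ∈ bd.patch (o.getD j) := by
      intro o x hx
      cases o with
      | none => exact bd_side_patch bd (Or.inl hx)
      | some k =>
        by_cases hk : k = j
        · subst hk
          rw [hD2] at hx
          exact bd_side_patch bd (Or.inr hx)
        · rw [hD3 k hk] at hx
          exact interior_subset hx
    refine (fib_count D ?_ ?_ ?_ ?_).2
    · intro o
      cases o with
      | none => exact (bd.maps_side1 j).surjOn hj
      | some k =>
        by_cases hk : k = j
        · subst hk
          rw [hD2]
          exact (bd.maps_side2 k).surjOn hj
        · rw [hD3 k hk]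
          exact (bd.maps_patch k).surjOn (huniq k hk)
    · intro o x x' hx hx' h h'
      have hh := h.trans h'.symm
      cases o with
      | none => exact (bd.maps_side1 j).injOn hx hx' hh
      | some k =>
        by_cases hk : k = j
        · subst hk
          rw [hD2] at hx hx'
          exact (bd.maps_side2 k).injOn hx hx' hh
        · rw [hD3 k hk] at hx hx'
          exact (bd.maps_patch k).injOn hx hx' hh
    · intro o o' x hx hx' hf
      have hnv : bd.toFun x ∉ bd.Vset := by rw [hf]; exact hy
      have hp := bd_patch_eq bd hnv (hDp o x hx) (hDp o' x hx')
      have key : ¬ (x ∈ bd.side1 j ∧ x ∈ bd.side2 j) := by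
        intro hh
        have h3 : x ∈ bd.side1 j ∩ bd.side2 j := hh
        rw [bd.side_inter] at h3
        have h4 := bd_ends_V bd h3
        exact hnv (by rw [bd.fixes_vertices x h4]; exact h4)
      cases o with
      | none =>
        cases o' with
        | none => rfl
        | some k =>
          have : j = k := hp
          subst this
          rw [hD2] at hx'
          exact absurd ⟨hx, hx'⟩ key
      | some k =>
        cases o' with
        | none =>
          have : k = j := hp
          subst this
          rw [hD2] at hx
          exact absurd ⟨hx', hx⟩ key
        | some k' =>
          have : k = k' := hp
          rw [this]
    · intro x hx
      rcases bd_cover bd x with h | ⟨k, h⟩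
      · have := bd.maps_complement.mapsTo h
        rw [hx] at this
        exact absurd he this
      · by_cases hk : k = j
        · subst hk
          rcases h with h | h | h
          · have := (bd.maps_patch k).mapsTo h
            rw [hx] at this
            exact absurd hj this
          · exact ⟨none, h⟩
          · exact ⟨Option.some k, by rw [hD2]; exact h⟩
        · rcases h with h | h | h
          · exact ⟨Option.some k, by rw [hD3 k hk]; exact h⟩
          · have := (bd.maps_side1 k).mapsTo h
            rw [hx] at this
            exact absurd this (huniq k hk)
          · have := (bd.maps_side2 k).mapsTo h
            rw [hx] at this
            exact absurd this (huniq k hk)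
  · have hne : ∀ j, y ∉ bd.edge j := fun j hj => he (Set.mem_iUnion.2 ⟨j, hj⟩)
    let D : Option (Fin bd.n) → Set RiemannSphere := fun o => match o with
      | none => (⋃ j, bd.patch j)ᶜ
      | Option.some k => interior (bd.patch k)
    have hD1 : D none = (⋃ j, bd.patch j)ᶜ := rfl
    have hD3 : ∀ k, D (Option.some k) = interior (bd.patch k) := fun k => rfl
    refine (fib_count D ?_ ?_ ?_ ?_).2
    · intro o
      cases o with
      | none => exact bd.maps_complement.surjOn he
      | some k => exact (bd.maps_patch k).surjOn (hne k)
    · intro o x x' hx hx' h h'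
      have hh := h.trans h'.symm
      cases o with
      | none => exact bd.maps_complement.injOn hx hx' hh
      | some k => exact (bd.maps_patch k).injOn hx hx' hh
    · intro o o' x hx hx' hf
      have hnv : bd.toFun x ∉ bd.Vset := by rw [hf]; exact hy
      cases o with
      | none =>
        cases o' with
        | none => rfl
        | some k => exact absurd (Set.mem_iUnion.2 ⟨k, interior_subset hx'⟩) hx
      | some k =>
        cases o' with
        | none => exact absurd (Set.mem_iUnion.2 ⟨k, interior_subset hx⟩) hx'
        | some k' => rw [bd_patch_eq bd hnv (interior_subset hx) (interior_subset hx')]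
    · intro x hx
      rcases bd_cover bd x with h | ⟨k, h⟩
      · exact ⟨none, h⟩
      · rcases h with h | h | h
        · exact ⟨Option.some k, h⟩
        · have := (bd.maps_side1 k).mapsTo h
          rw [hx] at this
          exact absurd this (hne k)
        · have := (bd.maps_side2 k).mapsTo h
          rw [hx] at this
          exact absurd this (hne k)

end blow

/-- punctured neighbourhoods of a point of the sphere -/
lemma small_punct (y : RiemannSphere) {U : Set RiemannSphere} (hU : U ∈ 𝓝 y) :
    ∃ O, IsOpen O ∧ y ∈ O ∧ O ⊆ U ∧ IsPreconnected (O \ {y}) := by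
  obtain ⟨h, hh⟩ := exists_toInf y
  have h1 : h '' U ∈ 𝓝 (∞ : RiemannSphere) := by
    rw [← hh]; exact h.isOpenMap.image_mem_nhds hU
  have h2 : ∃ R : ℝ, 0 < R ∧ ((fun z : ℂ => (z : RiemannSphere)) '' closedBall 0 R)ᶜ ⊆ h '' U := by
    rw [OnePoint.hasBasis_nhds_infty.mem_iff] at h1
    obtain ⟨K, ⟨hKc, hK⟩, hs⟩ := h1
    obtain ⟨R, hR⟩ := hK.isBounded.subset_closedBall 0
    refine ⟨max R 1, by positivity, fun x hx => hs ?_⟩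
    induction x using OnePoint.rec with
    | infty => right; rfl
    | coe z =>
      left
      refine ⟨z, ?_, rfl⟩
      intro hz
      exact hx ⟨z, closedBall_subset_closedBall (le_max_left _ _) (hR hz), rfl⟩
  obtain ⟨R, hR, hs⟩ := h2
  set C := (fun z : ℂ => (z : RiemannSphere)) '' closedBall 0 R
  have hC : IsClosed C := ((isCompact_closedBall (0 : ℂ) R).image OnePoint.continuous_coe).isClosed
  refine ⟨h ⁻¹' Cᶜ, hC.isOpen_compl.preimage h.continuous, ?_, ?_, ?_⟩
  · change h y ∉ C
    rw [hh]
    rintro ⟨z, -, hz⟩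
    exact OnePoint.coe_ne_infty z hz
  · intro x hx
    obtain ⟨u, hu, hux⟩ := hs hx
    rwa [← h.injective hux]
  · have : h ⁻¹' Cᶜ \ {y} = h.symm '' ((fun z : ℂ => (z : RiemannSphere)) '' {z | R < ‖z‖}) := by
      ext x
      constructor
      · rintro ⟨hx, hxy⟩
        have hne : h x ≠ ∞ := fun hx' => hxy (h.injective (hx'.trans hh.symm))
        obtain ⟨z, hz⟩ := OnePoint.ne_infty_iff_exists.1 hne
        refine ⟨h x, ⟨z, ?_, hz⟩, by simp⟩
        by_contra hzR
        exact hx ⟨z, by simpa using hzR, hz⟩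
      · rintro ⟨_, ⟨z, hz, rfl⟩, rfl⟩
        refine ⟨?_, ?_⟩
        · change h (h.symm _) ∉ C
          rw [h.apply_symm_apply]
          rintro ⟨w, hw, hwz⟩
          have : w = z := OnePoint.coe_injective hwz
          subst this
          have h3 : R < ‖w‖ := hz
          have h4 : ‖w‖ ≤ R := by simpa using hw
          linarith
        · intro hx
          have : h (h.symm (z : RiemannSphere)) = h y := congrArg h hx
          rw [h.apply_symm_apply, hh] at this
          exact OnePoint.coe_ne_infty z this
    rw [this]
    exact ((isPreconnected_norm_gt hR).image _ OnePoint.continuous_coe.continuousOn).image _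
      h.symm.continuous.continuousOn

instance punct_neBot (x : RiemannSphere) : (𝓝[≠] x).NeBot := by
  induction x using OnePoint.rec with
  | infty => exact OnePoint.nhdsNE_infty_neBot
  | coe z => exact OnePoint.nhdsNE_coe_neBot z

/-- removal of exceptional points for openness -/
lemma open_removal {f : RiemannSphere → RiemannSphere} (hf : Continuous f)
    (hfib : ∀ y, (f ⁻¹' {y}).Finite) {X : Set RiemannSphere} (hX : X.Finite)
    (hop : ∀ x, x ∉ X → 𝓝 (f x) ≤ Filter.map f (𝓝 x)) : IsOpenMap f := by
  rw [isOpenMap_iff_nhds_le]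
  intro x0 N hN
  have hN2 : f ⁻¹' N ∈ 𝓝 x0 := hN
  set E := (f ⁻¹' {f x0} ∪ X) \ {x0} with hE
  have hEf : E.Finite := ((hfib _).union hX).sdiff
  have hW : f ⁻¹' N ∩ Eᶜ ∈ 𝓝 x0 :=
    Filter.inter_mem hN2 (hEf.isClosed.isOpen_compl.mem_nhds (by simp [hE]))
  obtain ⟨K, hK, hKc, hKW⟩ := exists_mem_nhds_isClosed_subset hW
  set B := interior K with hB
  have hBo : IsOpen B := isOpen_interior
  have hx0B : x0 ∈ B := mem_interior_iff_mem_nhds.2 hK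
  have hclB : closure B ⊆ K := hKc.closure_subset_iff.2 interior_subset
  have hfr : IsCompact (f '' frontier B) := (isClosed_frontier.isCompact).image hf
  have hy0 : f x0 ∉ f '' frontier B := by
    rintro ⟨z, hz, hzx⟩
    have hzK := hKW (hclB hz.1)
    have hne : z ≠ x0 := by
      rintro rfl
      exact hz.2 (by rwa [hBo.interior_eq])
    exact hzK.2 ⟨Or.inl hzx, hne⟩
  obtain ⟨O, hO, hyO, hOs, hOc⟩ := small_punct (f x0) (hfr.isClosed.isOpen_compl.mem_nhds hy0)
  have hU1 : IsOpen (f '' (B \ {x0})) := by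
    rw [isOpen_iff_mem_nhds]
    rintro _ ⟨z, ⟨hzB, hzx⟩, rfl⟩
    have hz : z ∉ X := by
      intro hzX
      exact (hKW (interior_subset hzB)).2 ⟨Or.inr hzX, hzx⟩
    have h1 : B \ {x0} ∈ 𝓝 z := (hBo.sdiff isClosed_singleton).mem_nhds ⟨hzB, hzx⟩
    exact hop z hz (Filter.image_mem_map h1)
  have hU2 : IsOpen (f '' closure B)ᶜ :=
    ((isClosed_closure.isCompact).image hf).isClosed.isOpen_compl
  have hsub : O \ {f x0} ⊆ f '' (B \ {x0}) := by
    apply hOc.subset_left_of_subset_union hU1 hU2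
    · rw [Set.disjoint_left]
      rintro _ ⟨z, hz, rfl⟩ hh
      exact hh ⟨z, subset_closure hz.1, rfl⟩
    · intro y hy
      by_cases h : y ∈ f '' closure B
      · left
        obtain ⟨z, hz, rfl⟩ := h
        have hzB : z ∈ B := by
          by_contra hzB
          exact hOs hy.1 ⟨z, ⟨hz, by rwa [hBo.interior_eq]⟩, rfl⟩
        refine ⟨z, ⟨hzB, ?_⟩, rfl⟩
        rintro rfl
        exact hy.2 rfl
      · exact Or.inr h
    · have h1 : B ∩ f ⁻¹' O ∈ 𝓝 x0 :=
        (hBo.inter (hO.preimage hf)).mem_nhds ⟨hx0B, hyO⟩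
      have h2 : (B ∩ f ⁻¹' O) ∩ {x0}ᶜ ∈ 𝓝[≠] x0 :=
        Filter.inter_mem (mem_nhdsWithin_of_mem_nhds h1) self_mem_nhdsWithin
      obtain ⟨z, ⟨hzB, hzO⟩, hzx⟩ := Filter.nonempty_of_mem h2
      refine ⟨f z, ⟨hzO, ?_⟩, ⟨z, ⟨hzB, hzx⟩, rfl⟩⟩
      intro hzf
      exact (hKW (interior_subset hzB)).2 ⟨Or.inl hzf, hzx⟩
  refine Filter.mem_of_superset (hO.mem_nhds hyO) ?_
  intro y hy
  by_cases hyx : y = f x0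
  · rw [hyx]
    have hx0N : x0 ∈ f ⁻¹' N := mem_of_mem_nhds hN2
    exact hx0N
  · obtain ⟨z, hz, rfl⟩ := hsub ⟨hy, hyx⟩
    exact (hKW (interior_subset hz.1)).1

lemma rat_open {f : RiemannSphere → RiemannSphere} (hf : Continuous f)
    (hfib : ∀ y, (f ⁻¹' {y}).Finite) (F : RatFunc ℂ) (hF : f = evalSphere F) : IsOpenMap f := by
  have hden : F.denom ≠ 0 := F.denom_ne_zero
  set R : Set ℂ := {z | F.denom.eval z = 0} with hR
  have hRf : R.Finite := by
    have := Polynomial.finite_setOfPred_isRoot hden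
    exact this
  refine open_removal hf hfib (X := {∞} ∪ (fun z : ℂ => (z : RiemannSphere)) '' R)
    ((Set.finite_singleton _).union (hRf.image _)) ?_
  intro x hx
  have hxne : x ≠ ∞ := fun h => hx (Or.inl h)
  obtain ⟨z, rfl⟩ := OnePoint.ne_infty_iff_exists.1 hxne
  have hz : F.denom.eval z ≠ 0 := fun h => hx (Or.inr ⟨z, h, rfl⟩)
  let g : ℂ → ℂ := fun w => F.num.eval w / F.denom.eval w
  have hfg : ∀ w, F.denom.eval w ≠ 0 → f (w : RiemannSphere) = ((g w : ℂ) : RiemannSphere) := by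
    intro w hw
    rw [hF]
    change evalFin F w = _
    simp only [evalFin, if_neg hw]
    rfl
  have hev : ∀ᶠ w in 𝓝 z, F.denom.eval w ≠ 0 :=
    F.denom.continuous.continuousAt.eventually_ne hz
  have hga : AnalyticAt ℂ g z := by
    refine AnalyticAt.fun_div ?_ ?_ hz
    · exact (F.num.differentiable.analyticAt z)
    · exact (F.denom.differentiable.analyticAt z)
  have hopen : 𝓝 (g z) ≤ Filter.map g (𝓝 z) := by
    refine hga.eventually_constant_or_nhds_le_map_nhds.resolve_left ?_
    intro hc
    have h1 : ∀ᶠ w : ℂ in 𝓝 z, (w : RiemannSphere) ∈ f ⁻¹' {f (z : RiemannSphere)} := by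
      filter_upwards [hc, hev] with w hw hw'
      change f w = f z
      rw [hfg w hw', hfg z hz, hw]
    have h2 : ((fun w : ℂ => (w : RiemannSphere)) ⁻¹' (f ⁻¹' {f (z : RiemannSphere)})).Finite :=
      (hfib _).preimage OnePoint.coe_injective.injOn
    exact infinite_of_mem_nhds z h1 h2
  have he : IsOpenMap (fun w : ℂ => (w : RiemannSphere)) := OnePoint.isOpenMap_coe
  rw [hfg z hz]
  have h3 : 𝓝 ((g z : ℂ) : RiemannSphere) = Filter.map (fun w : ℂ => (w : RiemannSphere)) (𝓝 (g z)) :=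
    OnePoint.nhds_coe_eq _
  rw [h3, OnePoint.nhds_coe_eq, Filter.map_map]
  calc Filter.map (fun w : ℂ => (w : RiemannSphere)) (𝓝 (g z))
      ≤ Filter.map (fun w : ℂ => (w : RiemannSphere)) (Filter.map g (𝓝 z)) := Filter.map_mono hopen
    _ = Filter.map (f ∘ fun w : ℂ => (w : RiemannSphere)) (𝓝 z) := by
        rw [Filter.map_map]
        apply Filter.map_congr
        filter_upwards [hev] with w hw
        exact (hfg w hw).symm

/-- constant fibre cardinality and openness give a covering -/
lemma cover_of_card {f : RiemannSphere → RiemannSphere} (hf : Continuous f) (ho : IsOpenMap f)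
    (hfib : ∀ y, (f ⁻¹' {y}).Finite) {s : Set RiemannSphere} (hs : IsOpen s) {m : ℕ}
    (hm : ∀ y ∈ s, (f ⁻¹' {y}).ncard = m) : IsCoveringMapOn f s := by
  refine hf.isClosedMap.isCoveringMapOn_of_isLocalHomeomorphOn (fun x _ => hfib x) ?_
  intro x0 hx0
  have hfin := hfib (f x0)
  obtain ⟨U, hU, hUd⟩ := hfin.t2_separation
  -- common neighbourhood of values
  have hO : (⋂ z ∈ f ⁻¹' {f x0}, f '' U z) ∩ s ∈ 𝓝 (f x0) := by
    refine Filter.inter_mem ((Filter.biInter_mem hfin).2 ?_) (hs.mem_nhds hx0)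
    intro z hz
    have : f z = f x0 := hz
    rw [← this]
    exact ho.image_mem_nhds ((hU z).2.mem_nhds (hU z).1)
  obtain ⟨O, hOs, hOo, hxO⟩ := mem_nhds_iff.1 hO
  have hx0f : x0 ∈ f ⁻¹' {f x0} := rfl
  have hinj : Set.InjOn f (U x0 ∩ f ⁻¹' O) := by
    rintro a ⟨haU, haO⟩ b ⟨hbU, hbO⟩ hab
    by_contra hne
    -- too many preimages of f a
    have hy := hOs haO
    have hex : ∀ z : f ⁻¹' {f x0}, ∃ w ∈ U z, f w = f a := fun z =>
      Set.mem_iInter₂.1 hy.1 z.1 z.2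
    choose g hgU hgf using hex
    have hginj : Function.Injective g := by
      intro z z' h
      by_contra hzz
      have := hUd z.2 z'.2 (fun h => hzz (Subtype.ext h))
      exact Set.disjoint_left.1 this (hgU z) (h ▸ hgU z')
    have hcr : (Set.range g).ncard = m := by
      rw [← Set.image_univ, Set.ncard_image_of_injective _ hginj, Set.ncard_univ]
      exact hm _ hx0
    have hsub : Set.range g ⊆ f ⁻¹' {f a} := by
      rintro _ ⟨z, rfl⟩; exact hgf z
    have heq : Set.range g = f ⁻¹' {f a} :=
      Set.eq_of_subset_of_ncard_le hsub (by rw [hcr, hm _ hy.2]) (hfib _)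
    have hone : ∀ c, c ∈ U x0 → f c = f a → c = g ⟨x0, hx0f⟩ := by
      intro c hc hca
      have : c ∈ Set.range g := by rw [heq]; exact hca
      obtain ⟨z, rfl⟩ := this
      congr 1
      by_contra hzz
      have := hUd z.2 hx0f (fun h => hzz (Subtype.ext h))
      exact Set.disjoint_left.1 this (hgU z) hc
    exact hne ((hone a haU rfl).trans (hone b hbU hab.symm).symm)
  have hWo : IsOpen (U x0 ∩ f ⁻¹' O) := (hU x0).2.inter (hOo.preimage hf)
  have hemb : IsOpenEmbedding (f ∘ (Subtype.val : ↥(U x0 ∩ f ⁻¹' O) → RiemannSphere)) :=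
    .of_continuous_injective_isOpenMap (hf.comp continuous_subtype_val)
      (fun a b h => Subtype.ext (hinj a.2 b.2 h)) (ho.comp hWo.isOpenMap_subtype_val)
  have := (isLocalHomeomorphOn_iff_isOpenEmbedding_restrict (f := f) (s := {x0})).2 ?_
  · exact this x0 rfl
  · rintro x rfl
    exact ⟨_, hWo.mem_nhds ⟨(hU _).1, hxO⟩, hemb⟩

end PCL

namespace PCL
open Metric

/-- a family of paths lifting an isotopy is continuous at a point over a fixed point -/
lemma tube_cont {f : RiemannSphere → RiemannSphere} (hf : Continuous f)
    (V : Set RiemannSphere) (hfin : (f ⁻¹' V).Finite)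
    (H : C(ℝ × RiemannSphere, RiemannSphere)) (HV : ∀ t, ∀ v ∈ V, H (t, v) = v)
    (K : unitInterval × RiemannSphere → RiemannSphere)
    (hK : ∀ t x, f (K (t, x)) = H ((t : ℝ), f x)) (hK0 : ∀ x, K (0, x) = x)
    (hKc : ∀ x, Continuous fun t => K (t, x))
    {x0 : RiemannSphere} (hx0 : f x0 ∈ V) (hfixed : ∀ t, K (t, x0) = x0) (t0 : unitInterval) :
    ContinuousAt K (t0, x0) := by
  rw [ContinuousAt, hfixed t0]
  intro N hN
  have hEf : (f ⁻¹' V \ {x0}).Finite := hfin.sdiff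
  have hW : N ∩ (f ⁻¹' V \ {x0})ᶜ ∈ 𝓝 x0 :=
    Filter.inter_mem hN (hEf.isClosed.isOpen_compl.mem_nhds (by simp))
  obtain ⟨C, hC, hCc, hCW⟩ := exists_mem_nhds_isClosed_subset hW
  set B := interior C with hB
  have hBo : IsOpen B := isOpen_interior
  have hx0B : x0 ∈ B := mem_interior_iff_mem_nhds.2 hC
  have hclB : closure B ⊆ C := hCc.closure_subset_iff.2 interior_subset
  have hfr : IsCompact (f '' frontier B) := (isClosed_frontier.isCompact).image hf
  have hy0 : f x0 ∉ f '' frontier B := by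
    rintro ⟨z, hz, hzx⟩
    have hzK := hCW (hclB hz.1)
    have hne : z ≠ x0 := by
      rintro rfl
      exact hz.2 (by rwa [hBo.interior_eq])
    exact hzK.2 ⟨by change f z ∈ V; rw [hzx]; exact hx0, hne⟩
  have hQ : IsOpen {q : unitInterval × RiemannSphere | H ((q.1 : ℝ), q.2) ∈ (f '' frontier B)ᶜ} := by
    refine hfr.isClosed.isOpen_compl.preimage ?_
    fun_prop
  obtain ⟨u, v, hu, hv, hIu, hxv, huv⟩ := generalized_tube_lemma
    (isCompact_univ (X := unitInterval)) (isCompact_singleton (x := f x0)) hQ (by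
      rintro ⟨t, y⟩ ⟨-, hy⟩
      have : y = f x0 := hy
      subst this
      change H ((t : ℝ), f x0) ∉ _
      rw [HV _ _ hx0]
      exact hy0)
  have hnb : Set.univ ×ˢ (B ∩ f ⁻¹' v) ∈ 𝓝 ((t0, x0) : unitInterval × RiemannSphere) :=
    (isOpen_univ.prod (hBo.inter (hv.preimage hf))).mem_nhds ⟨trivial, hx0B, hxv rfl⟩
  rw [Filter.mem_map]
  refine Filter.mem_of_superset hnb ?_
  rintro ⟨t, x⟩ ⟨-, hxB, hxv'⟩
  have hr : IsPreconnected (Set.range fun t => K (t, x)) := isPreconnected_range (hKc x)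
  have hsub : (Set.range fun t => K (t, x)) ⊆ B := by
    apply hr.subset_left_of_subset_union hBo (isClosed_closure (s := B)).isOpen_compl
    · rw [Set.disjoint_left]
      intro z hz hz'
      exact hz' (subset_closure hz)
    · rintro _ ⟨s, rfl⟩
      by_cases h : K (s, x) ∈ closure B
      · left
        by_contra hnB
        have h1 : ((s, f x) : unitInterval × RiemannSphere) ∈ u ×ˢ v := ⟨hIu trivial, hxv'⟩
        have h2 := huv h1
        exact h2 ⟨K (s, x), ⟨h, by rwa [hBo.interior_eq]⟩, hK s x⟩
      · exact Or.inr h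
    · exact ⟨x, ⟨0, hK0 x⟩, hxB⟩
  exact (hCW (interior_subset (hsub ⟨t, rfl⟩))).1

lemma lift_isotopy {f : RiemannSphere → RiemannSphere} (hf : Continuous f)
    (V : Set RiemannSphere) (hVf : V.Finite) (hfib : ∀ y, (f ⁻¹' {y}).Finite)
    (hcov : IsCoveringMapOn f Vᶜ) {m : ℕ}
    (hm : ∀ y ∈ Vᶜ, (f ⁻¹' {y}).ncard = m) (hVfix : ∀ v ∈ V, f v = v)
    (H : C(ℝ × RiemannSphere, RiemannSphere)) (H0 : ∀ x, H (0, x) = x)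
    (Hb : ∀ t, Function.Bijective fun x => H (t, x)) (HV : ∀ t, ∀ v ∈ V, H (t, v) = v) :
    ∃ K : C(ℝ × RiemannSphere, RiemannSphere), (∀ x, K (0, x) = x) ∧
      (∀ t, Function.Bijective fun x => K (t, x)) ∧ (∀ t, ∀ v ∈ V, K (t, v) = v) ∧
      ∀ x, f (K (1, x)) = H (1, f x) := by
  classical
  have hfin : (f ⁻¹' V).Finite := by
    have : f ⁻¹' V = ⋃ v ∈ V, f ⁻¹' {v} := by ext; simp
    rw [this]
    exact hVf.biUnion fun v _ => hfib v
  have hHV : ∀ t y, y ∉ V → H (t, y) ∉ V := by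
    intro t y hy h
    have h1 : H (t, H (t, y)) = H (t, y) := HV t _ h
    have h2 : H (t, y) = y := (Hb t).1 h1
    exact hy (h2 ▸ h)
  have cov := hcov.isCoveringMap_restrictPreimage
  let HH : C(unitInterval × ↥(f ⁻¹' Vᶜ), ↥(Vᶜ)) :=
    ⟨fun q => ⟨H ((q.1 : ℝ), f q.2.1), hHV _ _ q.2.2⟩, by
      refine Continuous.subtype_mk ?_ _
      fun_prop⟩
  have hHH0 : ∀ a, HH (0, a) = (Vᶜ).restrictPreimage f ((ContinuousMap.id _) a) := by
    intro a
    apply Subtype.ext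
    exact H0 _
  let L := cov.liftHomotopy HH (ContinuousMap.id _) hHH0
  have hL1 : ∀ t a, f (L (t, a)).1 = H ((t : ℝ), f a.1) := by
    intro t a
    have := congrFun (cov.liftHomotopy_lifts HH (ContinuousMap.id _) hHH0) (t, a)
    exact congrArg Subtype.val this
  have hL0 : ∀ a, L (0, a) = a := cov.liftHomotopy_zero HH (ContinuousMap.id _) hHH0
  have hLinj : ∀ t a b, f a.1 = f b.1 → L (t, a) = L (t, b) → a = b := by
    intro t a b hab h
    have h1 : Continuous fun s : unitInterval => L (s, a) := by fun_prop
    have h2 : Continuous fun s : unitInterval => L (s, b) := by fun_prop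
    have h3 := cov.eq_of_comp_eq h1 h2 (by
      funext s
      apply Subtype.ext
      change f (L (s, a)).1 = f (L (s, b)).1
      rw [hL1, hL1, hab]) t h
    have h4 := congrFun h3 0
    simp only [hL0] at h4
    exact h4
  let K : unitInterval × RiemannSphere → RiemannSphere := fun q =>
    if h : q.2 ∈ f ⁻¹' Vᶜ then (L (q.1, ⟨q.2, h⟩)).1 else q.2
  have hK1 : ∀ t x (h : x ∈ f ⁻¹' Vᶜ), K (t, x) = (L (t, ⟨x, h⟩)).1 := by
    intro t x h
    simp only [K, dif_pos h]
  have hK2 : ∀ t x, f x ∈ V → K (t, x) = x := by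
    intro t x h
    have : x ∉ f ⁻¹' Vᶜ := fun h' => h' h
    simp only [K, dif_neg this]
  have hKf : ∀ t x, f (K (t, x)) = H ((t : ℝ), f x) := by
    intro t x
    by_cases h : f x ∈ V
    · rw [hK2 t x h, HV _ _ h]
    · rw [hK1 t x h, hL1]
  have hK0 : ∀ x, K (0, x) = x := by
    intro x
    by_cases h : f x ∈ V
    · rw [hK2 _ x h]
    · rw [hK1 _ x h, hL0]
  have hKc : ∀ x, Continuous fun t => K (t, x) := by
    intro x
    by_cases h : f x ∈ V
    · have : (fun t => K (t, x)) = fun _ => x := funext fun t => hK2 t x h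
      rw [this]; exact continuous_const
    · have : (fun t => K (t, x)) = fun t => (L (t, ⟨x, h⟩)).1 := funext fun t => hK1 t x h
      rw [this]
      fun_prop
  have hopen : IsOpen (f ⁻¹' Vᶜ) := hVf.isClosed.isOpen_compl.preimage hf
  have hcont : Continuous K := by
    rw [continuous_iff_continuousAt]
    rintro ⟨t, x⟩
    by_cases h : f x ∈ V
    · exact tube_cont hf V hfin H HV K hKf hK0 hKc h (fun s => hK2 s x h) t
    · have hon : ContinuousOn K (Set.univ ×ˢ (f ⁻¹' Vᶜ)) := by
        rw [continuousOn_iff_continuous_domRestrict]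
        have : (Set.univ ×ˢ (f ⁻¹' Vᶜ)).domRestrict K =
            fun q : ↥((Set.univ : Set unitInterval) ×ˢ (f ⁻¹' Vᶜ)) => (L (q.1.1, ⟨q.1.2, q.2.2⟩)).1 := by
          funext q
          exact hK1 q.1.1 q.1.2 q.2.2
        rw [this]
        refine continuous_subtype_val.comp (L.continuous.comp ?_)
        refine Continuous.prodMk (by fun_prop) (Continuous.subtype_mk (by fun_prop) _)
      exact hon.continuousAt ((isOpen_univ.prod hopen).mem_nhds ⟨trivial, h⟩)
  have hKinj : ∀ t, Function.Injective fun x => K (t, x) := by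
    intro t x x' hxx
    have hxx' : K (t, x) = K (t, x') := hxx
    have h1 : H ((t : ℝ), f x) = H ((t : ℝ), f x') := by rw [← hKf, ← hKf, hxx']
    have h2 : f x = f x' := (Hb t).1 h1
    by_cases h : f x ∈ V
    · rw [hK2 t x h, hK2 t x' (h2 ▸ h)] at hxx'
      exact hxx'
    · have h' : f x' ∉ V := h2 ▸ h
      rw [hK1 t x h, hK1 t x' h'] at hxx'
      exact congrArg Subtype.val (hLinj t ⟨x, h⟩ ⟨x', h'⟩ h2 (Subtype.ext hxx'))
  have hKsurj : ∀ t, Function.Surjective fun x => K (t, x) := by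
    intro t z
    obtain ⟨y, hy⟩ := (Hb t).2 (f z)
    have hy' : H ((t : ℝ), y) = f z := hy
    by_cases h : y ∈ V
    · rw [HV _ _ h] at hy'
      exact ⟨z, hK2 t z (hy' ▸ h)⟩
    · have hz : f z ∉ V := hy' ▸ hHV t y h
      have hsub : (fun x => K (t, x)) '' (f ⁻¹' {y}) ⊆ f ⁻¹' {f z} := by
        rintro _ ⟨x, hx, rfl⟩
        have hx' : f x = y := hx
        change f (K (t, x)) = f z
        rw [hKf, hx', hy']
      have heq := Set.eq_of_subset_of_ncard_le hsub (by
        rw [Set.ncard_image_of_injective _ (hKinj t), hm y h, hm _ hz]) (hfib _)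
      have : z ∈ (fun x => K (t, x)) '' (f ⁻¹' {y}) := by rw [heq]; rfl
      obtain ⟨x, -, hx⟩ := this
      exact ⟨x, hx⟩
  refine ⟨⟨fun q => K (Set.projIcc 0 1 zero_le_one q.1, q.2), ?_⟩, ?_, ?_, ?_, ?_⟩
  · refine hcont.comp (Continuous.prodMk ?_ (by fun_prop))
    exact continuous_projIcc.comp continuous_fst
  · intro x
    change K (Set.projIcc 0 1 zero_le_one (0 : ℝ), x) = x
    rw [Set.projIcc_left]
    exact hK0 x
  · intro t
    exact ⟨hKinj (Set.projIcc 0 1 zero_le_one t), hKsurj (Set.projIcc 0 1 zero_le_one t)⟩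
  · intro t v hv
    exact hK2 _ v (by rw [hVfix v hv]; exact hv)
  · intro x
    change f (K (Set.projIcc 0 1 zero_le_one (1 : ℝ), x)) = H (1, f x)
    rw [Set.projIcc_right, hKf]

end PCL

namespace PCL

lemma interNum_attain (bd : BlowupData RiemannSphere) (j : Fin bd.n) {Γ : Set RiemannSphere}
    (hΓ : IsSimpleClosedCurve Γ) (hΓP : Γ ∩ ↑bd.Vset = ∅) :
    ∃ Γ', IsotopicRel Γ Γ' ↑bd.Vset ∧ (Γ' ∩ bd.edge j).Finite ∧
      (Γ' ∩ bd.edge j).ncard = interNum Γ (bd.edge j) ↑bd.Vset := by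
  obtain ⟨Γ1, h1, h2⟩ := finite_rep bd j hΓ hΓP
  exact Nat.sInf_mem (s := {n : ℕ | ∃ A' : Set RiemannSphere, IsotopicRel Γ A' ↑bd.Vset ∧
    (A' ∩ bd.edge j).Finite ∧ (A' ∩ bd.edge j).ncard = n}) ⟨_, Γ1, h1, h2, rfl⟩

/-- sum over a finite family of pullbacks, one edge -/
lemma edge_sum (F : RatFunc ℂ) (bd : BlowupData RiemannSphere) (hmap : bd.toFun = evalSphere F)
    {Γ : Set RiemannSphere} (hΓ : IsSimpleClosedCurve Γ) (hΓP : Γ ∩ ↑bd.Vset = ∅) (j : Fin bd.n)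
    (A : Finset (Set RiemannSphere)) (hA : ∀ δ ∈ A, δ ∈ pullbacks bd.toFun Γ) :
    ∑ δ ∈ A, interNum δ (bd.edge j) ↑bd.Vset ≤ interNum Γ (bd.edge j) ↑bd.Vset := by
  classical
  obtain ⟨Γ', ⟨H, H0, Hb, HV, HΓ⟩, hfin, hcard⟩ := interNum_attain bd j hΓ hΓP
  have hf := bd.continuous_toFun
  have hfib := bd_fib_finite bd
  have hcov : IsCoveringMapOn bd.toFun (↑bd.Vset : Set RiemannSphere)ᶜ :=
    cover_of_card hf (rat_open hf hfib F hmap) hfib bd.Vset.finite_toSet.isClosed.isOpen_compl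
      (fun y hy => bd_fib_card bd hy)
  obtain ⟨K, K0, Kb, KV, Kf⟩ := lift_isotopy hf (↑bd.Vset : Set RiemannSphere)
    bd.Vset.finite_toSet hfib hcov (fun y hy => bd_fib_card bd hy) bd.fixes_vertices H H0 Hb HV
  set k : RiemannSphere → RiemannSphere := fun x => K (1, x) with hk
  have hkinj : Function.Injective k := (Kb 1).1
  set Q := (bd.toFun ⁻¹' Γ') ∩ bd.side1 j with hQ
  have hmapsQ : Set.MapsTo bd.toFun Q (Γ' ∩ bd.edge j) := fun x hx =>
    ⟨hx.1, (bd.maps_side1 j).mapsTo hx.2⟩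
  have hinjQ : Set.InjOn bd.toFun Q := (bd.maps_side1 j).injOn.mono Set.inter_subset_right
  have hQfin : Q.Finite := Set.Finite.of_injOn hmapsQ hinjQ hfin
  have hQcard : Q.ncard ≤ interNum Γ (bd.edge j) ↑bd.Vset := by
    rw [← hcard]
    exact Set.ncard_le_ncard_of_injOn bd.toFun hmapsQ hinjQ hfin
  have hδ : ∀ δ ∈ A, δ ⊆ bd.toFun ⁻¹' Γ := by
    intro δ hδ
    obtain ⟨x, hx, rfl⟩ := hA δ hδ
    exact connectedComponentIn_subset _ _
  have hkδ : ∀ δ ∈ A, k '' δ ∩ bd.side1 j ⊆ Q := by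
    rintro δ hδA _ ⟨⟨x, hx, rfl⟩, h2⟩
    refine ⟨?_, h2⟩
    change bd.toFun (K (1, x)) ∈ Γ'
    rw [Kf, ← HΓ]
    exact ⟨_, hδ δ hδA hx, rfl⟩
  have hone : ∀ δ ∈ A, interNum δ (bd.edge j) ↑bd.Vset ≤ (k '' δ ∩ bd.side1 j).ncard := by
    intro δ hδA
    obtain ⟨G, G0, Gb, GV, Ge⟩ := bd.side1_isotopic j
    have hI1 : IsotopicRel δ (k '' δ) ↑bd.Vset := ⟨K, K0, Kb, KV, rfl⟩
    have hI2 : IsotopicRel (k '' δ) ((fun x => G (1, x)) '' (k '' δ)) ↑bd.Vset :=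
      ⟨G, G0, Gb, GV, rfl⟩
    have heq : (fun x => G (1, x)) '' (k '' δ) ∩ bd.edge j =
        (fun x => G (1, x)) '' (k '' δ ∩ bd.side1 j) := by
      rw [← Ge, Set.image_inter (Gb 1).1]
    refine Nat.sInf_le ⟨_, iso_trans hI1 hI2, ?_, ?_⟩
    · rw [heq]
      exact (hQfin.subset (hkδ δ hδA)).image _
    · rw [heq, Set.ncard_image_of_injective _ (Gb 1).1]
  refine (Finset.sum_le_sum hone).trans (le_trans ?_ hQcard)
  have hfinδ : ∀ δ ∈ A, (k '' δ ∩ bd.side1 j).Finite := fun δ h => hQfin.subset (hkδ δ h)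
  let φ : Set RiemannSphere → Finset RiemannSphere := fun δ =>
    hQfin.toFinset.filter (fun x => x ∈ k '' δ ∩ bd.side1 j)
  have hφ : ∀ δ ∈ A, (k '' δ ∩ bd.side1 j).ncard = (φ δ).card := by
    intro δ h
    rw [← Set.ncard_coe_finset]
    congr 1
    ext x
    simp only [φ, Finset.coe_filter, Set.Finite.mem_toFinset]
    exact ⟨fun hx => ⟨hkδ δ h hx, hx⟩, fun hx => hx.2⟩
  rw [Finset.sum_congr rfl hφ, ← Finset.card_biUnion]
  · rw [Set.ncard_eq_toFinset_card Q hQfin]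
    apply Finset.card_le_card
    intro x hx
    obtain ⟨δ, -, hx⟩ := Finset.mem_biUnion.1 hx
    exact (Finset.mem_filter.1 hx).1
  · intro δ hδA δ' hδ'A hne
    rw [Function.onFun, Finset.disjoint_left]
    intro x hx hx'
    obtain ⟨⟨a, ha, hax⟩, -⟩ := (Finset.mem_filter.1 hx).2
    obtain ⟨⟨b, hb, hbx⟩, -⟩ := (Finset.mem_filter.1 hx').2
    have hab : a = b := hkinj (hax.trans hbx.symm)
    subst hab
    apply hne
    obtain ⟨z, hz, rfl⟩ := hA δ hδA
    obtain ⟨z', hz', rfl⟩ := hA δ' hδ'A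
    exact (connectedComponentIn_eq ha).trans (connectedComponentIn_eq hb).symm

end PCL


/-- Lemma 6.1(1): Let `f` be a critically fixed rational map, obtained by
blowing up the edges of its (connected) charge graph `G` with vertex set `C_f` (the data
`bd`), and let `S` be a spanning tree of `G` with edge set indexed by `T`. For any simple
closed curve `γ` in `Ĉ \ C_f`, the total complexity of the pullbacks of `γ` under `f` is
at most the complexity of `γ`: `Σ_{δ ∈ Δ(γ)} δ·S ≤ γ·S`. -/
theorem pullback_complexity_le (F : RatFunc ℂ) (hdeg : 2 ≤ rdeg F) (hcf : CriticallyFixed F)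
    (bd : BlowupData RiemannSphere)
    (hmap : bd.toFun = evalSphere F)
    (hVcrit : ↑bd.Vset = {z : RiemannSphere | 2 ≤ locDeg F z})
    (hGconn : IsConnected (⋃ j, bd.edge j)) (hGspan : ↑bd.Vset ⊆ ⋃ j, bd.edge j)
    (T : Finset (Fin bd.n))
    (hTcard : T.card = bd.Vset.card - 1)
    (hTconn : IsConnected (⋃ j ∈ T, bd.edge j))
    (hTspan : ↑bd.Vset ⊆ ⋃ j ∈ T, bd.edge j)
    (Γ : Set RiemannSphere) (hΓ : IsSimpleClosedCurve Γ) (hΓP : Γ ∩ ↑bd.Vset = ∅) :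
    ∑ᶠ δ ∈ pullbacks bd.toFun Γ, complexity bd T δ ≤ complexity bd T Γ := by
  classical
  by_cases hs : (pullbacks bd.toFun Γ ∩ Function.support (complexity bd T)).Finite
  · rw [finsum_mem_eq_sum _ hs]
    simp only [complexity]
    rw [Finset.sum_comm]
    refine Finset.sum_le_sum fun j _ => ?_
    refine PCL.edge_sum F bd hmap hΓ hΓP j _ ?_
    intro δ hδ
    exact ((Set.Finite.mem_toFinset _).1 hδ).1
  · rw [finsum_mem_eq_zero_of_infinite hs]
    exact Nat.zero_le _
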